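/- Assume (B0)–(B3), fix ȳ ∈ cl V, and let ũ : cl U_ȳ → ℝ be the modified potential of a c-convex function (so ũ has convex level sets). Let Q := {ũ ≤ 0} ⊂ cl U_ȳ (a convex set), let E be the ellipsoid given by John's Lemma for Q (so E ⊂ Q ⊂ n·E after centering), and suppose there is a small ellipsoid E_δ = x₀ + δ·E ⊂ Q with δ ≤ min{1, ε_c/(4 diam E)} such that |∂^{c̃}ũ| ≥ λ > 0 inside E_δ, and E_δ ⊂ B ⊂ 4·B ⊂ U_ȳ for some ball B (4·B its dilation by factor 4 about its center). Then there exists a constant C(n), depending only on the dimension, such that Lebⁿ(Q)² ≤ C(n) (γ^−_{c̃}/(δ^{2n} λ)) |inf_Q ũ|ⁿ, where γ^−_{c̃} = γ^−_{c̃}(Q × V). -/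

import Mathlib

open Set MeasureTheory Metric Bornology
open scoped ENNReal NNReal Pointwise

noncomputable section

abbrev Euc (n : ℕ) := EuclideanSpace ℝ (Fin n)

/-- Partial gradient of the cost in the first variable: `D_x c(x,y)`. -/
noncomputable def gradX (n : ℕ) (c : Euc n → Euc n → ℝ) (x y : Euc n) : Euc n :=
  gradient (fun x' => c x' y) x

/-- Partial gradient of the cost in the second variable: `D_y c(x,y)`. -/
noncomputable def gradY (n : ℕ) (c : Euc n → Euc n → ℝ) (x y : Euc n) : Euc n :=
  gradient (fun y' => c x y') y

/-- Mixed second derivative `D²_{xy} c` as a continuous linear map. -/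
noncomputable def DxyC (n : ℕ) (c : Euc n → Euc n → ℝ) (x y : Euc n) : Euc n →L[ℝ] Euc n :=
  fderiv ℝ (fun x' => gradY n c x' y) x

/-- Second derivative `D²_{xx} c`. -/
noncomputable def DxxC (n : ℕ) (c : Euc n → Euc n → ℝ) (x y : Euc n) : Euc n →L[ℝ] Euc n :=
  fderiv ℝ (fun x' => gradX n c x' y) x

/-- Third derivative `D²_{xx} D_y c`. -/
noncomputable def DxxyC (n : ℕ) (c : Euc n → Euc n → ℝ) (x y : Euc n) :
    Euc n →L[ℝ] Euc n →L[ℝ] Euc n :=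
  fderiv ℝ (fun x' => DxyC n c x' y) x

/-- `β⁺_c = ‖D²_{xy} c‖_{L∞(U×V)}`. -/
noncomputable def betaPlus (n : ℕ) (c : Euc n → Euc n → ℝ) (U V : Set (Euc n)) : ℝ :=
  sSup ((fun p : Euc n × Euc n => ‖DxyC n c p.1 p.2‖) '' (U ×ˢ V))

/-- `β⁻_c = ‖(D²_{xy} c)⁻¹‖_{L∞(U×V)}`. -/
noncomputable def betaMinus (n : ℕ) (c : Euc n → Euc n → ℝ) (U V : Set (Euc n)) : ℝ :=
  sSup ((fun p : Euc n × Euc n => ‖(DxyC n c p.1 p.2).inverse‖) '' (U ×ˢ V))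

/-- `γ⁺_c = ‖det D²_{xy} c‖_{L∞(U×V)}`. -/
noncomputable def gammaPlus (n : ℕ) (c : Euc n → Euc n → ℝ) (U V : Set (Euc n)) : ℝ :=
  sSup ((fun p : Euc n × Euc n =>
    |LinearMap.det ((DxyC n c p.1 p.2 : Euc n →L[ℝ] Euc n) : Euc n →ₗ[ℝ] Euc n)|) '' (U ×ˢ V))

/-- `γ⁻_c = ‖(det D²_{xy} c)⁻¹‖_{L∞(U×V)}`. -/
noncomputable def gammaMinus (n : ℕ) (c : Euc n → Euc n → ℝ) (U V : Set (Euc n)) : ℝ :=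
  sSup ((fun p : Euc n × Euc n =>
    |LinearMap.det ((DxyC n c p.1 p.2 : Euc n →L[ℝ] Euc n) : Euc n →ₗ[ℝ] Euc n)|⁻¹) '' (U ×ˢ V))

noncomputable def supDxx (n : ℕ) (c : Euc n → Euc n → ℝ) (U V : Set (Euc n)) : ℝ :=
  sSup ((fun p : Euc n × Euc n => ‖DxxC n c p.1 p.2‖) '' (U ×ˢ V))

noncomputable def supDx (n : ℕ) (c : Euc n → Euc n → ℝ) (U V : Set (Euc n)) : ℝ :=
  sSup ((fun p : Euc n × Euc n => ‖gradX n c p.1 p.2‖) '' (U ×ˢ V))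

noncomputable def supDxxy (n : ℕ) (c : Euc n → Euc n → ℝ) (U V : Set (Euc n)) : ℝ :=
  sSup ((fun p : Euc n × Euc n => ‖DxxyC n c p.1 p.2‖) '' (U ×ˢ V))

/-- The constant `M_c` from Theorem 4.3. -/
noncomputable def Mconst (n : ℕ) (c : Euc n → Euc n → ℝ) (U V : Set (Euc n)) : ℝ :=
  (betaMinus n c U V) ^ 2 * supDxx n c U V +
    (betaMinus n c U V) ^ 3 * supDx n c U V * supDxxy n c U V

/-- The constant `ε_c` of Lemma 6.1: `1/ε_c = 2 (β⁺)⁴ (β⁻)⁶ ‖D³_{xxy} c‖_∞`. -/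
noncomputable def epsC (n : ℕ) (c : Euc n → Euc n → ℝ) (U V : Set (Euc n)) : ℝ :=
  (2 * (betaPlus n c U V) ^ 4 * (betaMinus n c U V) ^ 6 * supDxxy n c U V)⁻¹

/-- Condition (B0). -/
def B0cond (n : ℕ) (c : Euc n → Euc n → ℝ) (U V : Set (Euc n)) : Prop :=
  IsOpen U ∧ IsBounded U ∧ IsOpen V ∧ IsBounded V ∧
    ContDiffOn ℝ 4 (Function.uncurry c) (closure U ×ˢ closure V)

/-- `f` is a (C¹-) diffeomorphism from `S` onto its range. -/
def DiffeoOnto (n : ℕ) (f : Euc n → Euc n) (S : Set (Euc n)) : Prop :=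
  Set.InjOn f S ∧ ContDiffOn ℝ 1 f S ∧ ContDiffOn ℝ 1 (Function.invFunOn f S) (f '' S)

/-- Condition (B1) (bi-twist). -/
def B1cond (n : ℕ) (c : Euc n → Euc n → ℝ) (U V : Set (Euc n)) : Prop :=
  (∀ y ∈ closure V, DiffeoOnto n (fun x => -gradY n c x y) (closure U)) ∧
  (∀ x ∈ closure U, DiffeoOnto n (fun y => -gradX n c x y) (closure V))

/-- `U_ȳ := -D_y c(U, ȳ)`. -/
def Uyset (n : ℕ) (c : Euc n → Euc n → ℝ) (U : Set (Euc n)) (ybar : Euc n) : Set (Euc n) :=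
  (fun x => -gradY n c x ybar) '' U

/-- `V_x̄ := -D_x c(x̄, V)`. -/
def Vxset (n : ℕ) (c : Euc n → Euc n → ℝ) (V : Set (Euc n)) (xbar : Euc n) : Set (Euc n) :=
  (fun y => -gradX n c xbar y) '' V

/-- Condition (B2) (bi-convexity). -/
def B2cond (n : ℕ) (c : Euc n → Euc n → ℝ) (U V : Set (Euc n)) : Prop :=
  (∀ y ∈ closure V, Convex ℝ (Uyset n c U y)) ∧ (∀ x ∈ closure U, Convex ℝ (Vxset n c V x))

/-- A strongly convex set: each boundary point is touched from outside by a sphere of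
radius `R` enclosing the set. -/
def StronglyConvexSet (n : ℕ) (Q : Set (Euc n)) : Prop :=
  Convex ℝ Q ∧ ∃ R : ℝ, 0 < R ∧ ∀ x ∈ frontier Q, ∃ z : Euc n, dist x z = R ∧ Q ⊆ closedBall z R

/-- Condition (B2s). -/
def B2scond (n : ℕ) (c : Euc n → Euc n → ℝ) (U V : Set (Euc n)) : Prop :=
  (∀ y ∈ closure V, StronglyConvexSet n (Uyset n c U y)) ∧
  (∀ x ∈ closure U, StronglyConvexSet n (Vxset n c V x))

/-- An affinely parameterized line segment on `[-1,1]`. -/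
def IsAffineSeg (n : ℕ) (F : ℝ → Euc n × Euc n) : Prop :=
  ∃ a b : Euc n × Euc n, ∀ t ∈ Icc (-1 : ℝ) 1, F t = a + t • b

/-- `∂²/∂s∂t c(x(s), y(t))` at `(0,0)`. -/
noncomputable def crossDiff2 (n : ℕ) (c : Euc n → Euc n → ℝ) (x y : ℝ → Euc n) : ℝ :=
  deriv (fun s => deriv (fun t => c (x s) (y t)) 0) 0

/-- `∂⁴/∂s²∂t² c(x(s), y(t))` at `(0,0)`. -/
noncomputable def crossDiff4 (n : ℕ) (c : Euc n → Euc n → ℝ) (x y : ℝ → Euc n) : ℝ :=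
  deriv (deriv (fun s => deriv (deriv (fun t => c (x s) (y t))) 0)) 0

/-- Condition (B3) (= A3w). -/
def B3cond (n : ℕ) (c : Euc n → Euc n → ℝ) (U V : Set (Euc n)) : Prop :=
  ∀ x y : ℝ → Euc n, (∀ t ∈ Icc (-1 : ℝ) 1, x t ∈ closure U) →
    (∀ t ∈ Icc (-1 : ℝ) 1, y t ∈ closure V) →
    IsAffineSeg n (fun t => (gradY n c (x t) (y 0), gradX n c (x 0) (y t))) →
    crossDiff2 n c x y = 0 → crossDiff4 n c x y ≤ 0

/-- Condition (B4) (non-negative cross-curvature). -/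
def B4cond (n : ℕ) (c : Euc n → Euc n → ℝ) (U V : Set (Euc n)) : Prop :=
  ∀ x y : ℝ → Euc n, (∀ t ∈ Icc (-1 : ℝ) 1, x t ∈ closure U) →
    (∀ t ∈ Icc (-1 : ℝ) 1, y t ∈ closure V) →
    IsAffineSeg n (fun t => (gradY n c (x t) (y 0), gradX n c (x 0) (y t))) →
    crossDiff4 n c x y ≤ 0

/-- The `c*`-transform `u^{c*}(y) = sup_{x ∈ A} (-c(x,y) - u(x))`. -/
noncomputable def cStarT (n : ℕ) (c : Euc n → Euc n → ℝ) (A : Set (Euc n)) (u : Euc n → ℝ)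
    (y : Euc n) : ℝ :=
  sSup ((fun x => -c x y - u x) '' A)

/-- `u` is `c`-convex on `A` (relative to the target set `B`): `u = (u^{c*})^c`. -/
def CConvexOn (n : ℕ) (c : Euc n → Euc n → ℝ) (A B : Set (Euc n)) (u : Euc n → ℝ) : Prop :=
  ∀ x ∈ A, u x = sSup ((fun y => -c x y - cStarT n c A u y) '' B)

/-- The `c`-subdifferential `∂ᶜu ⊂ A × B`. -/
def cSubdiff (n : ℕ) (c : Euc n → Euc n → ℝ) (A B : Set (Euc n)) (u : Euc n → ℝ) :
    Set (Euc n × Euc n) :=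
  {p | p.1 ∈ A ∧ p.2 ∈ B ∧ u p.1 + cStarT n c A u p.2 + c p.1 p.2 = 0}

def cSubdiffAt (n : ℕ) (c : Euc n → Euc n → ℝ) (A B : Set (Euc n)) (u : Euc n → ℝ)
    (x : Euc n) : Set (Euc n) :=
  {y | (x, y) ∈ cSubdiff n c A B u}

def cSubdiffImg (n : ℕ) (c : Euc n → Euc n → ℝ) (A B : Set (Euc n)) (u : Euc n → ℝ)
    (X : Set (Euc n)) : Set (Euc n) :=
  ⋃ x ∈ X, cSubdiffAt n c A B u x

/-- `∂^{c*}u^{c*}(Y) = {x : ∃ y ∈ Y, (x,y) ∈ ∂ᶜu}`. -/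
def cSubdiffPre (n : ℕ) (c : Euc n → Euc n → ℝ) (A B : Set (Euc n)) (u : Euc n → ℝ)
    (Y : Set (Euc n)) : Set (Euc n) :=
  {x | ∃ y ∈ Y, (x, y) ∈ cSubdiff n c A B u}

/-- `|∂ᶜu| ≥ lam` on `S`. -/
def MAge (n : ℕ) (c : Euc n → Euc n → ℝ) (A B : Set (Euc n)) (u : Euc n → ℝ) (lam : ℝ)
    (S : Set (Euc n)) : Prop :=
  ∀ X : Set (Euc n), X ⊆ S → MeasurableSet X →
    ENNReal.ofReal lam * volume X ≤ volume (cSubdiffImg n c A B u X)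

/-- `|∂ᶜu| ≤ lam` on `S`. -/
def MAle (n : ℕ) (c : Euc n → Euc n → ℝ) (A B : Set (Euc n)) (u : Euc n → ℝ) (lam : ℝ)
    (S : Set (Euc n)) : Prop :=
  ∀ X : Set (Euc n), X ⊆ S → MeasurableSet X →
    volume (cSubdiffImg n c A B u X) ≤ ENNReal.ofReal lam * volume X

/-- The inverse of the cost-exponential coordinate change `q(x) = -D_y c(x, ȳ)`. -/
noncomputable def xOf (n : ℕ) (c : Euc n → Euc n → ℝ) (U : Set (Euc n)) (ybar : Euc n) :
    Euc n → Euc n :=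
  Function.invFunOn (fun x => -gradY n c x ybar) (closure U)

/-- `cl U_ȳ := -D_y c(cl U, ȳ)`. -/
def clUy (n : ℕ) (c : Euc n → Euc n → ℝ) (U : Set (Euc n)) (ybar : Euc n) : Set (Euc n) :=
  (fun x => -gradY n c x ybar) '' closure U

/-- The modified cost `c̃(q,y) = c(x(q), y) - c(x(q), ȳ)`. -/
noncomputable def modCost (n : ℕ) (c : Euc n → Euc n → ℝ) (U : Set (Euc n)) (ybar : Euc n)
    (q y : Euc n) : ℝ :=
  c (xOf n c U ybar q) y - c (xOf n c U ybar q) ybar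

/-- The modified potential `ũ(q) = u(x(q)) + c(x(q), ȳ)`. -/
noncomputable def modPot (n : ℕ) (c : Euc n → Euc n → ℝ) (U : Set (Euc n)) (ybar : Euc n)
    (u : Euc n → ℝ) (q : Euc n) : ℝ :=
  u (xOf n c U ybar q) + c (xOf n c U ybar q) ybar

/-- The `c̃`-cone generated by `qt` and `Q` with height `-h0 > 0`. -/
noncomputable def cConeFun (n : ℕ) (ct : Euc n → Euc n → ℝ) (B Q : Set (Euc n)) (qt : Euc n)
    (h0 : ℝ) (q : Euc n) : ℝ :=
  sSup {r : ℝ | ∃ y ∈ B, r = -ct q y + ct qt y + h0 ∧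
    ∀ p ∈ frontier Q, -ct p y + ct qt y + h0 ≤ 0}

/-- The ordinary subdifferential `∂u(x)` relative to a domain `A`. -/
def subdiffAt (n : ℕ) (A : Set (Euc n)) (u : Euc n → ℝ) (x : Euc n) : Set (Euc n) :=
  {p | ∀ ε > 0, ∃ δ > 0, ∀ x' ∈ A, ‖x' - x‖ < δ →
    u x + @inner ℝ _ _ p (x' - x) - ε * ‖x' - x‖ ≤ u x'}

/-- The dual norm `‖v‖*_K = sup_{w ∈ K} ⟨w, v⟩`. -/
noncomputable def dualNorm (n : ℕ) (K : Set (Euc n)) (v : Euc n) : ℝ :=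
  sSup ((fun w => (@inner ℝ _ _ w v : ℝ)) '' K)

/-- The section `S(x̄, ȳ, τ)`. -/
def sectS (n : ℕ) (c : Euc n → Euc n → ℝ) (U : Set (Euc n)) (u : Euc n → ℝ)
    (xbar ybar : Euc n) (τ : ℝ) : Set (Euc n) :=
  {x ∈ U | u x ≤ u xbar - c x ybar + c xbar ybar + τ}

/-- The measure with density `f` restricted to `A`. -/
noncomputable def densMeasure (n : ℕ) (A : Set (Euc n)) (f : Euc n → ℝ) : Measure (Euc n) :=
  (volume.restrict A).withDensity fun x => ENNReal.ofReal (f x)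

end

open Set MeasureTheory Metric Bornology
open scoped ENNReal NNReal Pointwise

section Abstract

variable {E : Type*} [NormedAddCommGroup E] [InnerProductSpace ℝ E]

/-- Tangential half-space property of a quasi-convex function with nonzero gradient. -/
lemma quasi_tangent (m : E → ℝ) (x₀ p v : E) (a κ : ℝ) (ha : 0 < a) (hp : p ≠ 0)
    (hq : QuasiconvexOn ℝ (closedBall x₀ (2 * a)) m)
    (hl : ∀ q1 ∈ closedBall x₀ (2 * a), ∀ q2 ∈ closedBall x₀ (2 * a),
      |m q1 - m q2 - inner ℝ p (q1 - q2)| ≤ 1 / 4 * ‖p‖ * ‖q1 - q2‖)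
    (hd : ∀ q ∈ closedBall x₀ (2 * a),
      |m q - m x₀ - inner ℝ p (q - x₀)| ≤ κ * ‖p‖ * ‖q - x₀‖ ^ 2)
    (hv : ‖v‖ ≤ a) (hpv : inner ℝ p v = 0) : m x₀ ≤ m (x₀ + v) := by
  by_contra hcon
  push Not at hcon
  have hpn : 0 < ‖p‖ := norm_pos_iff.mpr hp
  obtain ⟨η, hη, hη1, hη2⟩ : ∃ η : ℝ, 0 < η ∧ η * ‖p‖ ≤ a ∧
      5 / 4 * (η * ‖p‖ ^ 2) ≤ m x₀ - m (x₀ + v) := by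
    refine ⟨min (a / ‖p‖) ((m x₀ - m (x₀ + v)) / (5 / 4 * ‖p‖ ^ 2)), ?_, ?_, ?_⟩
    · apply lt_min
      · positivity
      · apply div_pos (by linarith); positivity
    · calc _ ≤ (a / ‖p‖) * ‖p‖ := by gcongr; exact min_le_left _ _
        _ = a := by field_simp
    · calc _ ≤ 5 / 4 * ((m x₀ - m (x₀ + v)) / (5 / 4 * ‖p‖ ^ 2) * ‖p‖ ^ 2) := by
            gcongr; exact min_le_right _ _
        _ = _ := by field_simp
  set z := v + η • p with hz
  have hzn : ‖z‖ ≤ 2 * a := by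
    calc ‖z‖ ≤ ‖v‖ + ‖η • p‖ := norm_add_le _ _
      _ ≤ a + a := by
        gcongr
        rw [norm_smul, Real.norm_eq_abs, abs_of_pos hη]; exact hη1
      _ = 2 * a := by ring
  have hmem0 : x₀ ∈ closedBall x₀ (2 * a) := mem_closedBall_self (by linarith)
  have hmemv : x₀ + v ∈ closedBall x₀ (2 * a) := by
    rw [mem_closedBall, dist_self_add_left]; linarith
  have hmemz : x₀ + z ∈ closedBall x₀ (2 * a) := by
    rw [mem_closedBall, dist_self_add_left]; exact hzn
  have h1 : m (x₀ + z) ≤ m x₀ := by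
    have := hl _ hmemz _ hmemv
    have e : x₀ + z - (x₀ + v) = η • p := by rw [hz]; abel
    rw [e, inner_smul_right, real_inner_self_eq_norm_sq, norm_smul, Real.norm_eq_abs,
      abs_of_pos hη] at this
    have := (abs_le.mp this).2
    nlinarith
  have hkey : ∀ t : ℝ, 0 < t → t ≤ 1 → η * ‖p‖ ^ 2 ≤ κ * ‖p‖ * t * ‖z‖ ^ 2 := by
    intro t ht0 ht1
    have hcv := hq (m x₀)
    have hmem : x₀ + t • z ∈ {x ∈ closedBall x₀ (2 * a) | m x ≤ m x₀} := by
      have := hcv ⟨hmem0, le_refl _⟩ ⟨hmemz, h1⟩ (by linarith : 0 ≤ 1 - t) ht0.le (by ring)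
      convert this using 1
      module
    have h2 := (abs_le.mp (hd _ hmem.1)).1
    have h3 := hmem.2
    have e : x₀ + t • z - x₀ = t • z := by abel
    rw [e, inner_smul_right, norm_smul, Real.norm_eq_abs, abs_of_pos ht0] at h2
    have e2 : inner ℝ p z = η * ‖p‖ ^ 2 := by
      rw [hz, inner_add_right, hpv, inner_smul_right, real_inner_self_eq_norm_sq]; ring
    rw [e2] at h2
    have : t * (η * ‖p‖ ^ 2) ≤ t * (κ * ‖p‖ * t * ‖z‖ ^ 2) := by
      nlinarith
    exact le_of_mul_le_mul_left this ht0
  set A := η * ‖p‖ ^ 2 with hA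
  have hApos : 0 < A := by positivity
  set B := κ * ‖p‖ * ‖z‖ ^ 2 with hB
  have hk2 : ∀ t : ℝ, 0 < t → t ≤ 1 → A ≤ t * B := by
    intro t h0 h1
    have := hkey t h0 h1
    calc A ≤ _ := this
      _ = t * B := by rw [hB]; ring
  have hBpos : A ≤ B := by simpa using hk2 1 one_pos le_rfl
  have hBp : 0 < B := by linarith
  have := hk2 (A / (2 * B)) (by positivity) (by
    rw [div_le_one (by positivity)]; linarith)
  have e : A / (2 * B) * B = A / 2 := by field_simp
  linarith

/-- The abstract dual norm estimate. -/
lemma dual_est (m : E → ℝ) (x₀ p : E) (a h κ : ℝ) (D : Set E) (ha : 0 < a) (hh : 0 < h)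
    (hq : QuasiconvexOn ℝ (closedBall x₀ (2 * a)) m)
    (hl : ∀ q1 ∈ closedBall x₀ (2 * a), ∀ q2 ∈ closedBall x₀ (2 * a),
      |m q1 - m q2 - inner ℝ p (q1 - q2)| ≤ 1 / 4 * ‖p‖ * ‖q1 - q2‖)
    (hd : ∀ q ∈ closedBall x₀ (2 * a),
      |m q - m x₀ - inner ℝ p (q - x₀)| ≤ κ * ‖p‖ * ‖q - x₀‖ ^ 2)
    (hD : ∀ w ∈ D, ‖w‖ ≤ a) (hm : ∀ w ∈ D, m (x₀ + w) ≤ 0) (w' : E) (hw' : (2 : ℝ) • w' ∈ D)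
    (hm0 : -h ≤ m (x₀ + w')) : ∀ w ∈ D, inner ℝ p w ≤ 5 * h := by
  intro w hw
  have hcs : inner ℝ p w ≤ ‖p‖ * a :=
    (real_inner_le_norm p w).trans (by gcongr; exact hD w hw)
  by_cases hsmall : ‖p‖ * a < 2 * h
  · linarith
  push Not at hsmall
  have hpn : 0 < ‖p‖ := by
    rcases (norm_nonneg p).eq_or_lt with h0 | h0
    · rw [← h0] at hsmall; linarith
    · exact h0
  have hp : p ≠ 0 := norm_pos_iff.mp hpn
  by_cases hs : inner ℝ p w ≤ 0
  · linarith
  push Not at hs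
  -- the unit direction times tau
  set e := (2 * h / ‖p‖ ^ 2) • p with he
  have hen : ‖e‖ = 2 * h / ‖p‖ := by
    rw [he, norm_smul, Real.norm_eq_abs, abs_of_pos (by positivity)]; field_simp
  have hea : ‖e‖ ≤ a := by
    rw [hen, div_le_iff₀ hpn]; linarith
  have hpe : inner ℝ p e = 2 * h := by
    rw [he, inner_smul_right, real_inner_self_eq_norm_sq]; field_simp
  have hpe2 : ‖p‖ * ‖e‖ = 2 * h := by rw [hen]; field_simp
  have hmem : ∀ v : E, ‖v‖ ≤ 2 * a → x₀ + v ∈ closedBall x₀ (2 * a) := by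
    intro v hv; rw [mem_closedBall, dist_self_add_left]; exact hv
  have hx0 : x₀ ∈ closedBall x₀ (2 * a) := mem_closedBall_self (by linarith)
  have h2w := hD _ hw'
  have hA : x₀ + e ∈ closedBall x₀ (2 * a) := hmem _ (by linarith)
  have hB : x₀ + ((2 : ℝ) • w' - e) ∈ closedBall x₀ (2 * a) := hmem _ (by
    have := norm_sub_le ((2 : ℝ) • w') e; linarith)
  have hC : x₀ + (2 : ℝ) • w' ∈ closedBall x₀ (2 * a) := hmem _ (by linarith)
  have hlB := (abs_le.mp (hl _ hC _ hB)).1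
  have e1 : x₀ + (2 : ℝ) • w' - (x₀ + ((2 : ℝ) • w' - e)) = e := by abel
  rw [e1, hpe, mul_assoc, hpe2] at hlB
  have hmB : m (x₀ + ((2 : ℝ) • w' - e)) ≤ -(3 / 2) * h := by
    have := hm _ hw'
    linarith
  have hmA : -h ≤ m (x₀ + e) := by
    by_contra hcon
    push Not at hcon
    have hcv := hq (max (m (x₀ + e)) (m (x₀ + ((2 : ℝ) • w' - e))))
      ⟨hA, le_max_left _ _⟩ ⟨hB, le_max_right _ _⟩ (by norm_num : (0 : ℝ) ≤ 1 / 2)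
      (by norm_num : (0 : ℝ) ≤ 1 / 2) (by norm_num)
    have e2 : (1 / 2 : ℝ) • (x₀ + e) + (1 / 2 : ℝ) • (x₀ + ((2 : ℝ) • w' - e)) = x₀ + w' := by
      module
    rw [e2] at hcv
    have := hcv.2
    rcases le_max_iff.mp this with h1 | h1 <;> linarith
  have hm00 : -(7 / 2) * h ≤ m x₀ := by
    have := (abs_le.mp (hl _ hA _ hx0)).2
    rw [add_sub_cancel_left, hpe, mul_assoc, hpe2] at this
    linarith
  set s := inner ℝ p w with hsdef
  set f := (s / ‖p‖ ^ 2) • p with hf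
  have hfn : ‖f‖ = s / ‖p‖ := by
    rw [hf, norm_smul, Real.norm_eq_abs, abs_of_pos (by positivity)]; field_simp
  have hpf : inner ℝ p f = s := by
    rw [hf, inner_smul_right, real_inner_self_eq_norm_sq]; field_simp
  have hpf2 : ‖p‖ * ‖f‖ = s := by rw [hfn]; field_simp
  have hwf : inner ℝ p (w - f) = 0 := by rw [inner_sub_right, hpf]; simp [hsdef]
  have hwfn : ‖w - f‖ ≤ a := by
    have horth : inner ℝ (w - f) f = 0 := by
      rw [hf, inner_smul_right, real_inner_comm, hwf]; simp
    have h1 : ‖w - f + f‖ * ‖w - f + f‖ = ‖w - f‖ * ‖w - f‖ + ‖f‖ * ‖f‖ :=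
      norm_add_sq_eq_norm_sq_add_norm_sq_of_inner_eq_zero _ _ horth
    rw [sub_add_cancel] at h1
    have h2 : ‖w - f‖ ≤ ‖w‖ := by
      apply abs_le_of_sq_le_sq' _ (norm_nonneg _) |>.2
      nlinarith [norm_nonneg f]
    exact h2.trans (hD w hw)
  have ht := quasi_tangent m x₀ p (w - f) a κ ha hp hq hl hd hwfn hwf
  have hq1 : x₀ + w ∈ closedBall x₀ (2 * a) := hmem _ (by have := hD w hw; linarith)
  have hq2 : x₀ + (w - f) ∈ closedBall x₀ (2 * a) := hmem _ (by linarith)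
  have := (abs_le.mp (hl _ hq1 _ hq2)).1
  have e3 : x₀ + w - (x₀ + (w - f)) = f := by abel
  rw [e3, hpf, mul_assoc, hpf2] at this
  have := hm w hw
  linarith

end Abstract

open Set MeasureTheory Metric Bornology
open scoped ENNReal NNReal Pointwise

lemma one_dim_quasi (f f' f'' : ℝ → ℝ) (C : ℝ)
    (h1 : ∀ t ∈ Icc (0 : ℝ) 1, HasDerivAt f (f' t) t)
    (h2 : ∀ t ∈ Icc (0 : ℝ) 1, HasDerivAt f' (f'' t) t)
    (h3 : ∀ t ∈ Icc (0 : ℝ) 1, -C * |f' t| ≤ f'' t) :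
    ∀ t ∈ Icc (0 : ℝ) 1, f t ≤ max (f 0) (f 1) := by
  intro t ht
  by_contra hcon
  push Not at hcon
  obtain ⟨hc0, hc1⟩ := max_lt_iff.mp hcon
  have ht0 : 0 < t := by
    rcases ht.1.eq_or_lt with h | h
    · rw [← h] at hc0; exact absurd hc0 (lt_irrefl _)
    · exact h
  have ht1 : t < 1 := by
    rcases ht.2.eq_or_lt with h | h
    · rw [h] at hc1; exact absurd hc1 (lt_irrefl _)
    · exact h
  have hcont : ContinuousOn f (Icc 0 1) := fun s hs => (h1 s hs).continuousAt.continuousWithinAt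
  have hcont' : ContinuousOn f' (Icc 0 1) := fun s hs => (h2 s hs).continuousAt.continuousWithinAt
  obtain ⟨t1, ht1m, ht1e⟩ := exists_hasDerivAt_eq_slope f f' ht0
    (hcont.mono (Icc_subset_Icc le_rfl ht.2))
    (fun x hx => h1 x ⟨hx.1.le, hx.2.le.trans ht.2⟩)
  obtain ⟨t2, ht2m, ht2e⟩ := exists_hasDerivAt_eq_slope f f' ht1
    (hcont.mono (Icc_subset_Icc ht.1 le_rfl))
    (fun x hx => h1 x ⟨ht.1.trans hx.1.le, hx.2.le⟩)
  have hp1 : 0 < f' t1 := by rw [ht1e]; apply div_pos <;> linarith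
  have hp2 : f' t2 < 0 := by rw [ht2e]; apply div_neg_of_neg_of_pos <;> linarith
  have h12 : t1 ≤ t2 := ht1m.2.le.trans ht2m.1.le
  have hsub : Icc t1 t2 ⊆ Icc (0 : ℝ) 1 := Icc_subset_Icc ht1m.1.le ht2m.2.le
  have hS : IsCompact (Icc t1 t2 ∩ f' ⁻¹' (Ici 0)) := by
    apply IsCompact.of_isClosed_subset isCompact_Icc _ inter_subset_left
    exact (hcont'.mono hsub).preimage_isClosed_of_isClosed isClosed_Icc isClosed_Ici
  obtain ⟨t3, ht3, hmax⟩ := hS.exists_isGreatest ⟨t1, ⟨le_rfl, h12⟩, hp1.le⟩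
  have ht3' : 0 ≤ f' t3 := ht3.2
  have h32 : t3 < t2 := by
    rcases ht3.1.2.eq_or_lt with h | h
    · rw [h] at ht3'; linarith
    · exact h
  have hneg : ∀ s ∈ Ioo t3 t2, f' s < 0 := by
    intro s hs
    by_contra hcc
    push Not at hcc
    have := hmax (show s ∈ Icc t1 t2 ∩ f' ⁻¹' (Ici 0) from
      ⟨⟨ht3.1.1.trans hs.1.le, hs.2.le⟩, hcc⟩)
    linarith [hs.1]
  have hder : ∀ s ∈ Icc (0 : ℝ) 1, HasDerivAt (fun s => f' s * Real.exp (-C * s))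
      (f'' s * Real.exp (-C * s) + f' s * (Real.exp (-C * s) * (-C))) s := by
    intro s hs
    have he : HasDerivAt (fun s => Real.exp (-C * s)) (Real.exp (-C * s) * (-C)) s := by
      have := ((hasDerivAt_id s).const_mul (-C)).exp
      simpa using this
    exact (h2 s hs).mul he
  have hsub3 : Icc t3 t2 ⊆ Icc (0 : ℝ) 1 :=
    (Icc_subset_Icc ht3.1.1 le_rfl).trans hsub
  have hmono : MonotoneOn (fun s => f' s * Real.exp (-C * s)) (Icc t3 t2) := by
    apply monotoneOn_of_deriv_nonneg (convex_Icc _ _)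
    · exact fun s hs => (hder s (hsub3 hs)).continuousAt.continuousWithinAt
    · exact fun s hs => (hder s (hsub3 (interior_subset hs))).differentiableAt.differentiableWithinAt
    · intro s hs
      have hs' := hsub3 (interior_subset hs)
      rw [(hder s hs').deriv]
      rw [interior_Icc] at hs
      have := h3 s hs'
      rw [abs_of_neg (hneg s hs)] at this
      have he := Real.exp_pos (-C * s)
      have : 0 ≤ (f'' s - C * f' s) * Real.exp (-C * s) := mul_nonneg (by linarith) he.le
      linarith
  have := hmono ⟨le_rfl, h32.le⟩ ⟨h32.le, le_rfl⟩ h32.le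
  have h5 : 0 ≤ f' t3 * Real.exp (-C * t3) := mul_nonneg ht3' (Real.exp_pos _).le
  have h6 : f' t2 * Real.exp (-C * t2) < 0 := mul_neg_of_neg_of_pos hp2 (Real.exp_pos _)
  simp only at this
  linarith

section Abstract
variable {E : Type*} [NormedAddCommGroup E] [InnerProductSpace ℝ E] [CompleteSpace E]

/-- A `C²` function without critical points whose Hessian is nonnegative on the kernel of the
differential is quasi-convex. -/
lemma quasi_of_tangential (N : E → ℝ) (Ω : Set E) (hΩ : IsOpen Ω) (hcv : Convex ℝ Ω)
    (hN : ContDiffOn ℝ 2 N Ω) (hne : ∀ q ∈ Ω, fderiv ℝ N q ≠ 0)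
    (htan : ∀ q ∈ Ω, ∀ w : E, fderiv ℝ N q w = 0 → 0 ≤ fderiv ℝ (fderiv ℝ N) q w w) :
    QuasiconvexOn ℝ Ω N := by
  have hseg : ∀ q0 ∈ Ω, ∀ q1 ∈ Ω, ∀ t ∈ Icc (0 : ℝ) 1,
      N (q0 + t • (q1 - q0)) ≤ max (N q0) (N q1) := by
    intro q0 hq0 q1 hq1
    set w := q1 - q0 with hw
    set γ : ℝ → E := fun t => q0 + t • w with hγ
    have hγm : ∀ t ∈ Icc (0 : ℝ) 1, γ t ∈ Ω := by
      intro t ht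
      have := hcv hq0 hq1 (by linarith [ht.2] : 0 ≤ 1 - t) ht.1 (by ring)
      convert this using 1
      simp only [hγ, hw]; module
    have hγd : ∀ t, HasDerivAt γ w t := by
      intro t
      have := ((hasDerivAt_id t).smul_const w).const_add q0
      exact this.congr_deriv (by simp)
    have hγc : Continuous γ := by fun_prop
    have hat : ∀ q ∈ Ω, ContDiffAt ℝ 2 N q := fun q hq => hN.contDiffAt (hΩ.mem_nhds hq)
    have hat1 : ∀ q ∈ Ω, ContDiffAt ℝ 1 (fderiv ℝ N) q := fun q hq =>
      (hat q hq).fderiv_right (by norm_num)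
    have hc1 : ContinuousOn (fun t => ‖fderiv ℝ N (γ t)‖) (Icc 0 1) := by
      intro t ht
      exact (((hat1 _ (hγm t ht)).continuousAt.comp (f := γ) hγc.continuousAt).norm).continuousWithinAt
    have hc2 : ContinuousOn (fun t => ‖fderiv ℝ (fderiv ℝ N) (γ t)‖) (Icc 0 1) := by
      intro t ht
      have : ContDiffAt ℝ 0 (fderiv ℝ (fderiv ℝ N)) (γ t) :=
        (hat1 _ (hγm t ht)).fderiv_right (by norm_num)
      have h3 : ContinuousAt (fun t => fderiv ℝ (fderiv ℝ N) (γ t)) t :=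
        this.continuousAt.comp (f := γ) hγc.continuousAt
      exact (ContinuousAt.norm (E := E →L[ℝ] E →L[ℝ] ℝ) h3).continuousWithinAt
    obtain ⟨M, hM⟩ := isCompact_Icc.exists_bound_of_continuousOn hc2
    obtain ⟨t0, ht0, hmin⟩ := isCompact_Icc.exists_isMinOn (nonempty_Icc.mpr zero_le_one) hc1
    set μ := ‖fderiv ℝ N (γ t0)‖ with hμ
    have hμpos : 0 < μ := norm_pos_iff.mpr (hne _ (hγm t0 ht0))
    have hMnn : 0 ≤ M := (norm_nonneg _).trans (hM 0 ⟨le_rfl, zero_le_one⟩)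
    have main := one_dim_quasi (fun t => N (γ t)) (fun t => fderiv ℝ N (γ t) w)
      (fun t => fderiv ℝ (fderiv ℝ N) (γ t) w w) (3 * M * ‖w‖ / μ) ?_ ?_ ?_
    · intro t ht
      have := main t ht
      simpa [hγ, hw] using this
    · intro t ht
      exact (((hat _ (hγm t ht)).differentiableAt (by norm_num)).hasFDerivAt).comp_hasDerivAt t (hγd t)
    · intro t ht
      have h := (((hat1 _ (hγm t ht)).differentiableAt (by norm_num)).hasFDerivAt).comp_hasDerivAt t (hγd t)
      exact h.clm_apply (hasDerivAt_const t w) |>.congr_deriv (by simp)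
    · intro t ht
      set q := γ t
      have hqm : q ∈ Ω := hγm t ht
      set v := (InnerProductSpace.toDual ℝ E).symm (fderiv ℝ N q) with hv
      have hvn : ‖v‖ = ‖fderiv ℝ N q‖ := by rw [hv]; simp
      have hvi : ∀ z, fderiv ℝ N q z = inner ℝ v z := by
        intro z; rw [hv, InnerProductSpace.toDual_symm_apply]
      have hvμ : μ ≤ ‖v‖ := by rw [hvn]; exact hmin ht
      have hvpos : 0 < ‖v‖ := hμpos.trans_le hvμ
      set B := fderiv ℝ (fderiv ℝ N) q with hB
      have hBM : ‖B‖ ≤ M := (le_abs_self _).trans (hM t ht)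
      set d := fderiv ℝ N q w with hd
      set α := d / ‖v‖ ^ 2 with hα
      set w1 := w - α • v with hw1
      have hw1z : fderiv ℝ N q w1 = 0 := by
        rw [hw1, map_sub, map_smul, hvi v, real_inner_self_eq_norm_sq, ← hd, hα, smul_eq_mul]
        field_simp; ring
      have hpos := htan q hqm w1 hw1z
      have hdle : |d| ≤ ‖v‖ * ‖w‖ := by rw [hd, hvi]; exact abs_real_inner_le_norm _ _
      have hαv : |α| * ‖v‖ ≤ ‖w‖ := by
        rw [hα, abs_div, abs_of_pos (by positivity : 0 < ‖v‖ ^ 2)]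
        rw [div_mul_eq_mul_div, div_le_iff₀ (by positivity)]
        nlinarith
      have hw1n : ‖w1‖ ≤ 2 * ‖w‖ := by
        calc ‖w1‖ ≤ ‖w‖ + ‖α • v‖ := norm_sub_le _ _
          _ ≤ ‖w‖ + ‖w‖ := by gcongr; rw [norm_smul]; exact hαv
          _ = _ := by ring
      have e : B w w = B w1 w1 + α * (B w1 v + B v w) := by
        have : w = w1 + α • v := by rw [hw1]; abel
        have e1 : B w w = B w1 w + α * B v w := by
          have h9 : B w = B w1 + α • B v := by rw [← map_smul, ← map_add, ← this]
          rw [h9]; rfl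
        have e2 : B w1 w = B w1 w1 + α * B w1 v := by
          rw [← smul_eq_mul, ← map_smul, ← map_add, ← this]
        rw [e1, e2]; ring
      have hb : ∀ a b : E, |B a b| ≤ M * ‖a‖ * ‖b‖ := by
        intro a b
        calc |B a b| = ‖B a b‖ := (Real.norm_eq_abs _).symm
          _ ≤ ‖B‖ * ‖a‖ * ‖b‖ := B.le_opNorm₂ a b
          _ ≤ _ := by gcongr
      have hbd : |B w1 v + B v w| ≤ 3 * M * ‖w‖ * ‖v‖ := by
        calc _ ≤ |B w1 v| + |B v w| := abs_add_le _ _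
          _ ≤ M * (2 * ‖w‖) * ‖v‖ + M * ‖v‖ * ‖w‖ := by
            gcongr
            · exact (hb _ _).trans (by gcongr)
            · exact hb _ _
          _ = _ := by ring
      have hfin : |α * (B w1 v + B v w)| ≤ 3 * M * ‖w‖ / μ * |d| := by
        rw [abs_mul]
        calc _ ≤ |α| * (3 * M * ‖w‖ * ‖v‖) := by gcongr
          _ = 3 * M * ‖w‖ / ‖v‖ * |d| := by
            rw [hα, abs_div, abs_of_pos (by positivity : 0 < ‖v‖ ^ 2)]; field_simp
          _ ≤ _ := by gcongr
      have := (abs_le.mp hfin).1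
      have e' : fderiv ℝ (fderiv ℝ N) (γ t) w w = B w w := rfl
      rw [e', e]
      linarith
  intro r q0 hq0 q1 hq1 a b ha hb hab
  refine ⟨hcv hq0.1 hq1.1 ha hb hab, ?_⟩
  have := hseg q0 hq0.1 q1 hq1.1 b ⟨hb, by linarith⟩
  have e : q0 + b • (q1 - q0) = a • q0 + b • q1 := by
    rw [← eq_sub_iff_add_eq] at hab; rw [hab]; module
  rw [e] at this
  exact this.trans (max_le hq0.2 hq1.2)

end Abstract

open Set MeasureTheory Metric Bornology
open scoped ENNReal NNReal Pointwise

section Oper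
open Topology Filter
variable {F : Type*} [NormedAddCommGroup F] [NormedSpace ℝ F]

/-- Directional derivative operator. -/
noncomputable def Dv (v : F) (f : F → ℝ) : F → ℝ := fun z => fderiv ℝ f z v

lemma Dv_contDiffAt {k m : ℕ} (hkm : m + 1 ≤ k) (v : F) {f : F → ℝ} {z : F}
    (hf : ContDiffAt ℝ k f z) : ContDiffAt ℝ m (Dv v f) z := by
  have : ContDiffAt ℝ m (fderiv ℝ f) z := hf.fderiv_right (by exact_mod_cast hkm)
  exact this.clm_apply contDiffAt_const

lemma Dv_congr (v : F) {f g : F → ℝ} {z : F} (h : f =ᶠ[𝓝 z] g) : Dv v f =ᶠ[𝓝 z] Dv v g := by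
  filter_upwards [h.fderiv (𝕜 := ℝ)] with a ha
  simp [Dv, ha]

lemma Dv_Dv (u v : F) {f : F → ℝ} {z : F} (hf : ContDiffAt ℝ 2 f z) :
    Dv u (Dv v f) z = fderiv ℝ (fderiv ℝ f) z u v := by
  have h1 : DifferentiableAt ℝ (fderiv ℝ f) z :=
    (hf.fderiv_right (m := 1) (by norm_num)).differentiableAt (by norm_num)
  unfold Dv
  have := (h1.hasFDerivAt.clm_apply (hasFDerivAt_const v z)).fderiv
  rw [this]
  simp

lemma Dv_comm (u v : F) {f : F → ℝ} {z : F} (hf : ContDiffAt ℝ 2 f z) :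
    Dv u (Dv v f) z = Dv v (Dv u f) z := by
  rw [Dv_Dv u v hf, Dv_Dv v u hf]
  exact (hf.isSymmSndFDerivAt (by simp)).eq u v

lemma Dv_fadd (v : F) {f g : F → ℝ} {z : F} (hf : DifferentiableAt ℝ f z)
    (hg : DifferentiableAt ℝ g z) : Dv v (f + g) z = Dv v f z + Dv v g z := by
  unfold Dv; rw [fderiv_add hf hg]; rfl

lemma ev_cd {k : ℕ} {f : F → ℝ} {z : F} (hf : ContDiffAt ℝ k f z) :
    ∀ᶠ z' in 𝓝 z, ContDiffAt ℝ k f z' := hf.eventually (by simp)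

lemma Dv_comm12 (b ξ : F) {f : F → ℝ} {z : F} (hf : ContDiffAt ℝ (3 : ℕ) f z) :
    Dv b (Dv ξ (Dv ξ f)) z = Dv ξ (Dv ξ (Dv b f)) z := by
  rw [Dv_comm b ξ (by exact_mod_cast Dv_contDiffAt (k := 3) (m := 2) le_rfl ξ hf)]
  refine (Dv_congr ξ ?_).eq_of_nhds
  filter_upwards [ev_cd hf] with z' hz'
  exact Dv_comm b ξ (hz'.of_le (by norm_num))

lemma Dv_comm22 (η ξ : F) {f : F → ℝ} {z : F} (hf : ContDiffAt ℝ (4 : ℕ) f z) :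
    Dv η (Dv η (Dv ξ (Dv ξ f))) z = Dv ξ (Dv ξ (Dv η (Dv η f))) z := by
  rw [← Dv_comm12 η ξ (Dv_contDiffAt (k := 4) (m := 3) le_rfl η hf)]
  refine (Dv_congr η ?_).eq_of_nhds
  filter_upwards [ev_cd hf] with z' hz'
  exact Dv_comm12 η ξ (hz'.of_le (by norm_num))

lemma Dv_Dv_add (v : F) {f g : F → ℝ} {z : F} (hf : ContDiffAt ℝ (2 : ℕ) f z)
    (hg : ContDiffAt ℝ (2 : ℕ) g z) :
    Dv v (Dv v (f + g)) z = Dv v (Dv v f) z + Dv v (Dv v g) z := by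
  rw [← Dv_fadd v ((Dv_contDiffAt (m := 1) le_rfl v hf).differentiableAt (by norm_num))
    ((Dv_contDiffAt (m := 1) le_rfl v hg).differentiableAt (by norm_num))]
  refine (Dv_congr v ?_).eq_of_nhds
  filter_upwards [ev_cd hf, ev_cd hg] with z' h1 h2
  exact Dv_fadd v (h1.differentiableAt (by norm_num)) (h2.differentiableAt (by norm_num))

lemma chain1 {f : F → ℝ} {γ : ℝ → F} {ξ : F} {t : ℝ} (hf : DifferentiableAt ℝ f (γ t))
    (hγ : HasDerivAt γ ξ t) : HasDerivAt (fun s => f (γ s)) (Dv ξ f (γ t)) t :=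
  hf.hasFDerivAt.comp_hasDerivAt t hγ

lemma chain2 {f : F → ℝ} {γ γ' : ℝ → F} {a : F} {t : ℝ} (hf : ContDiffAt ℝ (2 : ℕ) f (γ t))
    (hγ : HasDerivAt γ (γ' t) t) (hγ' : HasDerivAt γ' a t) :
    HasDerivAt (fun s => Dv (γ' s) f (γ s))
      (Dv (γ' t) (Dv (γ' t) f) (γ t) + Dv a f (γ t)) t := by
  have h1 : DifferentiableAt ℝ (fderiv ℝ f) (γ t) :=
    (hf.fderiv_right (m := 1) (by norm_num)).differentiableAt (by norm_num)
  have h2 := (h1.hasFDerivAt.comp_hasDerivAt t hγ).clm_apply hγ'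
  rw [Dv_Dv _ _ (by exact_mod_cast hf)]
  exact h2

lemma chain2_deriv {f : F → ℝ} {γ γ' : ℝ → F} {a : F} {t : ℝ}
    (hf : ContDiffAt ℝ (2 : ℕ) f (γ t))
    (hγ : ∀ᶠ s in 𝓝 t, HasDerivAt γ (γ' s) s) (hγ' : HasDerivAt γ' a t) :
    deriv (deriv (fun s => f (γ s))) t = Dv (γ' t) (Dv (γ' t) f) (γ t) + Dv a f (γ t) := by
  rw [← (chain2 hf hγ.self_of_nhds hγ').deriv]
  refine EventuallyEq.deriv_eq ?_
  have hc : ContinuousAt γ t := hγ.self_of_nhds.continuousAt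
  filter_upwards [hγ, hc.eventually (ev_cd hf)] with s h1 h2
  exact (chain1 (h2.differentiableAt (by norm_num)) h1).deriv

end Oper

section Cross
open Topology Filter

lemma crossDiff4_eq {n : ℕ} {c : Euc n → Euc n → ℝ} {x x' y y' : ℝ → Euc n} {a b : Euc n}
    (hC : ContDiffAt ℝ (4 : ℕ) (Function.uncurry c) (x 0, y 0))
    (hx : ∀ᶠ s in 𝓝 0, HasDerivAt x (x' s) s) (hx' : HasDerivAt x' a 0)
    (hy : ∀ᶠ s in 𝓝 0, HasDerivAt y (y' s) s) (hy' : HasDerivAt y' b 0) :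
    crossDiff4 n c x y =
      (Dv (x' 0, 0) (Dv (x' 0, 0) (Dv (0, y' 0) (Dv (0, y' 0) (Function.uncurry c)))) (x 0, y 0)
      + Dv (x' 0, 0) (Dv (x' 0, 0) (Dv (0, b) (Function.uncurry c))) (x 0, y 0)) +
      (Dv (a, 0) (Dv (0, y' 0) (Dv (0, y' 0) (Function.uncurry c))) (x 0, y 0)
      + Dv (a, 0) (Dv (0, b) (Function.uncurry c)) (x 0, y 0)) := by
  set C := Function.uncurry c with hCd
  set f := Dv (0, y' 0) (Dv (0, y' 0) C) + Dv (0, b) C with hf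
  have hxc : ContinuousAt x 0 := hx.self_of_nhds.continuousAt
  have hpair : ContinuousAt (fun s => (x s, y 0)) 0 := hxc.prodMk continuousAt_const
  have h1 : (fun s => deriv (deriv (fun t => c (x s) (y t))) 0) =ᶠ[𝓝 0] fun s => f (x s, y 0) := by
    filter_upwards [hpair.eventually (ev_cd hC)] with s hs
    have := chain2_deriv (f := C) (γ := fun t => (x s, y t)) (γ' := fun t => ((0 : Euc n), y' t))
      (a := ((0 : Euc n), b)) (t := 0) (hs.of_le (by norm_num))
      (by filter_upwards [hy] with t ht using (hasDerivAt_const t (x s)).prodMk ht)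
      ((hasDerivAt_const 0 (0 : Euc n)).prodMk hy')
    exact this
  unfold crossDiff4
  rw [(h1.deriv).deriv_eq]
  have hf1 : ContDiffAt ℝ (2 : ℕ) (Dv ((0 : Euc n), y' 0) (Dv (0, y' 0) C)) (x 0, y 0) :=
    Dv_contDiffAt (k := 3) le_rfl _ (Dv_contDiffAt (k := 4) le_rfl _ hC)
  have hf2 : ContDiffAt ℝ (2 : ℕ) (Dv ((0 : Euc n), b) C) (x 0, y 0) :=
    Dv_contDiffAt (k := 4) (by norm_num) _ hC
  have hf0 : ContDiffAt ℝ (2 : ℕ) f (x 0, y 0) := hf1.add hf2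
  have := chain2_deriv (f := f) (γ := fun s => (x s, y 0)) (γ' := fun s => (x' s, (0 : Euc n)))
      (a := (a, (0 : Euc n))) (t := 0) hf0
      (by filter_upwards [hx] with t ht using ht.prodMk (hasDerivAt_const t (y 0)))
      (hx'.prodMk (hasDerivAt_const 0 (0 : Euc n)))
  rw [this, hf, Dv_Dv_add _ hf1 hf2, Dv_fadd _ (hf1.differentiableAt (by norm_num))
    (hf2.differentiableAt (by norm_num))]

lemma crossDiff2_eq {n : ℕ} {c : Euc n → Euc n → ℝ} {x y : ℝ → Euc n} {ξ η : Euc n}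
    (hC : ContDiffAt ℝ (2 : ℕ) (Function.uncurry c) (x 0, y 0))
    (hx : HasDerivAt x ξ 0) (hy : HasDerivAt y η 0) :
    crossDiff2 n c x y =
      Dv (ξ, 0) (Dv (0, η) (Function.uncurry c)) (x 0, y 0) := by
  set C := Function.uncurry c with hCd
  have hpair : ContinuousAt (fun s => (x s, y 0)) 0 := hx.continuousAt.prodMk continuousAt_const
  have h1 : (fun s => deriv (fun t => c (x s) (y t)) 0) =ᶠ[𝓝 0]
      fun s => Dv (0, η) C (x s, y 0) := by
    filter_upwards [hpair.eventually (ev_cd hC)] with s hs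
    exact (chain1 (f := C) (γ := fun t => (x s, y t)) (hs.differentiableAt (by norm_num))
      ((hasDerivAt_const 0 (x s)).prodMk hy)).deriv
  unfold crossDiff2
  rw [h1.deriv_eq]
  have hd : DifferentiableAt ℝ (Dv ((0 : Euc n), η) C) (x 0, y 0) :=
    (Dv_contDiffAt (k := 2) (m := 1) le_rfl _ hC).differentiableAt (by norm_num)
  exact (chain1 (f := Dv ((0 : Euc n), η) C) (γ := fun s => (x s, y 0)) hd
    (hx.prodMk (hasDerivAt_const 0 (y 0)))).deriv

end Cross

open Set MeasureTheory Metric Bornology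
open scoped ENNReal NNReal Pointwise

section Diffeo
open Topology Filter

lemma diffeo_equiv {n : ℕ} {f : Euc n → Euc n} {S : Set (Euc n)} (hf : DiffeoOnto n f S)
    {x : Euc n} (hx : S ∈ 𝓝 x) :
    ∃ e : Euc n ≃L[ℝ] Euc n, HasStrictFDerivAt f (e : Euc n →L[ℝ] Euc n) x := by
  obtain ⟨hinj, hf1, hg1⟩ := hf
  have hxS : x ∈ S := mem_of_mem_nhds hx
  have hcf : ContDiffAt ℝ 1 f x := hf1.contDiffAt hx
  have hs : HasStrictFDerivAt f (fderiv ℝ f x) x := hcf.hasStrictFDerivAt (by norm_num)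
  have hg : HasFDerivWithinAt (Function.invFunOn f S)
      (fderivWithin ℝ (Function.invFunOn f S) (f '' S) (f x)) (f '' S) (f x) :=
    (hg1.differentiableOn (by norm_num) _ (mem_image_of_mem f hxS)).hasFDerivWithinAt
  have hcomp := hg.comp x hs.hasFDerivAt.hasFDerivWithinAt (mapsTo_image f S)
  have hcomp2 := (hcomp.hasFDerivAt hx)
  have hid : HasFDerivAt (Function.invFunOn f S ∘ f) (ContinuousLinearMap.id ℝ (Euc n)) x := by
    refine (hasFDerivAt_id x).congr_of_eventuallyEq ?_
    filter_upwards [hx] with y hy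
    exact hinj.leftInvOn_invFunOn hy
  have heq := hcomp2.unique hid
  have hinj' : Function.Injective (fderiv ℝ f x : Euc n →ₗ[ℝ] Euc n) := by
    intro a b hab
    have h1 := congrArg (fun T : Euc n →L[ℝ] Euc n => T a) heq
    have h2 := congrArg (fun T : Euc n →L[ℝ] Euc n => T b) heq
    simp only [ContinuousLinearMap.comp_apply, ContinuousLinearMap.id_apply] at h1 h2
    rw [← h1, ← h2]; congr 1
  refine ⟨(LinearEquiv.ofInjectiveEndo _ hinj').toContinuousLinearEquiv, ?_⟩
  convert hs using 1
  ext v; rfl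

lemma diffeo_inv {n : ℕ} {f : Euc n → Euc n} {S : Set (Euc n)} (hinj : InjOn f S)
    {x : Euc n} (hx : S ∈ 𝓝 x) {e : Euc n ≃L[ℝ] Euc n}
    (he : HasStrictFDerivAt f (e : Euc n →L[ℝ] Euc n) x) :
    HasStrictFDerivAt (Function.invFunOn f S) (e.symm : Euc n →L[ℝ] Euc n) (f x) := by
  refine he.to_local_left_inverse ?_
  filter_upwards [hx] with y hy
  exact hinj.leftInvOn_invFunOn hy

lemma diffeo_inv_cd {n : ℕ} {f : Euc n → Euc n} {S : Set (Euc n)} (hf : DiffeoOnto n f S)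
    {x : Euc n} (hx : S ∈ 𝓝 x) {k : ℕ} (hk : k ≠ 0) (hcf : ContDiffAt ℝ k f x) :
    ContDiffAt ℝ k (Function.invFunOn f S) (f x) := by
  obtain ⟨e, he⟩ := diffeo_equiv hf hx
  have h1 := hcf.to_localInverse (f' := e) he.hasFDerivAt (by exact_mod_cast hk)
  refine h1.congr_of_eventuallyEq ?_
  have := HasStrictFDerivAt.localInverse_unique (f := f) (f' := e) (a := x)
    (g := Function.invFunOn f S) he (by
      filter_upwards [hx] with y hy
      exact hf.1.leftInvOn_invFunOn hy)
  filter_upwards [this] with y hy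
  rw [hy]; rfl

lemma diffeo_image_open {n : ℕ} {f : Euc n → Euc n} {S W : Set (Euc n)} (hf : DiffeoOnto n f S)
    (hW : IsOpen W) (hWS : W ⊆ S) : IsOpen (f '' W) := by
  rw [isOpen_iff_mem_nhds]
  rintro _ ⟨x, hx, rfl⟩
  obtain ⟨e, he⟩ := diffeo_equiv hf (mem_of_superset (hW.mem_nhds hx) hWS)
  rw [← he.map_nhds_eq_of_equiv]
  exact image_mem_map (hW.mem_nhds hx)

/-- the inverse maps the image of the smaller set back -/
lemma invFunOn_mem_of_image {n : ℕ} {f : Euc n → Euc n} {S W : Set (Euc n)} (hinj : InjOn f S)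
    (hWS : W ⊆ S) {q : Euc n} (hq : q ∈ f '' W) :
    Function.invFunOn f S q ∈ W ∧ f (Function.invFunOn f S q) = q := by
  obtain ⟨x, hx, rfl⟩ := hq
  rw [hinj.leftInvOn_invFunOn (hWS hx)]
  exact ⟨hx, rfl⟩
end Diffeo

open Set MeasureTheory Metric Bornology
open scoped ENNReal NNReal Pointwise

section Interior
open Topology Filter
variable {n : ℕ} {c : Euc n → Euc n → ℝ} {U V : Set (Euc n)}

lemma Ccd (h0 : B0cond n c U V) {x y : Euc n} (hx : x ∈ U) (hy : y ∈ V) :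
    ContDiffAt ℝ (4 : ℕ) (Function.uncurry c) (x, y) := by
  obtain ⟨hU, -, hV, -, hc⟩ := h0
  exact hc.contDiffAt (prod_mem_nhds (mem_of_superset (hU.mem_nhds hx) subset_closure)
    (mem_of_superset (hV.mem_nhds hy) subset_closure))

lemma gradY_eq {x y : Euc n} (h : DifferentiableAt ℝ (Function.uncurry c) (x, y)) :
    gradY n c x y = (InnerProductSpace.toDual ℝ (Euc n)).symm
      ((fderiv ℝ (Function.uncurry c) (x, y)).comp (ContinuousLinearMap.inr ℝ (Euc n) (Euc n))) := by
  unfold gradY gradient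
  congr 1
  exact (h.hasFDerivAt.comp y (hasFDerivAt_prodMk_right x y)).fderiv

lemma gradX_eq {x y : Euc n} (h : DifferentiableAt ℝ (Function.uncurry c) (x, y)) :
    gradX n c x y = (InnerProductSpace.toDual ℝ (Euc n)).symm
      ((fderiv ℝ (Function.uncurry c) (x, y)).comp (ContinuousLinearMap.inl ℝ (Euc n) (Euc n))) := by
  unfold gradX gradient
  congr 1
  exact (HasFDerivAt.comp (f := fun e : Euc n => (e, y)) x h.hasFDerivAt (hasFDerivAt_prodMk_left x y)).fderiv

lemma inner_gradY {x y : Euc n} (h : DifferentiableAt ℝ (Function.uncurry c) (x, y)) (η : Euc n) :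
    inner ℝ (gradY n c x y) η = Dv ((0 : Euc n), η) (Function.uncurry c) (x, y) := by
  rw [gradY_eq h, InnerProductSpace.toDual_symm_apply]; simp [Dv]

lemma inner_gradX {x y : Euc n} (h : DifferentiableAt ℝ (Function.uncurry c) (x, y)) (ξ : Euc n) :
    inner ℝ (gradX n c x y) ξ = Dv (ξ, (0 : Euc n)) (Function.uncurry c) (x, y) := by
  rw [gradX_eq h, InnerProductSpace.toDual_symm_apply]; simp [Dv]

lemma gradY_cd {k : ℕ} {p : Euc n × Euc n} (h : ContDiffAt ℝ (k + 1 : ℕ) (Function.uncurry c) p) :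
    ContDiffAt ℝ k (fun p : Euc n × Euc n => gradY n c p.1 p.2) p := by
  have h1 : ContDiffAt ℝ k (fderiv ℝ (Function.uncurry c)) p :=
    h.fderiv_right (by exact_mod_cast le_rfl)
  have h2 : ContDiffAt ℝ k (fun p => (InnerProductSpace.toDual ℝ (Euc n)).symm
      ((fderiv ℝ (Function.uncurry c) p).comp (ContinuousLinearMap.inr ℝ (Euc n) (Euc n)))) p :=
    ((InnerProductSpace.toDual ℝ (Euc n)).symm.contDiff.contDiffAt).comp p
      (h1.clm_comp contDiffAt_const)
  refine h2.congr_of_eventuallyEq ?_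
  filter_upwards [ev_cd h] with q hq
  exact gradY_eq (hq.differentiableAt (by simp))

lemma gradX_cd {k : ℕ} {p : Euc n × Euc n} (h : ContDiffAt ℝ (k + 1 : ℕ) (Function.uncurry c) p) :
    ContDiffAt ℝ k (fun p : Euc n × Euc n => gradX n c p.1 p.2) p := by
  have h1 : ContDiffAt ℝ k (fderiv ℝ (Function.uncurry c)) p :=
    h.fderiv_right (by exact_mod_cast le_rfl)
  have h2 : ContDiffAt ℝ k (fun p => (InnerProductSpace.toDual ℝ (Euc n)).symm
      ((fderiv ℝ (Function.uncurry c) p).comp (ContinuousLinearMap.inl ℝ (Euc n) (Euc n)))) p :=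
    ((InnerProductSpace.toDual ℝ (Euc n)).symm.contDiff.contDiffAt).comp p
      (h1.clm_comp contDiffAt_const)
  refine h2.congr_of_eventuallyEq ?_
  filter_upwards [ev_cd h] with q hq
  exact gradX_eq (hq.differentiableAt (by simp))

lemma gradY_cdx (h0 : B0cond n c U V) {x y : Euc n} (hx : x ∈ U) (hy : y ∈ V) :
    ContDiffAt ℝ (3 : ℕ) (fun x' => gradY n c x' y) x :=
  (gradY_cd (p := (x, y)) (Ccd h0 hx hy)).comp (f := fun x' : Euc n => (x', y)) x
    (contDiffAt_id.prodMk contDiffAt_const)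

lemma gradX_cdy (h0 : B0cond n c U V) {x y : Euc n} (hx : x ∈ U) (hy : y ∈ V) :
    ContDiffAt ℝ (3 : ℕ) (fun y' => gradX n c x y') y :=
  (gradX_cd (p := (x, y)) (Ccd h0 hx hy)).comp (f := fun y' : Euc n => (x, y')) y
    (contDiffAt_const.prodMk contDiffAt_id)

lemma hasFD_gradY (h0 : B0cond n c U V) {x y : Euc n} (hx : x ∈ U) (hy : y ∈ V) :
    HasFDerivAt (fun x' => gradY n c x' y) (DxyC n c x y) x :=
  ((gradY_cdx h0 hx hy).differentiableAt (by norm_num)).hasFDerivAt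

lemma inner_DxyC (h0 : B0cond n c U V) {x y : Euc n} (hx : x ∈ U) (hy : y ∈ V) (ξ η : Euc n) :
    inner ℝ (DxyC n c x y ξ) η =
      Dv (ξ, (0 : Euc n)) (Dv ((0 : Euc n), η) (Function.uncurry c)) (x, y) := by
  have hC := Ccd h0 hx hy
  have h1 : HasFDerivAt (fun x' => Dv ((0 : Euc n), η) (Function.uncurry c) (x', y))
     ((fderiv ℝ (Dv ((0 : Euc n), η) (Function.uncurry c)) (x, y)).comp
       (ContinuousLinearMap.inl ℝ (Euc n) (Euc n))) x :=
    HasFDerivAt.comp (f := fun e : Euc n => (e, y)) x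
      (((Dv_contDiffAt (k := 4) (m := 3) le_rfl _ hC).differentiableAt (by norm_num)).hasFDerivAt) (hasFDerivAt_prodMk_left x y)
  have h2 := (hasFD_gradY h0 hx hy).inner ℝ (hasFDerivAt_const η x)
  have hpair : ContinuousAt (fun s : Euc n => (s, y)) x := by fun_prop
  have h3 : (fun x' => inner ℝ (gradY n c x' y) η) =ᶠ[𝓝 x]
      (fun x' => Dv ((0 : Euc n), η) (Function.uncurry c) (x', y)) := by
    filter_upwards [hpair.eventually (ev_cd hC)] with x' hx'
    exact inner_gradY (hx'.differentiableAt (by norm_num)) η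
  have h4 := (h2.congr_of_eventuallyEq h3.symm).unique h1
  have := congrArg (fun T : Euc n →L[ℝ] ℝ => T ξ) h4
  simpa [Dv, fderivInnerCLM_apply] using this

lemma hasFD_gradX (h0 : B0cond n c U V) {x y : Euc n} (hx : x ∈ U) (hy : y ∈ V) :
    HasFDerivAt (fun y' => gradX n c x y') (ContinuousLinearMap.adjoint (DxyC n c x y)) y := by
  have hC := Ccd h0 hx hy
  have h := ((gradX_cdy h0 hx hy).differentiableAt (by norm_num)).hasFDerivAt
  suffices hs : ContinuousLinearMap.adjoint (DxyC n c x y) = fderiv ℝ (fun y' => gradX n c x y') y by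
    rw [hs]; exact h
  ext1 η
  refine ext_inner_right ℝ fun ξ => ?_
  rw [ContinuousLinearMap.adjoint_inner_left, real_inner_comm, inner_DxyC h0 hx hy]
  rw [Dv_comm _ _ (hC.of_le (by norm_num))]
  have h1 : HasFDerivAt (fun y' => Dv (ξ, (0 : Euc n)) (Function.uncurry c) (x, y'))
     ((fderiv ℝ (Dv (ξ, (0 : Euc n)) (Function.uncurry c)) (x, y)).comp
       (ContinuousLinearMap.inr ℝ (Euc n) (Euc n))) y :=
    (((Dv_contDiffAt (k := 4) (m := 3) le_rfl _ hC).differentiableAt (by norm_num)).hasFDerivAt).comp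
      y (hasFDerivAt_prodMk_right x y)
  have h2 := h.inner ℝ (hasFDerivAt_const ξ y)
  have hpair : ContinuousAt (fun s : Euc n => (x, s)) y := by fun_prop
  have h3 : (fun y' => inner ℝ (gradX n c x y') ξ) =ᶠ[𝓝 y]
      (fun y' => Dv (ξ, (0 : Euc n)) (Function.uncurry c) (x, y')) := by
    filter_upwards [hpair.eventually (ev_cd hC)] with x' hx'
    exact inner_gradX (hx'.differentiableAt (by norm_num)) ξ
  have h4 := (h2.congr_of_eventuallyEq h3.symm).unique h1
  have := congrArg (fun T : Euc n →L[ℝ] ℝ => T η) h4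
  simpa [Dv, fderivInnerCLM_apply] using this.symm

lemma DxyC_equiv (h0 : B0cond n c U V) (h1 : B1cond n c U V) {x y : Euc n} (hx : x ∈ U)
    (hy : y ∈ V) : ∃ e : Euc n ≃L[ℝ] Euc n, (e : Euc n →L[ℝ] Euc n) = DxyC n c x y ∧
      (DxyC n c x y).inverse = (e.symm : Euc n →L[ℝ] Euc n) := by
  obtain ⟨e, he⟩ := diffeo_equiv (h1.1 y (subset_closure hy))
    (mem_of_superset (h0.1.mem_nhds hx) subset_closure)
  have h2 := he.hasFDerivAt.unique (hasFD_gradY h0 hx hy).neg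
  have h3 : (((ContinuousLinearEquiv.neg ℝ).trans e : Euc n ≃L[ℝ] Euc n) : Euc n →L[ℝ] Euc n)
      = DxyC n c x y := by
    ext1 v
    have := congrArg (fun T : Euc n →L[ℝ] Euc n => T v) h2
    simp only [_root_.neg_apply] at this
    simp only [ContinuousLinearEquiv.coe_coe] at this ⊢
    simp [this]
  refine ⟨_, h3, ?_⟩
  rw [← h3, ContinuousLinearMap.inverse_equiv]

end Interior

open Set MeasureTheory Metric Bornology
open scoped ENNReal NNReal Pointwise

section Quasi
open Topology Filter

section gen
variable {F : Type*} [NormedAddCommGroup F] [NormedSpace ℝ F]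
  {G : Type*} [NormedAddCommGroup G] [NormedSpace ℝ G]

lemma Dv_smul_dir (r : ℝ) (v : F) (f : F → ℝ) : Dv (r • v) f = r • Dv v f := by
  ext z; simp [Dv]

lemma Dv_smul_fun (r : ℝ) (v : F) (f : F → ℝ) : Dv v (r • f) = r • Dv v f := by
  ext z; simp [Dv, fderiv_const_smul_field]

lemma Dv_zero_dir (f : F → ℝ) : Dv (0 : F) f = 0 := by
  ext z; simp [Dv]

lemma hasDerivAt_line (q0 w : F) (t : ℝ) : HasDerivAt (fun t : ℝ => q0 + t • w) w t :=
  ((hasDerivAt_id t).smul_const w).const_add q0 |>.congr_deriv (by simp)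

lemma line_curve {X : F → G} {q0 w : F} {t0 : ℝ} (hX : ContDiffAt ℝ (2 : ℕ) X (q0 + t0 • w)) :
    (∀ᶠ t in 𝓝 t0, HasDerivAt (fun t : ℝ => X (q0 + t • w)) (fderiv ℝ X (q0 + t • w) w) t) ∧
    HasDerivAt (fun t : ℝ => fderiv ℝ X (q0 + t • w) w)
      (fderiv ℝ (fderiv ℝ X) (q0 + t0 • w) w w) t0 := by
  have hl : ∀ t, HasDerivAt (fun t : ℝ => q0 + t • w) w t := hasDerivAt_line q0 w
  constructor
  · have hev : ∀ᶠ z in 𝓝 (q0 + t0 • w), ContDiffAt ℝ (2 : ℕ) X z := hX.eventually (by simp)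
    filter_upwards [(hl t0).continuousAt.eventually hev] with t ht
    exact (ht.differentiableAt (by norm_num)).hasFDerivAt.comp_hasDerivAt t (hl t)
  · have h1 : DifferentiableAt ℝ (fderiv ℝ X) (q0 + t0 • w) :=
      (hX.fderiv_right (m := 1) (by norm_num)).differentiableAt (by norm_num)
    have h3 : HasDerivAt (fun t : ℝ => fderiv ℝ X (q0 + t • w))
        (fderiv ℝ (fderiv ℝ X) (q0 + t0 • w) w) t0 :=
      HasFDerivAt.comp_hasDerivAt (f := fun t : ℝ => q0 + t • w) (l := fderiv ℝ X) t0
        h1.hasFDerivAt (hl t0)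
    exact (h3.clm_apply (hasDerivAt_const t0 w)).congr_deriv (by simp)

end gen

lemma convex_le (g g1 g2 : ℝ → ℝ) (h1 : ∀ s ∈ Icc (0 : ℝ) 1, HasDerivAt g (g1 s) s)
    (h2 : ∀ s ∈ Icc (0 : ℝ) 1, HasDerivAt g1 (g2 s) s) (h0 : g1 0 = 0)
    (hp : ∀ s ∈ Icc (0 : ℝ) 1, 0 ≤ g2 s) : g 0 ≤ g 1 := by
  have hm1 : MonotoneOn g1 (Icc 0 1) := by
    refine monotoneOn_of_deriv_nonneg (convex_Icc 0 1)
      (fun s hs => (h2 s hs).continuousAt.continuousWithinAt) ?_ ?_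
    · intro s hs; rw [interior_Icc] at hs
      exact (h2 s (Ioo_subset_Icc_self hs)).differentiableAt.differentiableWithinAt
    · intro s hs; rw [interior_Icc] at hs
      rw [(h2 s (Ioo_subset_Icc_self hs)).deriv]; exact hp s (Ioo_subset_Icc_self hs)
  have hm : MonotoneOn g (Icc 0 1) := by
    refine monotoneOn_of_deriv_nonneg (convex_Icc 0 1)
      (fun s hs => (h1 s hs).continuousAt.continuousWithinAt) ?_ ?_
    · intro s hs; rw [interior_Icc] at hs
      exact (h1 s (Ioo_subset_Icc_self hs)).differentiableAt.differentiableWithinAt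
    · intro s hs; rw [interior_Icc] at hs
      rw [(h1 s (Ioo_subset_Icc_self hs)).deriv, ← h0]
      exact hm1 ⟨le_rfl, zero_le_one⟩ (Ioo_subset_Icc_self hs) hs.1.le
  exact hm ⟨le_rfl, zero_le_one⟩ ⟨zero_le_one, le_rfl⟩ zero_le_one

variable {n : ℕ} {c : Euc n → Euc n → ℝ} {U V : Set (Euc n)}

lemma Uyset_open (h0 : B0cond n c U V) (h1 : B1cond n c U V) {y : Euc n} (hy : y ∈ closure V) :
    IsOpen (Uyset n c U y) := diffeo_image_open (h1.1 y hy) h0.1 subset_closure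

lemma Vxset_open (h0 : B0cond n c U V) (h1 : B1cond n c U V) {x : Euc n} (hx : x ∈ closure U) :
    IsOpen (Vxset n c V x) := diffeo_image_open (h1.2 x hx) h0.2.2.1 subset_closure

lemma xOf_mem (h1 : B1cond n c U V) {y : Euc n} (hy : y ∈ closure V) {q : Euc n}
    (hq : q ∈ Uyset n c U y) : xOf n c U y q ∈ U ∧ -gradY n c (xOf n c U y q) y = q :=
  invFunOn_mem_of_image (h1.1 y hy).1 subset_closure hq

/-- inverse in the second variable -/
noncomputable def yOf (n : ℕ) (c : Euc n → Euc n → ℝ) (V : Set (Euc n)) (x : Euc n) :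
    Euc n → Euc n :=
  Function.invFunOn (fun y => -gradX n c x y) (closure V)

lemma yOf_mem (h1 : B1cond n c U V) {x : Euc n} (hx : x ∈ closure U) {q : Euc n}
    (hq : q ∈ Vxset n c V x) : yOf n c V x q ∈ V ∧ -gradX n c x (yOf n c V x q) = q :=
  invFunOn_mem_of_image (h1.2 x hx).1 subset_closure hq

lemma yOf_left (h1 : B1cond n c U V) {x : Euc n} (hx : x ∈ closure U) {y : Euc n}
    (hy : y ∈ closure V) : yOf n c V x (-gradX n c x y) = y :=
  (h1.2 x hx).1.leftInvOn_invFunOn hy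

lemma xOf_left (h1 : B1cond n c U V) {x : Euc n} (hx : x ∈ closure U) {y : Euc n}
    (hy : y ∈ closure V) : xOf n c U y (-gradY n c x y) = x :=
  (h1.1 y hy).1.leftInvOn_invFunOn hx

lemma xOf_cd (h0 : B0cond n c U V) (h1 : B1cond n c U V) {y : Euc n} (hy : y ∈ V) {q : Euc n}
    (hq : q ∈ Uyset n c U y) : ContDiffAt ℝ (3 : ℕ) (xOf n c U y) q := by
  obtain ⟨x, hx, rfl⟩ := hq
  exact diffeo_inv_cd (h1.1 y (subset_closure hy)) (mem_of_superset (h0.1.mem_nhds hx) subset_closure)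
    (by norm_num) (gradY_cdx h0 hx hy).neg

lemma yOf_cd (h0 : B0cond n c U V) (h1 : B1cond n c U V) {x : Euc n} (hx : x ∈ U) {q : Euc n}
    (hq : q ∈ Vxset n c V x) : ContDiffAt ℝ (3 : ℕ) (yOf n c V x) q := by
  obtain ⟨y, hy, rfl⟩ := hq
  exact diffeo_inv_cd (h1.2 x (subset_closure hx))
    (mem_of_superset (h0.2.2.1.mem_nhds hy) subset_closure)
    (by norm_num) (gradX_cdy h0 hx hy).neg

lemma fderiv_xOf (h0 : B0cond n c U V) (h1 : B1cond n c U V) {y : Euc n} (hy : y ∈ V) {q : Euc n}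
    (hq : q ∈ Uyset n c U y) :
    fderiv ℝ (xOf n c U y) q = -(DxyC n c (xOf n c U y q) y).inverse := by
  obtain ⟨hx, hxq⟩ := xOf_mem h1 (subset_closure hy) hq
  obtain ⟨e, he, hei⟩ := DxyC_equiv h0 h1 hx hy
  have hA : HasFDerivAt (fun x' => -gradY n c x' y) (-DxyC n c (xOf n c U y q) y) (xOf n c U y q) :=
    (hasFD_gradY h0 hx hy).neg
  have hXd : HasFDerivAt (xOf n c U y) (fderiv ℝ (xOf n c U y) q) q :=
    ((xOf_cd h0 h1 hy hq).differentiableAt (by norm_num)).hasFDerivAt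
  have hcomp := hA.comp q hXd
  have hid : HasFDerivAt ((fun x' => -gradY n c x' y) ∘ xOf n c U y)
      (ContinuousLinearMap.id ℝ (Euc n)) q := by
    refine (hasFDerivAt_id q).congr_of_eventuallyEq ?_
    filter_upwards [(Uyset_open h0 h1 (subset_closure hy)).mem_nhds hq] with q' hq'
    exact (xOf_mem h1 (subset_closure hy) hq').2
  have h := hcomp.unique hid
  rw [hei]
  ext1 w
  have hw := congrArg (fun T : Euc n →L[ℝ] Euc n => T w) h
  rw [← he] at hw
  simp at hw
  rw [_root_.neg_apply, ContinuousLinearEquiv.coe_coe]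
  rw [eq_neg_iff_add_eq_zero]
  apply e.injective
  rw [map_add, e.apply_symm_apply, map_zero]
  nth_rewrite 2 [← hw]
  simp

end Quasi

open Set MeasureTheory Metric Bornology
open scoped ENNReal NNReal Pointwise

section QuasiB
open Topology Filter
variable {n : ℕ} {c : Euc n → Euc n → ℝ} {U V : Set (Euc n)}

lemma affine_curve_zero (h0 : B0cond n c U V) {x0 : Euc n} (hx0 : x0 ∈ U)
    {y y' : ℝ → Euc n} {b P G : Euc n} {s : ℝ} (hyV : y s ∈ V)
    (hy : ∀ᶠ τ in 𝓝 s, HasDerivAt y (y' τ) τ) (hy' : HasDerivAt y' b s)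
    (haff : ∀ᶠ τ in 𝓝 s, gradX n c x0 (y τ) = P + τ • G) (a : Euc n) :
    Dv (a, (0 : Euc n)) (Dv ((0 : Euc n), y' s) (Dv ((0 : Euc n), y' s) (Function.uncurry c))) (x0, y s)
      + Dv (a, (0 : Euc n)) (Dv ((0 : Euc n), b) (Function.uncurry c)) (x0, y s) = 0 := by
  have hC := Ccd h0 hx0 hyV
  have hf : ContDiffAt ℝ (2 : ℕ) (Dv (a, (0 : Euc n)) (Function.uncurry c)) (x0, y s) :=
    Dv_contDiffAt (k := 4) (by norm_num) _ hC
  have h1 := chain2_deriv (f := Dv (a, (0 : Euc n)) (Function.uncurry c))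
    (γ := fun t => (x0, y t)) (γ' := fun t => ((0 : Euc n), y' t)) (a := ((0 : Euc n), b)) (t := s)
    hf (by filter_upwards [hy] with t ht using (hasDerivAt_const t x0).prodMk ht)
    ((hasDerivAt_const s (0 : Euc n)).prodMk hy')
  rw [Dv_comm12 _ _ (hC.of_le (by norm_num)), Dv_comm _ _ (hC.of_le (by norm_num)), ← h1]
  have hcont : ContinuousAt (fun t => (x0, y t)) s :=
    continuousAt_const.prodMk hy.self_of_nhds.continuousAt
  have h2 : (fun t => Dv (a, (0 : Euc n)) (Function.uncurry c) (x0, y t)) =ᶠ[𝓝 s]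
      fun t => inner ℝ P a + t * inner ℝ G a := by
    filter_upwards [haff, hcont.eventually (ev_cd hC)] with t ht htC
    rw [← inner_gradX (htC.differentiableAt (by norm_num)), ht, inner_add_left, real_inner_smul_left]
  rw [h2.deriv.deriv_eq]
  have h3 : deriv (fun t : ℝ => inner ℝ P a + t * inner ℝ G a) = fun _ => inner ℝ G a := by
    ext t
    exact (((hasDerivAt_id t).mul_const (inner ℝ G a)).const_add (inner ℝ P a)).deriv.trans (by simp)
  rw [h3]; simp

lemma B3_use (h0 : B0cond n c U V) (h1 : B1cond n c U V) (h3 : B3cond n c U V)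
    {x0 : Euc n} (hx0 : x0 ∈ U) {y y' : ℝ → Euc n} {b P G ξ : Euc n} (hyV : y 0 ∈ V)
    (hy : ∀ᶠ τ in 𝓝 0, HasDerivAt y (y' τ) τ) (hy' : HasDerivAt y' b 0)
    (haff : ∀ᶠ τ in 𝓝 (0 : ℝ), gradX n c x0 (y τ) = P + τ • G)
    (hz : Dv (ξ, (0 : Euc n)) (Dv ((0 : Euc n), y' 0) (Function.uncurry c)) (x0, y 0) = 0) :
    Dv (ξ, (0 : Euc n)) (Dv (ξ, (0 : Euc n)) (Dv ((0 : Euc n), y' 0) (Dv ((0 : Euc n), y' 0)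
      (Function.uncurry c)))) (x0, y 0)
      + Dv (ξ, (0 : Euc n)) (Dv (ξ, (0 : Euc n)) (Dv ((0 : Euc n), b) (Function.uncurry c)))
        (x0, y 0) ≤ 0 := by
  set C := Function.uncurry c with hCdef
  have hC : ContDiffAt ℝ (4 : ℕ) C (x0, y 0) := Ccd h0 hx0 hyV
  set y0 := y 0 with hy0
  have hyc := subset_closure hyV
  set q0 := -gradY n c x0 y0 with hq0
  set ω := -DxyC n c x0 y0 ξ with hω
  have hq0m : q0 ∈ Uyset n c U y0 := ⟨x0, hx0, rfl⟩
  have hXq0 : xOf n c U y0 q0 = x0 := xOf_left h1 (subset_closure hx0) hyc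
  have hopen := Uyset_open h0 h1 hyc
  have hlc : ContinuousAt (fun t : ℝ => q0 + t • ω) 0 := (hasDerivAt_line q0 ω 0).continuousAt
  have hev1 : ∀ᶠ t in 𝓝 (0 : ℝ), q0 + t • ω ∈ Uyset n c U y0 :=
    hlc.eventually (by simpa using hopen.mem_nhds hq0m)
  have hev2 : ∀ᶠ t in 𝓝 (0 : ℝ), y t ∈ V :=
    hy.self_of_nhds.continuousAt.eventually (h0.2.2.1.mem_nhds hyV)
  obtain ⟨ε, hε, hball⟩ := Metric.eventually_nhds_iff_ball.1 (hev1.and (hev2.and haff))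
  set r := ε / 2 with hr
  have hrp : 0 < r := by positivity
  have hrt : ∀ t ∈ Icc (-1 : ℝ) 1, r * t ∈ ball (0 : ℝ) ε := by
    intro t ht
    rw [mem_ball_zero_iff, Real.norm_eq_abs, abs_mul, abs_of_pos hrp]
    have := abs_le.2 ht
    nlinarith
  -- the scaled curves
  set X := xOf n c U y0 with hX
  have hXcd : ContDiffAt ℝ (2 : ℕ) X (q0 + (0 : ℝ) • (r • ω)) := by
    simpa using (xOf_cd h0 h1 hyV hq0m).of_le (by norm_num)
  obtain ⟨hx1, hx2⟩ := line_curve hXcd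
  set xs : ℝ → Euc n := fun t => X (q0 + t • (r • ω)) with hxs
  set xs' : ℝ → Euc n := fun t => fderiv ℝ X (q0 + t • (r • ω)) (r • ω) with hxs'
  have hxs0 : xs 0 = x0 := by simp [hxs, hXq0]
  have hxsDz : xs' 0 = r • ξ := by
    simp only [hxs', zero_smul, add_zero]
    rw [fderiv_xOf h0 h1 hyV hq0m, ← hX, hXq0]
    obtain ⟨e, he, hei⟩ := DxyC_equiv h0 h1 hx0 hyV
    rw [hei, hω, ← he]; simp
  set ys : ℝ → Euc n := fun t => y (r * t) with hys
  have hys0 : ys 0 = y0 := by simp [hys, hy0]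
  have hmulc : ContinuousAt (fun t : ℝ => r * t) 0 := by fun_prop
  have hmul : ∀ t : ℝ, HasDerivAt (fun t => r * t) r t := fun t =>
    ((hasDerivAt_id t).const_mul r).congr_deriv (by simp)
  have hy1 : ∀ᶠ t in 𝓝 (0 : ℝ), HasDerivAt ys (r • y' (r * t)) t := by
    have : ∀ᶠ t in 𝓝 (0 : ℝ), HasDerivAt y (y' (r * t)) (r * t) :=
      hmulc.eventually (by simpa using hy)
    filter_upwards [this] with t ht
    exact HasDerivAt.scomp (h := fun t => r * t) t ht (hmul t)
  have hy2 : HasDerivAt (fun t => r • y' (r * t)) (r • r • b) 0 := by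
    have h : HasDerivAt y' b (r * 0) := by simpa using hy'
    exact (HasDerivAt.scomp (h := fun t => r * t) 0 h (hmul 0)).const_smul r
  have haff' : ∀ᶠ τ in 𝓝 (0 : ℝ), gradX n c x0 (ys τ) = P + τ • (r • G) := by
    have : ∀ᶠ t in 𝓝 (0 : ℝ), gradX n c x0 (y (r * t)) = P + (r * t) • G :=
      hmulc.eventually (by simpa using haff)
    filter_upwards [this] with t ht
    rw [hys]; simp only; rw [ht, smul_smul, mul_comm]
  have hB := h3 xs ys (fun t ht => by
      refine subset_closure (xOf_mem h1 hyc ?_).1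
      have := (hball _ (hrt t ht)).1
      rwa [mul_comm, mul_smul] at this)
    (fun t ht => subset_closure (hball _ (hrt t ht)).2.1)
    ⟨(-q0, P), (-(r • ω), r • G), fun t ht => by
      have e1 : gradY n c (xs t) (ys 0) = -(q0 + t • (r • ω)) := by
        rw [hys0, ← (xOf_mem h1 hyc (q := q0 + t • (r • ω)) ?_).2, neg_neg]
        have := (hball _ (hrt t ht)).1
        rwa [mul_comm, mul_smul] at this
      have e2 : gradX n c (xs 0) (ys t) = P + (r * t) • G := by
        rw [hxs0]; exact (hball _ (hrt t ht)).2.2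
      simp only [e1, e2, Prod.smul_mk, Prod.mk_add_mk]
      refine Prod.ext ?_ ?_
      · simp only [smul_neg]; abel
      · simp only [smul_smul]; rw [mul_comm]⟩
  have hC' : ContDiffAt ℝ (4 : ℕ) C (xs 0, ys 0) := by rw [hxs0, hys0]; exact hC
  have hcd2 : crossDiff2 n c xs ys = 0 := by
    rw [crossDiff2_eq (ξ := xs' 0) (η := r • y' (r * 0)) (hC'.of_le (by norm_num))
      hx1.self_of_nhds hy1.self_of_nhds, hxsDz, hxs0, hys0, mul_zero]
    have e1 : (r • ξ, (0 : Euc n)) = r • (ξ, (0 : Euc n)) := by simp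
    have e2 : ((0 : Euc n), r • y' 0) = r • ((0 : Euc n), y' 0) := by simp
    rw [e1, e2, Dv_smul_dir, Dv_smul_dir, Dv_smul_fun]
    simp [← hCdef, hz]
  have hB4 := hB hcd2
  rw [crossDiff4_eq hC' hx1 hx2 hy1 hy2] at hB4
  have hzero := affine_curve_zero h0 (x0 := x0) hx0 (y := ys) (s := 0) (by rw [hys0]; exact hyV)
    hy1 hy2 haff' (fderiv ℝ (fderiv ℝ X) (q0 + (0 : ℝ) • r • ω) (r • ω) (r • ω))
  have hxsDz2 : fderiv ℝ X (q0 + (0 : ℝ) • r • ω) (r • ω) = r • ξ := hxsDz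
  rw [hxsDz2, hxs0] at hB4
  rw [hzero, add_zero, mul_zero, hys0] at hB4
  have e1 : (r • ξ, (0 : Euc n)) = r • (ξ, (0 : Euc n)) := by simp
  have e2 : ((0 : Euc n), r • y' 0) = r • ((0 : Euc n), y' 0) := by simp
  have e3 : ((0 : Euc n), r • r • b) = r • r • ((0 : Euc n), b) := by simp
  rw [e1, e2, e3] at hB4
  simp only [Dv_smul_dir, Dv_smul_fun] at hB4
  simp only [Pi.smul_apply, smul_eq_mul, ← hCdef] at hB4
  have hr4 : 0 < r ^ 4 := by positivity
  by_contra hcon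
  push Not at hcon
  have := mul_pos hr4 hcon
  nlinarith
end QuasiB

open Set MeasureTheory Metric Bornology
open scoped ENNReal NNReal Pointwise

section QuasiC
open Topology Filter
variable {n : ℕ} {c : Euc n → Euc n → ℝ} {U V : Set (Euc n)}

lemma ypath (h0 : B0cond n c U V) (h1 : B1cond n c U V) (h2 : B2cond n c U V) {x0 : Euc n}
    (hx0 : x0 ∈ U) {ya yb : Euc n} (hya : ya ∈ V) (hyb : yb ∈ V) :
    ∃ (y y' y'' : ℝ → Euc n), y 0 = ya ∧ y 1 = yb ∧ ∀ s ∈ Icc (0 : ℝ) 1, y s ∈ V ∧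
      (∀ᶠ τ in 𝓝 s, HasDerivAt y (y' τ) τ) ∧ HasDerivAt y' (y'' s) s ∧
      (∀ᶠ τ in 𝓝 s, gradX n c x0 (y τ) =
        gradX n c x0 ya + τ • (gradX n c x0 yb - gradX n c x0 ya)) := by
  set qa := -gradX n c x0 ya with hqa
  set qb := -gradX n c x0 yb with hqb
  have hxc := subset_closure hx0
  have hqam : qa ∈ Vxset n c V x0 := ⟨ya, hya, rfl⟩
  have hqbm : qb ∈ Vxset n c V x0 := ⟨yb, hyb, rfl⟩
  have hline : ∀ s ∈ Icc (0 : ℝ) 1, qa + s • (qb - qa) ∈ Vxset n c V x0 := by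
    intro s hs
    exact (h2.2 x0 hxc).add_smul_sub_mem hqam hqbm hs
  have hopen := Vxset_open h0 h1 hxc
  refine ⟨fun s => yOf n c V x0 (qa + s • (qb - qa)),
    fun s => fderiv ℝ (yOf n c V x0) (qa + s • (qb - qa)) (qb - qa),
    fun s => fderiv ℝ (fderiv ℝ (yOf n c V x0)) (qa + s • (qb - qa)) (qb - qa) (qb - qa), ?_, ?_, ?_⟩
  · simp only [zero_smul, add_zero]; exact yOf_left h1 hxc (subset_closure hya)
  · simp only [one_smul, add_sub_cancel]; exact yOf_left h1 hxc (subset_closure hyb)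
  · intro s hs
    obtain ⟨hl1, hl2⟩ := line_curve ((yOf_cd h0 h1 hx0 (hline s hs)).of_le
      (by norm_num : ((2 : ℕ) : WithTop ℕ∞) ≤ ((3 : ℕ) : WithTop ℕ∞)))
    refine ⟨(yOf_mem h1 hxc (hline s hs)).1, hl1, hl2, ?_⟩
    have hc : ContinuousAt (fun t : ℝ => qa + t • (qb - qa)) s :=
      (hasDerivAt_line qa (qb - qa) s).continuousAt
    filter_upwards [hc.eventually (hopen.mem_nhds (hline s hs))] with τ hτ
    have := (yOf_mem h1 hxc hτ).2
    rw [neg_eq_iff_eq_neg] at this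
    rw [this, hqa, hqb, neg_add, neg_neg, ← smul_neg]
    congr 2; abel

lemma modCost_cd (h0 : B0cond n c U V) (h1 : B1cond n c U V) {ybar y : Euc n} (hyb : ybar ∈ V)
    (hy : y ∈ V) {q : Euc n} (hq : q ∈ Uyset n c U ybar) :
    ContDiffAt ℝ (3 : ℕ) (fun q => -modCost n c U ybar q y) q := by
  have hX := xOf_cd h0 h1 hyb hq
  have hm := xOf_mem h1 (subset_closure hyb) hq
  have e : ∀ y' ∈ V, ContDiffAt ℝ (3 : ℕ) (fun q => c (xOf n c U ybar q) y') q := fun y' hy' =>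
    ContDiffAt.comp (g := Function.uncurry c) (f := fun q => (xOf n c U ybar q, y')) q
      ((Ccd h0 hm.1 hy').of_le (by norm_num)) (hX.prodMk contDiffAt_const)
  exact ((e y hy).sub (e ybar hyb)).neg

lemma modCost_fd (h0 : B0cond n c U V) (h1 : B1cond n c U V) {ybar y : Euc n} (hyb : ybar ∈ V)
    (hy : y ∈ V) {q : Euc n} (hq : q ∈ Uyset n c U ybar) (w : Euc n) :
    fderiv ℝ (fun q => -modCost n c U ybar q y) q w =
      -(inner ℝ (gradX n c (xOf n c U ybar q) y - gradX n c (xOf n c U ybar q) ybar)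
        (fderiv ℝ (xOf n c U ybar) q w)) := by
  have hX := (xOf_cd h0 h1 hyb hq).differentiableAt (by norm_num)
  have hm := xOf_mem h1 (subset_closure hyb) hq
  have e : ∀ y' ∈ V, HasFDerivAt (fun q => c (xOf n c U ybar q) y')
      ((fderiv ℝ (Function.uncurry c) (xOf n c U ybar q, y')).comp
        ((fderiv ℝ (xOf n c U ybar) q).prod 0)) q := fun y' hy' =>
    HasFDerivAt.comp (g := Function.uncurry c) (f := fun q => (xOf n c U ybar q, y')) q
      ((Ccd h0 hm.1 hy').differentiableAt (by norm_num)).hasFDerivAt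
      (hX.hasFDerivAt.prodMk (hasFDerivAt_const y' q))
  have h := ((e y hy).sub (e ybar hyb)).neg
  rw [show (fun q => -modCost n c U ybar q y) = _ from rfl]
  erw [h.fderiv]
  rw [inner_sub_left, inner_gradX ((Ccd h0 hm.1 hy).differentiableAt (by norm_num)),
    inner_gradX ((Ccd h0 hm.1 hyb).differentiableAt (by norm_num))]
  simp [Dv]

lemma modCost_tangential (h0 : B0cond n c U V) (h1 : B1cond n c U V) (h2 : B2cond n c U V)
    (h3 : B3cond n c U V) {ybar y : Euc n} (hyb : ybar ∈ V)
    (hy : y ∈ V) {q : Euc n} (hq : q ∈ Uyset n c U ybar) (w : Euc n)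
    (hw : fderiv ℝ (fun q => -modCost n c U ybar q y) q w = 0) :
    0 ≤ fderiv ℝ (fderiv ℝ (fun q => -modCost n c U ybar q y)) q w w := by
  set C := Function.uncurry c with hCdef
  set X := xOf n c U ybar with hX
  have hm := xOf_mem h1 (subset_closure hyb) hq
  rw [modCost_fd h0 h1 hyb hy hq, neg_eq_zero] at hw
  set x0 := X q with hx0
  have hx0U : x0 ∈ U := hm.1
  have hXcd : ContDiffAt ℝ (2 : ℕ) X (q + (0 : ℝ) • w) := by
    simpa using (xOf_cd h0 h1 hyb hq).of_le (by norm_num)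
  obtain ⟨hg1, hg2⟩ := line_curve hXcd
  set γ : ℝ → Euc n := fun t => X (q + t • w) with hγ
  set γ' : ℝ → Euc n := fun t => fderiv ℝ X (q + t • w) w with hγ'
  set a := fderiv ℝ (fderiv ℝ X) (q + (0 : ℝ) • w) w w with ha
  have hγ0 : γ 0 = x0 := by simp [hγ, hx0]
  have hγ'0 : γ' 0 = fderiv ℝ X q w := by simp [hγ']
  set ξ := fderiv ℝ X q w with hξ
  set K : Euc n × Euc n → ℝ := Dv (ξ, (0 : Euc n)) (Dv (ξ, (0 : Euc n)) C) + Dv (a, (0 : Euc n)) C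
    with hK
  have hKcd : ∀ y1 ∈ V, ContDiffAt ℝ (2 : ℕ) K (x0, y1) := fun y1 hy1 =>
    (Dv_contDiffAt (k := 3) le_rfl _ (Dv_contDiffAt (k := 4) le_rfl _ (Ccd h0 hx0U hy1))).add
      (Dv_contDiffAt (k := 4) (by norm_num) _ (Ccd h0 hx0U hy1))
  -- second derivative of curves
  have hsec : ∀ y1 ∈ V, ∀ f : Euc n × Euc n → ℝ, ContDiffAt ℝ (2 : ℕ) f (x0, y1) →
      deriv (deriv (fun t => f (γ t, y1))) 0 =
        Dv (ξ, (0 : Euc n)) (Dv (ξ, (0 : Euc n)) f) (x0, y1) + Dv (a, (0 : Euc n)) f (x0, y1) := by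
    intro y1 hy1 f hf
    have := chain2_deriv (f := f) (γ := fun t => (γ t, y1)) (γ' := fun t => (γ' t, (0 : Euc n)))
      (a := (a, (0 : Euc n))) (t := 0) (by rw [hγ0]; exact hf)
      (by filter_upwards [hg1] with t ht using ht.prodMk (hasDerivAt_const t y1))
      (hg2.prodMk (hasDerivAt_const 0 (0 : Euc n)))
    rw [hγ0, hγ'0] at this
    exact this
  have hD2 : fderiv ℝ (fderiv ℝ (fun q => -modCost n c U ybar q y)) q w w
      = -K (x0, y) + K (x0, ybar) := by
    have hN := modCost_cd h0 h1 hyb hy hq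
    rw [← Dv_Dv w w (hN.of_le (by norm_num))]
    have hc := chain2_deriv (f := fun q => -modCost n c U ybar q y) (γ := fun t : ℝ => q + t • w)
      (γ' := fun _ => w) (a := 0) (t := 0) (by simpa using hN.of_le (by norm_num))
      (Eventually.of_forall fun t => hasDerivAt_line q w t) (hasDerivAt_const 0 w)
    simp only [Dv_zero_dir, Pi.zero_apply, add_zero, zero_smul] at hc
    rw [← hc]
    have h5 : ContDiffAt ℝ (2 : ℕ) (fun p : Euc n × Euc n => -C (p.1, y) + C (p.1, ybar)) (x0, y) := by
      have e1 : ∀ y1 ∈ V, ContDiffAt ℝ (2 : ℕ) (fun p : Euc n × Euc n => C (p.1, y1)) (x0, y) :=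
        fun y1 hy1 => ContDiffAt.comp (g := C) (f := fun p : Euc n × Euc n => (p.1, y1)) (x0, y)
          ((Ccd h0 hx0U hy1).of_le (by norm_num)) (contDiffAt_fst.prodMk contDiffAt_const)
      exact (e1 y hy).neg.add (e1 ybar hyb)
    have hd : ∀ y1 ∈ V, ∀ᶠ t in 𝓝 (0 : ℝ), DifferentiableAt ℝ (fun t => C (γ t, y1)) t := by
      intro y1 hy1
      have hcont : ContinuousAt (fun t => (γ t, y1)) 0 :=
        hg1.self_of_nhds.continuousAt.prodMk continuousAt_const
      filter_upwards [hg1, hcont.eventually (ev_cd (z := (γ 0, y1)) (by rw [hγ0]; exact Ccd h0 hx0U hy1))]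
        with t ht htC
      exact (chain1 (f := C) (γ := fun t => (γ t, y1)) (htC.differentiableAt (by norm_num))
        (ht.prodMk (hasDerivAt_const t y1))).differentiableAt
    have hdd : ∀ y1 ∈ V, DifferentiableAt ℝ (deriv (fun t => C (γ t, y1))) 0 := by
      intro y1 hy1
      have hcont : ContinuousAt (fun t => (γ t, y1)) 0 :=
        hg1.self_of_nhds.continuousAt.prodMk continuousAt_const
      have hch := chain2 (f := C) (γ := fun t => (γ t, y1)) (γ' := fun t => (γ' t, (0 : Euc n)))
        (a := (a, (0 : Euc n))) (t := 0)
        (by rw [hγ0]; exact (Ccd h0 hx0U hy1).of_le (by norm_num))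
        (hg1.self_of_nhds.prodMk (hasDerivAt_const 0 y1)) (hg2.prodMk (hasDerivAt_const 0 (0 : Euc n)))
      refine hch.differentiableAt.congr_of_eventuallyEq ?_
      filter_upwards [hg1, hcont.eventually (ev_cd (z := (γ 0, y1)) (by rw [hγ0]; exact Ccd h0 hx0U hy1))]
        with t ht htC
      exact (chain1 (f := C) (γ := fun t => (γ t, y1)) (htC.differentiableAt (by norm_num))
        (ht.prodMk (hasDerivAt_const t y1))).deriv
    have h6 : deriv (fun t : ℝ => -modCost n c U ybar (q + t • w) y) =ᶠ[𝓝 0]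
        fun t => -deriv (fun t => C (γ t, y)) t + deriv (fun t => C (γ t, ybar)) t := by
      filter_upwards [hd y hy, hd ybar hyb] with t t1 t2
      have : (fun t : ℝ => -modCost n c U ybar (q + t • w) y) =
          fun t => -C (γ t, y) + C (γ t, ybar) := by
        ext t; simp [modCost, hCdef, hγ, hX]; ring
      rw [this]
      exact (t1.hasDerivAt.neg.add t2.hasDerivAt).deriv
    rw [h6.deriv_eq]
    have := ((hdd y hy).hasDerivAt.neg.add (hdd ybar hyb).hasDerivAt).deriv
    refine this.trans ?_
    rw [hsec y hy C ((Ccd h0 hx0U hy).of_le (by norm_num)),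
      hsec ybar hyb C ((Ccd h0 hx0U hyb).of_le (by norm_num))]
    rfl
  rw [hD2]
  obtain ⟨ys, ys', ys'', hys0, hys1, hys⟩ := ypath h0 h1 h2 hx0U hyb hy
  set G := gradX n c x0 y - gradX n c x0 ybar with hG
  have hmain := convex_le (fun s => -K (x0, ys s)) (fun s => -Dv ((0 : Euc n), ys' s) K (x0, ys s))
    (fun s => -(Dv ((0 : Euc n), ys' s) (Dv ((0 : Euc n), ys' s) K) (x0, ys s)
      + Dv ((0 : Euc n), ys'' s) K (x0, ys s))) ?_ ?_ ?_ ?_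
  · simp only [hys0, hys1] at hmain; linarith
  · intro s hs
    obtain ⟨hV, hd1, hd2, -⟩ := hys s hs
    exact (chain1 (f := K) (γ := fun s => (x0, ys s)) ((hKcd _ hV).differentiableAt (by norm_num))
      ((hasDerivAt_const s x0).prodMk hd1.self_of_nhds)).neg
  · intro s hs
    obtain ⟨hV, hd1, hd2, -⟩ := hys s hs
    exact (chain2 (f := K) (γ := fun s => (x0, ys s)) (γ' := fun s => ((0 : Euc n), ys' s))
      (a := ((0 : Euc n), ys'' s)) (hKcd _ hV)
      ((hasDerivAt_const s x0).prodMk hd1.self_of_nhds)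
      ((hasDerivAt_const s (0 : Euc n)).prodMk hd2)).neg
  · -- first derivative at zero vanishes
    simp only [hys0, neg_eq_zero]
    set η := ys' 0
    have hC := Ccd h0 hx0U hyb
    rw [hK, Dv_fadd _ ((Dv_contDiffAt (k := 3) (m := 2) le_rfl _
      (Dv_contDiffAt (k := 4) le_rfl _ hC)).differentiableAt (by norm_num))
      ((Dv_contDiffAt (k := 4) (m := 3) le_rfl _ hC).differentiableAt (by norm_num)),
      Dv_comm12 _ _ (hC.of_le (by norm_num)), Dv_comm _ _ (hC.of_le (by norm_num)),
      ← hsec ybar hyb _ (Dv_contDiffAt (k := 4) (by norm_num) _ hC)]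
    have hcont : ContinuousAt (fun t => (γ t, ybar)) 0 :=
        hg1.self_of_nhds.continuousAt.prodMk continuousAt_const
    have hqc : ContinuousAt (fun t : ℝ => q + t • w) 0 := (hasDerivAt_line q w 0).continuousAt
    have hqe : ∀ᶠ t in 𝓝 (0 : ℝ), q + t • w ∈ Uyset n c U ybar :=
      hqc.eventually (by simpa using (Uyset_open h0 h1 (subset_closure hyb)).mem_nhds hq)
    have h7 : (fun t => Dv ((0 : Euc n), η) C (γ t, ybar)) =ᶠ[𝓝 0]
        fun t => -(inner ℝ q η + t * inner ℝ w η) := by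
      filter_upwards [hqe, hcont.eventually (ev_cd (z := (γ 0, ybar)) (by rw [hγ0]; exact hC))]
        with t ht htC
      rw [← inner_gradY (htC.differentiableAt (by norm_num))]
      have := (xOf_mem h1 (subset_closure hyb) ht).2
      rw [neg_eq_iff_eq_neg] at this
      rw [hγ]; simp only; rw [this, inner_neg_left, inner_add_left, real_inner_smul_left]
    rw [h7.deriv.deriv_eq]
    have h8 : deriv (fun t : ℝ => -(inner ℝ q η + t * inner ℝ w η)) = fun _ => -inner ℝ w η := by
      ext t
      exact (((hasDerivAt_id t).mul_const (inner ℝ w η)).const_add (inner ℝ q η)).neg.deriv.trans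
        (by simp)
    rw [h8]; simp
  · intro s hs
    obtain ⟨hV, hd1, hd2, haff⟩ := hys s hs
    have hC := Ccd h0 hx0U hV
    have hA : ContDiffAt ℝ (2 : ℕ) (Dv (ξ, (0 : Euc n)) (Dv (ξ, (0 : Euc n)) C)) (x0, ys s) :=
      Dv_contDiffAt (k := 3) le_rfl _ (Dv_contDiffAt (k := 4) le_rfl _ hC)
    have hB : ContDiffAt ℝ (2 : ℕ) (Dv (a, (0 : Euc n)) C) (x0, ys s) :=
      Dv_contDiffAt (k := 4) (by norm_num) _ hC
    rw [hK, Dv_Dv_add _ hA hB, Dv_fadd _ (hA.differentiableAt (by norm_num))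
      (hB.differentiableAt (by norm_num)), Dv_comm22 _ _ hC,
      ← Dv_comm12 (a, (0 : Euc n)) ((0 : Euc n), ys' s) (hC.of_le (by norm_num)),
      Dv_comm12 ((0 : Euc n), ys'' s) (ξ, (0 : Euc n)) (hC.of_le (by norm_num)),
      Dv_comm ((0 : Euc n), ys'' s) _ (hC.of_le (by norm_num))]
    have hz := affine_curve_zero h0 hx0U hV hd1 hd2 haff a
    -- shift
    have hsh : ∀ {p : ℝ → Prop}, (∀ᶠ τ in 𝓝 s, p τ) → ∀ᶠ τ in 𝓝 (0 : ℝ), p (s + τ) := by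
      intro p hp
      have hc : ContinuousAt (fun τ : ℝ => s + τ) 0 := by fun_prop
      exact hc.eventually (by simpa using hp)
    have hd1' : HasDerivAt (fun τ => ys' (s + τ)) (ys'' s) 0 := by
      have : HasDerivAt ys' (ys'' s) (s + 0) := by simpa using hd2
      exact this.comp_const_add s 0
    have hB3 := B3_use h0 h1 h3 hx0U (y := fun τ => ys (s + τ)) (y' := fun τ => ys' (s + τ))
      (b := ys'' s) (P := gradX n c x0 ybar + s • G) (G := G) (ξ := ξ) (by simpa using hV)
      (by filter_upwards [hsh hd1] with τ hτ; exact hτ.comp_const_add s τ)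
      hd1'
      (by filter_upwards [hsh haff] with τ hτ
          rw [hτ, add_smul, add_assoc]) ?_
    · simp only [add_zero] at hB3
      linarith
    · simp only [add_zero]
      rw [Dv_comm _ _ (hC.of_le (by norm_num))]
      have hder := chain1 (f := Dv (ξ, (0 : Euc n)) C) (γ := fun s => (x0, ys s))
        ((Dv_contDiffAt (k := 4) (m := 3) le_rfl _ hC).differentiableAt (by norm_num))
        ((hasDerivAt_const s x0).prodMk hd1.self_of_nhds)
      have hcont : ContinuousAt (fun t => (x0, ys t)) s :=
        continuousAt_const.prodMk hd1.self_of_nhds.continuousAt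
      have h9 : (fun s => Dv (ξ, (0 : Euc n)) C (x0, ys s)) =ᶠ[𝓝 s]
          fun _ => inner ℝ (gradX n c x0 ybar) ξ := by
        filter_upwards [haff, hcont.eventually (ev_cd hC)] with t ht htC
        rw [← inner_gradX (htC.differentiableAt (by norm_num)), ht, inner_add_left,
          real_inner_smul_left, hw, mul_zero, add_zero]
      exact hder.unique ((hasDerivAt_const s _).congr_of_eventuallyEq h9)

lemma modCost_quasi (h0 : B0cond n c U V) (h1 : B1cond n c U V) (h2 : B2cond n c U V)
    (h3 : B3cond n c U V) {ybar y : Euc n} (hyb : ybar ∈ V) (hy : y ∈ V) :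
    QuasiconvexOn ℝ (Uyset n c U ybar) (fun q => -modCost n c U ybar q y) := by
  have hcv := h2.1 ybar (subset_closure hyb)
  by_cases hyy : y = ybar
  · subst hyy
    have : (fun q => -modCost n c U y q y) = fun _ => (0 : ℝ) := by ext q; simp [modCost]
    rw [this]
    intro r
    by_cases hr : (0 : ℝ) ≤ r
    · simpa [hr] using hcv
    · simpa [hr] using convex_empty
  refine quasi_of_tangential _ _ (Uyset_open h0 h1 (subset_closure hyb)) hcv
    (fun q hq => ((modCost_cd h0 h1 hyb hy hq).of_le (by norm_num)).contDiffWithinAt) ?_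
    (fun q hq w hw => modCost_tangential h0 h1 h2 h3 hyb hy hq w hw)
  intro q hq hzero
  have hm := xOf_mem h1 (subset_closure hyb) hq
  obtain ⟨e, he, hei⟩ := DxyC_equiv h0 h1 hm.1 hyb
  set G := gradX n c (xOf n c U ybar q) y - gradX n c (xOf n c U ybar q) ybar with hG
  have h := modCost_fd h0 h1 hyb hy hq (e G)
  rw [hzero, fderiv_xOf h0 h1 hyb hq, hei] at h
  simp only [← hG, _root_.zero_apply, _root_.neg_apply, ContinuousLinearEquiv.coe_coe,
    e.symm_apply_apply, inner_neg_right, neg_neg] at h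
  have h := inner_self_eq_zero.1 h.symm
  apply hyy
  apply (h1.2 _ (subset_closure hm.1)).1 (subset_closure hy) (subset_closure hyb)
  rw [hG, sub_eq_zero] at h
  simp [h]
end QuasiC

open Set MeasureTheory Metric Bornology
open scoped ENNReal NNReal Pointwise

section GradEst
open Topology Filter
variable {n : ℕ} {c : Euc n → Euc n → ℝ} {U V : Set (Euc n)}

/-- pointwise bounds replacing the suprema -/
structure CBds (n : ℕ) (c : Euc n → Euc n → ℝ) (U V : Set (Euc n)) (bp bm D3 : ℝ) : Prop where
  p : ∀ x ∈ U, ∀ y ∈ V, ‖DxyC n c x y‖ ≤ bp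
  m : ∀ x ∈ U, ∀ y ∈ V, ‖(DxyC n c x y).inverse‖ ≤ bm
  d : ∀ x ∈ U, ∀ y ∈ V, ‖DxxyC n c x y‖ ≤ D3
  one : 1 ≤ bp * bm
  p0 : 0 ≤ bp
  m0 : 0 ≤ bm
  d0 : 0 ≤ D3

variable {bp bm D3 : ℝ}

lemma DxyC_inv_apply (h0 : B0cond n c U V) (h1 : B1cond n c U V) {x y : Euc n} (hx : x ∈ U)
    (hy : y ∈ V) (v : Euc n) : DxyC n c x y ((DxyC n c x y).inverse v) = v ∧
      (DxyC n c x y).inverse (DxyC n c x y v) = v := by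
  obtain ⟨e, he, hei⟩ := DxyC_equiv h0 h1 hx hy
  rw [hei, ← he]; simp

lemma DxyC_X_lip (h0 : B0cond n c U V) (h1 : B1cond n c U V) (h2 : B2cond n c U V)
    (hb : CBds n c U V bp bm D3) {ybar y : Euc n} (hyb : ybar ∈ V) (hy : y ∈ V) {q q' : Euc n}
    (hq : q ∈ Uyset n c U ybar) (hq' : q' ∈ Uyset n c U ybar) :
    ‖DxyC n c (xOf n c U ybar q) y - DxyC n c (xOf n c U ybar q') y‖ ≤ D3 * bm * ‖q - q'‖ := by
  have hcv := h2.1 ybar (subset_closure hyb)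
  refine hcv.norm_image_sub_le_of_norm_hasFDerivWithin_le
    (f := fun q => DxyC n c (xOf n c U ybar q) y)
    (f' := fun q => (DxxyC n c (xOf n c U ybar q) y).comp (fderiv ℝ (xOf n c U ybar) q))
    ?_ ?_ hq' hq
  · intro z hz
    have hm := xOf_mem h1 (subset_closure hyb) hz
    have hd : HasFDerivAt (fun x' => DxyC n c x' y) (DxxyC n c (xOf n c U ybar z) y)
        (xOf n c U ybar z) :=
      ((ContDiffAt.fderiv_right (m := 2) (gradY_cdx h0 hm.1 hy) (by norm_num)).differentiableAt
        (by norm_num)).hasFDerivAt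
    exact (HasFDerivAt.comp (f := xOf n c U ybar) z hd
      ((xOf_cd h0 h1 hyb hz).differentiableAt (by norm_num)).hasFDerivAt).hasFDerivWithinAt
  · intro z hz
    have hm := xOf_mem h1 (subset_closure hyb) hz
    refine (ContinuousLinearMap.opNorm_comp_le _ _).trans ?_
    rw [fderiv_xOf h0 h1 hyb hz, norm_neg]
    exact mul_le_mul (hb.d _ hm.1 _ hy) (hb.m _ hm.1 _ hyb) (norm_nonneg _) hb.d0

lemma grad_est (h0 : B0cond n c U V) (h1 : B1cond n c U V) (h2 : B2cond n c U V)
    (hb : CBds n c U V bp bm D3) {ybar y : Euc n} (hyb : ybar ∈ V) (hy : y ∈ V) {q q' : Euc n}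
    (hq : q ∈ Uyset n c U ybar) (hq' : q' ∈ Uyset n c U ybar) :
    ‖fderiv ℝ (fun q => -modCost n c U ybar q y) q - fderiv ℝ (fun q => -modCost n c U ybar q y) q'‖
      ≤ 2 * bp ^ 2 * bm ^ 4 * D3 * ‖q - q'‖ * ‖fderiv ℝ (fun q => -modCost n c U ybar q y) q'‖ := by
  set T := fderiv ℝ (fun q => -modCost n c U ybar q y) q' with hT
  have hp0 := hb.p0
  have hm0 := hb.m0
  have hd0 := hb.d0
  have hmx := xOf_mem h1 (subset_closure hyb) hq
  have hmx' := xOf_mem h1 (subset_closure hyb) hq'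
  refine ContinuousLinearMap.opNorm_le_bound _ (by positivity) fun w => ?_
  rw [_root_.sub_apply, hT, modCost_fd h0 h1 hyb hy hq, modCost_fd h0 h1 hyb hy hq', ← hT]
  have hTv : ∀ v, T v = _ := fun v => modCost_fd h0 h1 hyb hy hq' v
  have hL : ∀ y1 ∈ V, ‖DxyC n c (xOf n c U ybar q) y1 - DxyC n c (xOf n c U ybar q') y1‖
      ≤ D3 * bm * ‖q - q'‖ := fun y1 hy1 => DxyC_X_lip h0 h1 h2 hb hyb hy1 hq hq'
  rw [fderiv_xOf h0 h1 hyb hq'] at hTv ⊢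
  rw [fderiv_xOf h0 h1 hyb hq]
  set x := xOf n c U ybar q
  set x' := xOf n c U ybar q'
  set G := gradX n c x' y - gradX n c x' ybar with hG
  have hGn : ‖G‖ ≤ bp * ‖T‖ := by
    have h := hTv (DxyC n c x' ybar G)
    rw [_root_.neg_apply, (DxyC_inv_apply h0 h1 hmx'.1 hyb G).2, inner_neg_right, neg_neg,
      real_inner_self_eq_norm_sq] at h
    have h5 : ‖G‖ ^ 2 ≤ ‖T‖ * (bp * ‖G‖) := by
      rw [← h]
      refine (Real.le_norm_self _).trans ((T.le_opNorm _).trans ?_)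
      gcongr
      exact (ContinuousLinearMap.le_opNorm _ _).trans (by gcongr; exact hb.p _ hmx'.1 _ hyb)
    rcases (norm_nonneg G).eq_or_lt with h6 | h6
    · rw [← h6]; positivity
    · have : ‖G‖ * ‖G‖ ≤ (bp * ‖T‖) * ‖G‖ := by nlinarith
      exact le_of_mul_le_mul_right this h6
  obtain ⟨ys, ys', ys'', hys0, hys1, hys⟩ := ypath h0 h1 h2 hmx'.1 hyb hy
  have hyn : ∀ s ∈ Icc (0 : ℝ) 1, ‖ys' s‖ ≤ bm * bp * ‖T‖ := by
    intro s hs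
    obtain ⟨hV, hd1, -, haff⟩ := hys s hs
    have e1 : HasDerivAt (fun τ => gradX n c x' (ys τ))
        (ContinuousLinearMap.adjoint (DxyC n c x' (ys s)) (ys' s)) s :=
      HasFDerivAt.comp_hasDerivAt (f := ys) s (hasFD_gradX h0 hmx'.1 hV) hd1.self_of_nhds
    have e2 : HasDerivAt (fun τ => gradX n c x' (ys τ)) G s :=
      (hasDerivAt_line _ G s).congr_of_eventuallyEq haff
    have e3 := e1.unique e2
    have h5 : ‖ys' s‖ ^ 2 ≤ ‖G‖ * (bm * ‖ys' s‖) := by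
      rw [← real_inner_self_eq_norm_sq]
      nth_rewrite 2 [← (DxyC_inv_apply h0 h1 hmx'.1 hV (ys' s)).1]
      rw [← ContinuousLinearMap.adjoint_inner_left, e3]
      refine (real_inner_le_norm _ _).trans ?_
      gcongr
      exact (ContinuousLinearMap.le_opNorm _ _).trans (by gcongr; exact hb.m _ hmx'.1 _ hV)
    have h7 : ‖ys' s‖ ≤ bm * ‖G‖ := by
      rcases (norm_nonneg (ys' s)).eq_or_lt with h6 | h6
      · rw [← h6]; positivity
      · have : ‖ys' s‖ * ‖ys' s‖ ≤ (bm * ‖G‖) * ‖ys' s‖ := by nlinarith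
        exact le_of_mul_le_mul_right this h6
    calc ‖ys' s‖ ≤ bm * ‖G‖ := h7
      _ ≤ bm * (bp * ‖T‖) := by gcongr
      _ = _ := by ring
  -- the inverse difference
  set B := (DxyC n c x ybar).inverse with hB
  set B' := (DxyC n c x' ybar).inverse with hB'
  have hBn : ‖B‖ ≤ bm := hb.m _ hmx.1 _ hyb
  have hBn' : ‖B'‖ ≤ bm := hb.m _ hmx'.1 _ hyb
  have hBd : ‖B w - B' w‖ ≤ bm ^ 3 * D3 * ‖q - q'‖ * ‖w‖ := by
    have e : B w - B' w = -B ((DxyC n c x ybar - DxyC n c x' ybar) (B' w)) := by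
      rw [_root_.sub_apply, (DxyC_inv_apply h0 h1 hmx'.1 hyb w).1, map_sub,
        (DxyC_inv_apply h0 h1 hmx.1 hyb _).2]; abel
    rw [e, norm_neg]
    calc _ ≤ ‖B‖ * (‖DxyC n c x ybar - DxyC n c x' ybar‖ * (‖B'‖ * ‖w‖)) := by
          refine (B.le_opNorm _).trans ?_
          gcongr
          refine (ContinuousLinearMap.le_opNorm _ _).trans ?_
          gcongr
          exact B'.le_opNorm _
      _ ≤ bm * ((D3 * bm * ‖q - q'‖) * (bm * ‖w‖)) := by
          gcongr
          exact hL _ hyb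
      _ = _ := by ring
  have hmain : ∀ s ∈ Icc (0 : ℝ) 1, ‖DxyC n c x (ys s) (B w) - DxyC n c x' (ys s) (B' w)‖ ≤
      2 * bp * bm ^ 3 * D3 * ‖q - q'‖ * ‖w‖ := by
    intro s hs
    have hV := (hys s hs).1
    have e : DxyC n c x (ys s) (B w) - DxyC n c x' (ys s) (B' w) =
        (DxyC n c x (ys s) - DxyC n c x' (ys s)) (B w) + DxyC n c x' (ys s) (B w - B' w) := by
      simp
    rw [e]
    calc _ ≤ ‖(DxyC n c x (ys s) - DxyC n c x' (ys s)) (B w)‖ + ‖DxyC n c x' (ys s) (B w - B' w)‖ :=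
          norm_add_le _ _
      _ ≤ (D3 * bm * ‖q - q'‖) * (bm * ‖w‖) + bp * (bm ^ 3 * D3 * ‖q - q'‖ * ‖w‖) := by
          refine add_le_add ((ContinuousLinearMap.le_opNorm _ _).trans ?_)
            ((ContinuousLinearMap.le_opNorm _ _).trans ?_)
          · refine mul_le_mul (hL _ hV) ((B.le_opNorm w).trans (by gcongr)) (norm_nonneg _)
              (by positivity)
          · exact mul_le_mul (hb.p _ hmx'.1 _ hV) hBd (norm_nonneg _) hp0
      _ = (bm ^ 2 * D3 * ‖q - q'‖ * ‖w‖) * 1 + bp * (bm ^ 3 * D3 * ‖q - q'‖ * ‖w‖) := by ring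
      _ ≤ (bm ^ 2 * D3 * ‖q - q'‖ * ‖w‖) * (bp * bm) + bp * (bm ^ 3 * D3 * ‖q - q'‖ * ‖w‖) := by
          gcongr; exact hb.one
      _ = _ := by ring
  -- fundamental theorem on the path
  set Fn : ℝ → ℝ := fun s => inner ℝ (gradX n c x (ys s)) (B w) - inner ℝ (gradX n c x' (ys s)) (B' w)
    with hFn
  have hFd : ∀ s ∈ Icc (0 : ℝ) 1, HasDerivWithinAt Fn
      (inner ℝ (ys' s) (DxyC n c x (ys s) (B w) - DxyC n c x' (ys s) (B' w))) (Icc 0 1) s := by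
    intro s hs
    obtain ⟨hV, hd1, -, -⟩ := hys s hs
    have e : ∀ x1 ∈ U, ∀ v : Euc n, HasDerivAt (fun τ => inner ℝ (gradX n c x1 (ys τ)) v)
        (inner ℝ (ys' s) (DxyC n c x1 (ys s) v)) s := by
      intro x1 hx1 v
      have e1 : HasDerivAt (fun τ => gradX n c x1 (ys τ))
        (ContinuousLinearMap.adjoint (DxyC n c x1 (ys s)) (ys' s)) s :=
        HasFDerivAt.comp_hasDerivAt (f := ys) s (hasFD_gradX h0 hx1 hV) hd1.self_of_nhds
      have := e1.inner ℝ (hasDerivAt_const s v)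
      simpa [ContinuousLinearMap.adjoint_inner_left] using this
    rw [inner_sub_right]
    exact ((e x hmx.1 (B w)).sub (e x' hmx'.1 (B' w))).hasDerivWithinAt
  have hfin := (convex_Icc (0 : ℝ) 1).norm_image_sub_le_of_norm_hasDerivWithin_le
    (C := (bm * bp * ‖T‖) * (2 * bp * bm ^ 3 * D3 * ‖q - q'‖ * ‖w‖)) hFd
    (fun s hs => (norm_inner_le_norm _ _).trans
      (mul_le_mul (hyn s hs) (hmain s hs) (norm_nonneg _) (by positivity)))
    (left_mem_Icc.2 zero_le_one) (right_mem_Icc.2 zero_le_one)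
  simp only [hFn, hys0, hys1] at hfin
  simp only [_root_.neg_apply, inner_neg_right, neg_neg, hG, inner_sub_left]
  refine le_trans (le_of_eq ?_) (hfin.trans (le_of_eq ?_))
  · congr 1; ring
  · simp; ring

lemma lin_est (h0 : B0cond n c U V) (h1 : B1cond n c U V) (h2 : B2cond n c U V)
    (hb : CBds n c U V bp bm D3) {ybar y : Euc n} (hyb : ybar ∈ V) (hy : y ∈ V) {q0 : Euc n}
    (hq0 : q0 ∈ Uyset n c U ybar) :
    ∃ p : Euc n, ‖p‖ ≤ bm * ‖gradX n c (xOf n c U ybar q0) y - gradX n c (xOf n c U ybar q0) ybar‖ ∧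
    ∀ q1 ∈ Uyset n c U ybar, ∀ q2 ∈ Uyset n c U ybar, ∀ ρ, ‖q1 - q0‖ ≤ ρ → ‖q2 - q0‖ ≤ ρ →
      |(-modCost n c U ybar q1 y) - (-modCost n c U ybar q2 y) - inner ℝ p (q1 - q2)| ≤
        2 * bp ^ 2 * bm ^ 4 * D3 * ρ * ‖p‖ * ‖q1 - q2‖ := by
  set N := fun q => -modCost n c U ybar q y with hN
  set T := fderiv ℝ N q0 with hT
  have hp0 := hb.p0
  have hm0 := hb.m0
  have hd0 := hb.d0
  refine ⟨(InnerProductSpace.toDual ℝ (Euc n)).symm T, ?_, ?_⟩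
  · rw [LinearIsometryEquiv.norm_map]
    refine ContinuousLinearMap.opNorm_le_bound _ (by positivity) fun w => ?_
    rw [hT, hN, modCost_fd h0 h1 hyb hy hq0, norm_neg, fderiv_xOf h0 h1 hyb hq0]
    refine (norm_inner_le_norm _ _).trans ?_
    rw [_root_.neg_apply, norm_neg, mul_comm bm, mul_assoc]
    gcongr
    exact (ContinuousLinearMap.le_opNorm _ _).trans (by
      gcongr; exact hb.m _ (xOf_mem h1 (subset_closure hyb) hq0).1 _ hyb)
  · intro q1 hq1 q2 hq2 ρ hρ1 hρ2
    rw [InnerProductSpace.toDual_symm_apply, LinearIsometryEquiv.norm_map]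
    have hcv : Convex ℝ (Uyset n c U ybar ∩ closedBall q0 ρ) :=
      (h2.1 ybar (subset_closure hyb)).inter (convex_closedBall q0 ρ)
    have := hcv.norm_image_sub_le_of_norm_hasFDerivWithin_le (f := fun q => N q - T q)
      (f' := fun q => fderiv ℝ N q - T) (C := 2 * bp ^ 2 * bm ^ 4 * D3 * ρ * ‖T‖) (x := q2) (y := q1)
      (fun z hz => ((((modCost_cd h0 h1 hyb hy hz.1).differentiableAt (by norm_num)).hasFDerivAt).sub
        T.hasFDerivAt).hasFDerivWithinAt)
      (fun z hz => by
        refine (grad_est h0 h1 h2 hb hyb hy hz.1 hq0).trans ?_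
        have : ‖z - q0‖ ≤ ρ := by simpa [dist_eq_norm] using hz.2
        gcongr)
      ⟨hq2, by simpa [dist_eq_norm] using hρ2⟩ ⟨hq1, by simpa [dist_eq_norm] using hρ1⟩
    rw [Real.norm_eq_abs] at this
    refine le_trans (le_of_eq ?_) this
    congr 1
    simp only [map_sub]; ring
end GradEst

open Set MeasureTheory Metric Bornology
open scoped ENNReal NNReal Pointwise

section Bdry
open Topology Filter
variable {n : ℕ} {c : Euc n → Euc n → ℝ} {U V : Set (Euc n)}

lemma diffeo_uniqueDiff {f : Euc n → Euc n} {S : Set (Euc n)} (hf : DiffeoOnto n f S)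
    (hD : UniqueDiffOn ℝ (f '' S)) : UniqueDiffOn ℝ S := by
  obtain ⟨hinj, hf1, hg1⟩ := hf
  intro y hy
  set k := Function.invFunOn f S with hk
  have hky : k (f y) = y := hinj.leftInvOn_invFunOn hy
  have hq : f y ∈ f '' S := mem_image_of_mem f hy
  have hkd : HasFDerivWithinAt k (fderivWithin ℝ k (f '' S) (f y)) (f '' S) (f y) :=
    (hg1.differentiableOn (by norm_num) _ hq).hasFDerivWithinAt
  have hfd : HasFDerivWithinAt f (fderivWithin ℝ f S y) S (k (f y)) := by
    rw [hky]; exact (hf1.differentiableOn (by norm_num) _ hy).hasFDerivWithinAt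
  have hkS : MapsTo k (f '' S) S := by
    rintro _ ⟨z, hz, rfl⟩; rw [hk, hinj.leftInvOn_invFunOn hz]; exact hz
  have hcomp := hfd.comp (f y) hkd hkS
  have hid : HasFDerivWithinAt (f ∘ k) (ContinuousLinearMap.id ℝ (Euc n)) (f '' S) (f y) := by
    have hh : ∀ x ∈ f '' S, (f ∘ k) x = id x := by
      rintro _ ⟨z, hz, rfl⟩
      simp only [Function.comp, hk]; rw [hinj.leftInvOn_invFunOn hz]; rfl
    exact (hasFDerivWithinAt_id (f y) (f '' S)).congr hh (hh _ hq)
  have heq := (hD _ hq).eq hcomp hid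
  have hinj' : Function.Injective (fderivWithin ℝ k (f '' S) (f y) : Euc n →ₗ[ℝ] Euc n) := by
    intro a b hab
    have h1 := congrArg (fun T : Euc n →L[ℝ] Euc n => T a) heq
    have h2 := congrArg (fun T : Euc n →L[ℝ] Euc n => T b) heq
    simp only [ContinuousLinearMap.comp_apply, ContinuousLinearMap.id_apply] at h1 h2
    rw [← h1, ← h2]; congr 1
  have hsurj := (LinearMap.injective_iff_surjective).1 hinj'
  have := hkd.uniqueDiffWithinAt (hD _ hq) hsurj.denseRange
  rw [hky] at this
  refine this.mono ?_
  exact hkS.image_subset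

lemma image_closure_eq {f : Euc n → Euc n} {W : Set (Euc n)} (hW : IsBounded W)
    (hf : ContinuousOn f (closure W)) : f '' closure W = closure (f '' W) := by
  apply subset_antisymm
  · exact hf.image_closure
  · have hc : IsCompact (f '' closure W) := (hW.isCompact_closure).image_of_continuousOn hf
    exact closure_minimal (image_mono subset_closure) hc.isClosed

lemma clUy_eq (h0 : B0cond n c U V) (h1 : B1cond n c U V) {y : Euc n} (hy : y ∈ closure V) :
    clUy n c U y = closure (Uyset n c U y) :=
  image_closure_eq h0.2.1 (h1.1 y hy).2.1.continuousOn

lemma uniq_U (h0 : B0cond n c U V) (h1 : B1cond n c U V) (h2 : B2cond n c U V)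
    (hU : U.Nonempty) (hV : V.Nonempty) : UniqueDiffOn ℝ (closure U) := by
  obtain ⟨y, hy⟩ := hV
  have hy := subset_closure (s := V) hy
  refine diffeo_uniqueDiff (h1.1 y hy) ?_
  have : (fun x => -gradY n c x y) '' closure U = closure (Uyset n c U y) := clUy_eq h0 h1 hy
  rw [this]
  have ho := Uyset_open h0 h1 hy
  refine uniqueDiffOn_convex (h2.1 y hy).closure ?_
  have : (Uyset n c U y).Nonempty := hU.image _
  exact this.mono (interior_maximal subset_closure ho)

lemma clVx_eq (h0 : B0cond n c U V) (h1 : B1cond n c U V) {x : Euc n} (hx : x ∈ closure U) :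
    (fun y => -gradX n c x y) '' closure V = closure (Vxset n c V x) :=
  image_closure_eq h0.2.2.2.1 (h1.2 x hx).2.1.continuousOn

lemma uniq_V (h0 : B0cond n c U V) (h1 : B1cond n c U V) (h2 : B2cond n c U V)
    (hU : U.Nonempty) (hV : V.Nonempty) : UniqueDiffOn ℝ (closure V) := by
  obtain ⟨x, hx⟩ := hU
  have hx := subset_closure (s := U) hx
  refine diffeo_uniqueDiff (h1.2 x hx) ?_
  rw [clVx_eq h0 h1 hx]
  have ho := Vxset_open h0 h1 hx
  refine uniqueDiffOn_convex (h2.2 x hx).closure ?_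
  have : (Vxset n c V x).Nonempty := hV.image _
  exact this.mono (interior_maximal subset_closure ho)

lemma gradY_contOn [Nontrivial (Euc n)] (h0 : B0cond n c U V) (h1 : B1cond n c U V)
    (h2 : B2cond n c U V) (hU : U.Nonempty) (hV : V.Nonempty) :
    ContinuousOn (fun p : Euc n × Euc n => gradY n c p.1 p.2) (closure U ×ˢ closure V) := by
  have huU := uniq_U h0 h1 h2 hU hV
  have huV := uniq_V h0 h1 h2 hU hV
  have hu := huU.prod huV
  set S := closure U ×ˢ closure V with hS
  set g : Euc n × Euc n → Euc n := fun p => (InnerProductSpace.toDual ℝ (Euc n)).symm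
    ((fderivWithin ℝ (Function.uncurry c) S p).comp (ContinuousLinearMap.inr ℝ (Euc n) (Euc n)))
    with hg
  have hgc : ContinuousOn g S := by
    have hc := h0.2.2.2.2.continuousOn_fderivWithin hu (by norm_num)
    have hc2 : ContinuousOn (fun p => (fderivWithin ℝ (Function.uncurry c) S p).comp
      (ContinuousLinearMap.inr ℝ (Euc n) (Euc n))) S := hc.clm_comp continuousOn_const
    exact (InnerProductSpace.toDual ℝ (Euc n)).symm.continuous.comp_continuousOn hc2
  have hdiff : ∀ x ∈ closure U, ∀ y ∈ closure V, DifferentiableAt ℝ (fun y' => c x y') y →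
      gradY n c x y = g (x, y) := by
    intro x hx y hy hd
    unfold gradY gradient
    rw [hg]; simp only
    congr 1
    have e1 : HasFDerivWithinAt (fun y' => c x y') ((fderivWithin ℝ (Function.uncurry c) S (x, y)).comp
        (ContinuousLinearMap.inr ℝ (Euc n) (Euc n))) (closure V) y :=
      HasFDerivWithinAt.comp (f := fun y' : Euc n => (x, y')) y
        ((h0.2.2.2.2.differentiableOn (by norm_num) _ (mk_mem_prod hx hy)).hasFDerivWithinAt)
        (hasFDerivAt_prodMk_right x y).hasFDerivWithinAt (fun y' hy' => mk_mem_prod hx hy')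
    exact (huV y hy).eq hd.hasFDerivAt.hasFDerivWithinAt e1
  have hzero : ∀ x y, ¬ DifferentiableAt ℝ (fun y' => c x y') y → gradY n c x y = 0 := by
    intro x y hd
    unfold gradY gradient
    rw [fderiv_zero_of_not_differentiableAt hd, map_zero]
  refine hgc.congr ?_
  rintro ⟨x, y⟩ ⟨hx, hy⟩
  simp only at hx hy ⊢
  by_cases hd : DifferentiableAt ℝ (fun y' => c x y') y
  · exact hdiff x hx y hy hd
  have hx0 := hzero x y hd
  have hother : ∀ x' ∈ closure U, x' ≠ x → gradY n c x' y = g (x', y) := by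
    intro x' hx' hne
    refine hdiff x' hx' y hy ?_
    by_contra hcon
    exact hne ((h1.1 y hy).1 hx' hx (by simp [hx0, hzero x' y hcon]))
  have hcl : x ∈ closure (U ∩ {x}ᶜ) := by
    have h := (dense_compl_singleton x).open_subset_closure_inter h0.1
    exact closure_minimal h isClosed_closure hx
  have hne : (𝓝[U ∩ {x}ᶜ] x).NeBot := mem_closure_iff_nhdsWithin_neBot.1 hcl
  have hmono : 𝓝[U ∩ {x}ᶜ] x ≤ 𝓝[closure U] x :=
    nhdsWithin_mono x (inter_subset_left.trans subset_closure)
  have t1 : Tendsto (fun x' => gradY n c x' y) (𝓝[U ∩ {x}ᶜ] x) (𝓝 (gradY n c x y)) := by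
    have := ((h1.1 y hy).2.1.continuousOn x hx).neg
    have h' : Tendsto (fun x' => - -gradY n c x' y) (𝓝[closure U] x) (𝓝 (- -gradY n c x y)) := this
    simp only [neg_neg] at h'
    exact h'.mono_left hmono
  have t2 : Tendsto (fun x' => g (x', y)) (𝓝[U ∩ {x}ᶜ] x) (𝓝 (g (x, y))) := by
    have : ContinuousWithinAt (fun x' => g (x', y)) (closure U) x :=
      ContinuousWithinAt.comp (f := fun x' : Euc n => (x', y)) (hgc (x, y) (mk_mem_prod hx hy))
        (by fun_prop) (fun x' hx' => mk_mem_prod hx' hy)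
    exact this.tendsto.mono_left hmono
  refine tendsto_nhds_unique t1 (t2.congr' ?_)
  filter_upwards [self_mem_nhdsWithin] with x' hx'
  exact (hother x' (subset_closure hx'.1) hx'.2).symm

lemma exists_seq_closure {S : Set (Euc n)} {y : Euc n} (hy : y ∈ closure S) :
    ∃ s : ℕ → Euc n, (∀ k, s k ∈ S) ∧ Tendsto s atTop (𝓝 y) := mem_closure_iff_seq_limit.1 hy

lemma c_tendsto (h0 : B0cond n c U V) {x y : Euc n} {xs ys : ℕ → Euc n} (hx : x ∈ closure U)
    (hy : y ∈ closure V) (hxs : ∀ k, xs k ∈ closure U) (hys : ∀ k, ys k ∈ closure V)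
    (tx : Tendsto xs atTop (𝓝 x)) (ty : Tendsto ys atTop (𝓝 y)) :
    Tendsto (fun k => c (xs k) (ys k)) atTop (𝓝 (c x y)) := by
  have := h0.2.2.2.2.continuousOn (x, y) (mk_mem_prod hx hy)
  refine this.tendsto.comp (tendsto_nhdsWithin_iff.2 ⟨tx.prodMk_nhds ty, ?_⟩)
  exact Eventually.of_forall fun k => mk_mem_prod (hxs k) (hys k)

lemma gradY_tendsto [Nontrivial (Euc n)] (h0 : B0cond n c U V) (h1 : B1cond n c U V)
    (h2 : B2cond n c U V) (hU : U.Nonempty) (hV : V.Nonempty) {x y : Euc n} {xs ys : ℕ → Euc n}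
    (hx : x ∈ closure U) (hy : y ∈ closure V) (hxs : ∀ k, xs k ∈ closure U)
    (hys : ∀ k, ys k ∈ closure V)
    (tx : Tendsto xs atTop (𝓝 x)) (ty : Tendsto ys atTop (𝓝 y)) :
    Tendsto (fun k => gradY n c (xs k) (ys k)) atTop (𝓝 (gradY n c x y)) := by
  have := gradY_contOn h0 h1 h2 hU hV (x, y) (mk_mem_prod hx hy)
  refine this.tendsto.comp (tendsto_nhdsWithin_iff.2 ⟨tx.prodMk_nhds ty, ?_⟩)
  exact Eventually.of_forall fun k => mk_mem_prod (hxs k) (hys k)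

lemma quasi_bdry [Nontrivial (Euc n)] (h0 : B0cond n c U V) (h1 : B1cond n c U V)
    (h2 : B2cond n c U V) (h3 : B3cond n c U V) (hU : U.Nonempty) (hV : V.Nonempty)
    {ybar y : Euc n} (hyb : ybar ∈ closure V) (hy : y ∈ closure V) :
    QuasiconvexOn ℝ (Uyset n c U ybar) (fun q => -modCost n c U ybar q y) := by
  intro r q1 hq1 q2 hq2 a b ha hb hab
  obtain ⟨hq1, hr1⟩ := hq1
  obtain ⟨hq2, hr2⟩ := hq2
  have hqt := h2.1 ybar hyb hq1 hq2 ha hb hab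
  refine ⟨hqt, ?_⟩
  obtain ⟨yb, hybV, tyb⟩ := exists_seq_closure hyb
  obtain ⟨ys, hysV, tys⟩ := exists_seq_closure hy
  obtain ⟨hx1, hxq1⟩ := xOf_mem h1 hyb hq1
  obtain ⟨hx2, hxq2⟩ := xOf_mem h1 hyb hq2
  simp only [modCost] at hr1 hr2 ⊢
  set x1 := xOf n c U ybar q1
  set x2 := xOf n c U ybar q2
  set Q1 : ℕ → Euc n := fun k => -gradY n c x1 (yb k) with hQ1
  set Q2 : ℕ → Euc n := fun k => -gradY n c x2 (yb k) with hQ2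
  have m1 : ∀ k, Q1 k ∈ Uyset n c U (yb k) := fun k => ⟨x1, hx1, rfl⟩
  have m2 : ∀ k, Q2 k ∈ Uyset n c U (yb k) := fun k => ⟨x2, hx2, rfl⟩
  have hybc : ∀ k, yb k ∈ closure V := fun k => subset_closure (hybV k)
  have hysc : ∀ k, ys k ∈ closure V := fun k => subset_closure (hysV k)
  have mt : ∀ k, a • Q1 k + b • Q2 k ∈ Uyset n c U (yb k) :=
    fun k => h2.1 (yb k) (hybc k) (m1 k) (m2 k) ha hb hab
  set xs : ℕ → Euc n := fun k => xOf n c U (yb k) (a • Q1 k + b • Q2 k) with hxs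
  have hxsU : ∀ k, xs k ∈ U := fun k => (xOf_mem h1 (hybc k) (mt k)).1
  have hxsg : ∀ k, -gradY n c (xs k) (yb k) = a • Q1 k + b • Q2 k :=
    fun k => (xOf_mem h1 (hybc k) (mt k)).2
  obtain ⟨xst, hxst, φ, hφ, tφ⟩ := (h0.2.1.isCompact_closure).tendsto_subseq
    (fun k => subset_closure (hxsU k))
  have tg := gradY_tendsto h0 h1 h2 hU hV hxst hyb (fun k => subset_closure (hxsU (φ k)))
    (fun k => hybc (φ k)) tφ (tyb.comp hφ.tendsto_atTop)
  have tQ : ∀ x' ∈ U, Tendsto (fun k => -gradY n c x' (yb k)) atTop (𝓝 (-gradY n c x' ybar)) :=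
    fun x' hx' => (gradY_tendsto h0 h1 h2 hU hV (subset_closure hx') hyb
      (fun _ => subset_closure hx') hybc tendsto_const_nhds tyb).neg
  have tQt : Tendsto (fun k => a • Q1 k + b • Q2 k) atTop (𝓝 (a • q1 + b • q2)) := by
    have := ((tQ x1 hx1).const_smul a).add ((tQ x2 hx2).const_smul b)
    rwa [hxq1, hxq2] at this
  have heq : -gradY n c xst ybar = a • q1 + b • q2 := by
    refine tendsto_nhds_unique tg.neg ?_
    refine (tQt.comp hφ.tendsto_atTop).congr fun k => ?_
    exact (hxsg (φ k)).symm
  have hxst' : xOf n c U ybar (a • q1 + b • q2) = xst := by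
    rw [← heq]; exact xOf_left h1 hxst hyb
  rw [hxst']
  -- pass to the limit in the quasiconvexity inequality
  have hk : ∀ k, -(c (xs k) (ys k) - c (xs k) (yb k)) ≤
      max (-(c x1 (ys k) - c x1 (yb k))) (-(c x2 (ys k) - c x2 (yb k))) := by
    intro k
    have hqk := modCost_quasi h0 h1 h2 h3 (hybV k) (hysV k)
    have e1 : xOf n c U (yb k) (Q1 k) = x1 := xOf_left h1 (subset_closure hx1) (hybc k)
    have e2 : xOf n c U (yb k) (Q2 k) = x2 := xOf_left h1 (subset_closure hx2) (hybc k)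
    have := (hqk (max (-(c x1 (ys k) - c x1 (yb k))) (-(c x2 (ys k) - c x2 (yb k))))
      (x := Q1 k) ⟨m1 k, by simp only [modCost, e1]; exact le_max_left _ _⟩
      (y := Q2 k) ⟨m2 k, by simp only [modCost, e2]; exact le_max_right _ _⟩ ha hb hab).2
    simpa only [modCost] using this
  have hc1 : ∀ x' ∈ U, Tendsto (fun k => -(c x' (ys k) - c x' (yb k))) atTop
      (𝓝 (-(c x' y - c x' ybar))) := fun x' hx' =>
    ((c_tendsto h0 (subset_closure hx') hy (fun _ => subset_closure hx') hysc tendsto_const_nhds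
      tys).sub (c_tendsto h0 (subset_closure hx') hyb (fun _ => subset_closure hx') hybc
      tendsto_const_nhds tyb)).neg
  have hc2 : Tendsto (fun k => -(c (xs (φ k)) (ys (φ k)) - c (xs (φ k)) (yb (φ k)))) atTop
      (𝓝 (-(c xst y - c xst ybar))) :=
    ((c_tendsto h0 hxst hy (fun k => subset_closure (hxsU (φ k))) (fun k => hysc (φ k)) tφ
      (tys.comp hφ.tendsto_atTop)).sub (c_tendsto h0 hxst hyb
      (fun k => subset_closure (hxsU (φ k))) (fun k => hybc (φ k)) tφ
      (tyb.comp hφ.tendsto_atTop))).neg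
  refine (le_of_tendsto_of_tendsto' hc2
    (((hc1 x1 hx1).max (hc1 x2 hx2)).comp hφ.tendsto_atTop) fun k => hk (φ k)).trans ?_
  exact max_le hr1 hr2

lemma lin_bdry [Nontrivial (Euc n)] {bp bm D3 : ℝ} (h0 : B0cond n c U V) (h1 : B1cond n c U V)
    (h2 : B2cond n c U V) (hU : U.Nonempty) (hV : V.Nonempty)
    (hb : CBds n c U V bp bm D3) {ybar y : Euc n} (hyb : ybar ∈ closure V) (hy : y ∈ closure V)
    {q0 : Euc n} (hq0 : q0 ∈ Uyset n c U ybar) :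
    ∃ p : Euc n, 
    ∀ q1 ∈ Uyset n c U ybar, ∀ q2 ∈ Uyset n c U ybar, 
      |(-modCost n c U ybar q1 y) - (-modCost n c U ybar q2 y) - inner ℝ p (q1 - q2)| ≤
        2 * bp ^ 2 * bm ^ 4 * D3 * max ‖q1 - q0‖ ‖q2 - q0‖ * ‖p‖ * ‖q1 - q2‖ := by
  obtain ⟨yb, hybV, tyb⟩ := exists_seq_closure hyb
  obtain ⟨ys, hysV, tys⟩ := exists_seq_closure hy
  have hybc : ∀ k, yb k ∈ closure V := fun k => subset_closure (hybV k)
  have hysc : ∀ k, ys k ∈ closure V := fun k => subset_closure (hysV k)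
  obtain ⟨hx0, hxq0⟩ := xOf_mem h1 hyb hq0
  set x0 := xOf n c U ybar q0
  have hQm : ∀ x' ∈ U, ∀ k, -gradY n c x' (yb k) ∈ Uyset n c U (yb k) := fun x' hx' k => ⟨x', hx', rfl⟩
  have hXe : ∀ x' ∈ U, ∀ k, xOf n c U (yb k) (-gradY n c x' (yb k)) = x' := fun x' hx' k =>
    xOf_left h1 (subset_closure hx') (hybc k)
  have tQ : ∀ x' ∈ U, Tendsto (fun k => -gradY n c x' (yb k)) atTop (𝓝 (-gradY n c x' ybar)) :=
    fun x' hx' => (gradY_tendsto h0 h1 h2 hU hV (subset_closure hx') hyb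
      (fun _ => subset_closure hx') hybc tendsto_const_nhds tyb).neg
  choose p hpn hp using fun k => lin_est h0 h1 h2 hb (hybV k) (hysV k) (hQm x0 hx0 k)
  have hbd : ∃ R, ∀ k, ‖p k‖ ≤ R := by
    have hcomp : IsCompact (closure V) := h0.2.2.2.1.isCompact_closure
    obtain ⟨R, hR⟩ := hcomp.exists_bound_of_continuousOn
      (h1.2 x0 (subset_closure hx0)).2.1.continuousOn
    refine ⟨bm * (R + R), fun k => (hpn k).trans ?_⟩
    have := hb.m0
    gcongr
    rw [hXe x0 hx0]
    refine (norm_sub_le _ _).trans (add_le_add ?_ ?_)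
    · have := hR _ (hysc k); rwa [norm_neg] at this
    · have := hR _ (hybc k); rwa [norm_neg] at this
  obtain ⟨R, hR⟩ := hbd
  obtain ⟨ps, -, φ, hφ, tφ⟩ := (isCompact_closedBall (0 : Euc n) R).tendsto_subseq
    (x := p) (fun k => by simpa using hR k)
  refine ⟨ps, fun q1 hq1 q2 hq2 => ?_⟩
  obtain ⟨hx1, hxq1⟩ := xOf_mem h1 hyb hq1
  obtain ⟨hx2, hxq2⟩ := xOf_mem h1 hyb hq2
  simp only [modCost]
  set x1 := xOf n c U ybar q1
  set x2 := xOf n c U ybar q2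
  have hk : ∀ k, _ := fun k => hp k _ (hQm x1 hx1 k) _ (hQm x2 hx2 k) _ (le_max_left _ _)
    (le_max_right _ _)
  simp only [modCost, hXe x1 hx1, hXe x2 hx2] at hk
  have hc1 : ∀ x' ∈ U, Tendsto (fun k => -(c x' (ys k) - c x' (yb k))) atTop
      (𝓝 (-(c x' y - c x' ybar))) := fun x' hx' =>
    ((c_tendsto h0 (subset_closure hx') hy (fun _ => subset_closure hx') hysc tendsto_const_nhds
      tys).sub (c_tendsto h0 (subset_closure hx') hyb (fun _ => subset_closure hx') hybc
      tendsto_const_nhds tyb)).neg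
  have T0 := tQ x0 hx0
  have T1 := tQ x1 hx1
  have T2 := tQ x2 hx2
  rw [hxq0] at T0; rw [hxq1] at T1; rw [hxq2] at T2
  have S0 := T0.comp hφ.tendsto_atTop
  have S1 := T1.comp hφ.tendsto_atTop
  have S2 := T2.comp hφ.tendsto_atTop
  have L : Tendsto (fun k => |(-(c x1 (ys (φ k)) - c x1 (yb (φ k)))) -
      (-(c x2 (ys (φ k)) - c x2 (yb (φ k)))) -
      inner ℝ (p (φ k)) (-gradY n c x1 (yb (φ k)) - -gradY n c x2 (yb (φ k)))|) atTop
      (𝓝 |(-(c x1 y - c x1 ybar)) - (-(c x2 y - c x2 ybar)) - inner ℝ ps (q1 - q2)|) :=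
    ((((hc1 x1 hx1).comp hφ.tendsto_atTop).sub ((hc1 x2 hx2).comp hφ.tendsto_atTop)).sub
      (tφ.inner (S1.sub S2))).abs
  refine le_of_tendsto_of_tendsto' L
    ((((((S1.sub S0).norm.max (S2.sub S0).norm).const_mul (2 * bp ^ 2 * bm ^ 4 * D3)).mul
      tφ.norm).mul (S1.sub S2).norm)) fun k => hk (φ k)

end Bdry

open Set MeasureTheory Metric Bornology
open scoped ENNReal NNReal Pointwise

section Ident
open Topology Filter
variable {n : ℕ} {c : Euc n → Euc n → ℝ} {U V : Set (Euc n)}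

lemma det_adj (A : Euc n →L[ℝ] Euc n) :
    LinearMap.det ((ContinuousLinearMap.adjoint A : Euc n →L[ℝ] Euc n) : Euc n →ₗ[ℝ] Euc n) =
      LinearMap.det (A : Euc n →ₗ[ℝ] Euc n) := by
  have h : ((ContinuousLinearMap.adjoint A : Euc n →L[ℝ] Euc n) : Euc n →ₗ[ℝ] Euc n) =
      LinearMap.adjoint (A : Euc n →ₗ[ℝ] Euc n) := by
    rw [LinearMap.eq_adjoint_iff]
    intro x y
    exact ContinuousLinearMap.adjoint_inner_left A y x
  rw [h]
  set b := EuclideanSpace.basisFun (Fin n) ℝ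
  rw [← LinearMap.det_toMatrix b.toBasis, ← LinearMap.det_toMatrix b.toBasis,
    LinearMap.toMatrix_adjoint b b, Matrix.det_conjTranspose]
  simp

lemma cx_diff (h0 : B0cond n c U V) {x y : Euc n} (hx : x ∈ U) (hy : y ∈ closure V) :
    HasFDerivAt (fun x' => c x' y) (innerSL ℝ (gradX n c x y)) x := by
  have h : ContDiffOn ℝ 4 (fun x' => c x' y) (closure U) := by
    have := h0.2.2.2.2.comp (f := fun x' : Euc n => (x', y)) (s := closure U)
      (contDiff_id.prodMk contDiff_const).contDiffOn (fun x' hx' => mk_mem_prod hx' hy)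
    exact this
  have hd : DifferentiableAt ℝ (fun x' => c x' y) x :=
    (h.contDiffAt (mem_of_superset (h0.1.mem_nhds hx) subset_closure)).differentiableAt (by norm_num)
  exact hd.hasGradientAt.hasFDerivAt

lemma xOf_fd (h0 : B0cond n c U V) (h1 : B1cond n c U V) {ybar q : Euc n}
    (hyb : ybar ∈ closure V) (hq : q ∈ Uyset n c U ybar) :
    ∃ e : Euc n ≃L[ℝ] Euc n, HasFDerivAt (xOf n c U ybar) (e : Euc n →L[ℝ] Euc n) q ∧
      HasFDerivAt (fun x => -gradY n c x ybar) (e.symm : Euc n →L[ℝ] Euc n) (xOf n c U ybar q) := by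
  obtain ⟨x, hx, rfl⟩ := hq
  have hn := mem_of_superset (h0.1.mem_nhds hx) (subset_closure (s := U))
  obtain ⟨e, he⟩ := diffeo_equiv (h1.1 ybar hyb) hn
  refine ⟨e.symm, (diffeo_inv (h1.1 ybar hyb).1 hn he).hasFDerivAt, ?_⟩
  simp only
  rw [xOf_left h1 (subset_closure hx) hyb]
  exact he.hasFDerivAt

lemma gradY_mod (ybar q y : Euc n) :
    gradY n (modCost n c U ybar) q y = gradY n c (xOf n c U ybar q) y := by
  unfold gradY gradient modCost
  rw [fderiv_sub_const]

lemma DxyC_mod (h0 : B0cond n c U V) (h1 : B1cond n c U V) {ybar q y : Euc n}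
    (hyb : ybar ∈ closure V) (hq : q ∈ Uyset n c U ybar) (hy : y ∈ V)
    {e : Euc n →L[ℝ] Euc n} (he : HasFDerivAt (xOf n c U ybar) e q) :
    DxyC n (modCost n c U ybar) q y = (DxyC n c (xOf n c U ybar q) y).comp e := by
  have : (fun q' => gradY n (modCost n c U ybar) q' y) =
      fun q' => gradY n c (xOf n c U ybar q') y := by
    funext q'; exact gradY_mod ybar q' y
  unfold DxyC
  rw [this]
  have h := hasFD_gradY h0 (xOf_mem h1 hyb hq).1 hy
  exact (HasFDerivAt.comp (f := xOf n c U ybar) q h he).fderiv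

lemma p_ident (h0 : B0cond n c U V) (h1 : B1cond n c U V) {ybar q0 y p : Euc n} {K : ℝ}
    (hyb : ybar ∈ closure V) (hq : q0 ∈ Uyset n c U ybar) (hy : y ∈ closure V)
    {e : Euc n →L[ℝ] Euc n} (he : HasFDerivAt (xOf n c U ybar) e q0)
    (hp : ∀ q1 ∈ Uyset n c U ybar, ∀ q2 ∈ Uyset n c U ybar,
      |(-modCost n c U ybar q1 y) - (-modCost n c U ybar q2 y) - inner ℝ p (q1 - q2)| ≤
        K * max ‖q1 - q0‖ ‖q2 - q0‖ * ‖p‖ * ‖q1 - q2‖) :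
    p = -(ContinuousLinearMap.adjoint e (gradX n c (xOf n c U ybar q0) y
      - gradX n c (xOf n c U ybar q0) ybar)) := by
  have hx := (xOf_mem h1 hyb hq).1
  have d1 : HasFDerivAt (fun q => -modCost n c U ybar q y)
      (-((innerSL ℝ (gradX n c (xOf n c U ybar q0) y)).comp e -
        (innerSL ℝ (gradX n c (xOf n c U ybar q0) ybar)).comp e)) q0 :=
    ((HasFDerivAt.comp (f := xOf n c U ybar) q0 (cx_diff h0 hx hy) he).sub
      (HasFDerivAt.comp (f := xOf n c U ybar) q0 (cx_diff h0 hx hyb) he)).neg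
  have d2 : HasFDerivAt (fun q => -modCost n c U ybar q y) (innerSL ℝ p) q0 := by
    rw [hasFDerivAt_iff_isLittleO_nhds_zero]
    have hO : (fun h : Euc n => -modCost n c U ybar (q0 + h) y - -modCost n c U ybar q0 y -
        innerSL ℝ p h) =O[𝓝 0] fun h : Euc n => ‖h‖ ^ 2 := by
      refine Asymptotics.IsBigO.of_bound (|K| * ‖p‖) ?_
      have : ∀ᶠ h in 𝓝 (0 : Euc n), q0 + h ∈ Uyset n c U ybar := by
        have ht : Tendsto (fun h : Euc n => q0 + h) (𝓝 0) (𝓝 q0) := by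
          have := (continuous_const_add q0).tendsto (0 : Euc n)
          simpa using this
        exact ht.eventually ((Uyset_open h0 h1 hyb).mem_nhds hq)
      filter_upwards [this] with h hh
      have := hp _ hh _ hq
      simp only [add_sub_cancel_left, sub_self, norm_zero] at this
      rw [max_eq_left (norm_nonneg _)] at this
      rw [innerSL_apply_apply, Real.norm_eq_abs, norm_pow, norm_norm]
      refine this.trans ?_
      calc K * ‖h‖ * ‖p‖ * ‖h‖ ≤ |K| * ‖h‖ * ‖p‖ * ‖h‖ := by gcongr; exact le_abs_self K
        _ = _ := by ring
    refine hO.trans_isLittleO ?_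
    exact Asymptotics.isLittleO_norm_pow_id one_lt_two
  have heq := d2.unique d1
  refine ext_inner_right ℝ fun v => ?_
  have := congrArg (fun T : Euc n →L[ℝ] ℝ => T v) heq
  simp only [innerSL_apply_apply, _root_.neg_apply, _root_.sub_apply,
    ContinuousLinearMap.comp_apply] at this
  rw [this, inner_neg_left, ContinuousLinearMap.adjoint_inner_left, inner_sub_left]

lemma eps_arith {a b d : ℝ} (p0 : 0 ≤ a) (m0 : 0 ≤ b) (d0 : 0 ≤ d) (one : 1 ≤ a * b)
    (hne : 2 * a ^ 4 * b ^ 6 * d ≠ 0) :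
    2 * a ^ 2 * b ^ 4 * d * (2 * a ^ 4 * b ^ 6 * d)⁻¹ ≤ 1 := by
  have h3 : 1 ≤ (a * b) ^ 2 := one_le_pow₀ one
  have h4 : 2 * a ^ 2 * b ^ 4 * d ≤ 2 * a ^ 4 * b ^ 6 * d := by
    have : 0 ≤ 2 * a ^ 2 * b ^ 4 * d := by positivity
    calc _ ≤ 2 * a ^ 2 * b ^ 4 * d * (a * b) ^ 2 := le_mul_of_one_le_right this h3
      _ = _ := by ring
  have hpos : 0 < 2 * a ^ 4 * b ^ 6 * d := lt_of_le_of_ne (by positivity) hne.symm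
  rw [← div_eq_mul_inv, div_le_one hpos]
  exact h4

/-- from `ε_c > 0` to bounds -/
lemma cbds_of_eps [Nontrivial (Euc n)] (h0 : B0cond n c U V) (h1 : B1cond n c U V)
    (hU : U.Nonempty) (hV : V.Nonempty) (he : 0 < epsC n c U V) :
    CBds n c U V (betaPlus n c U V) (betaMinus n c U V) (supDxxy n c U V) ∧
    2 * betaPlus n c U V ^ 2 * betaMinus n c U V ^ 4 * supDxxy n c U V * epsC n c U V ≤ 1 := by
  have hne : 2 * (betaPlus n c U V) ^ 4 * (betaMinus n c U V) ^ 6 * supDxxy n c U V ≠ 0 := by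
    intro h; rw [epsC, h, inv_zero] at he; exact lt_irrefl _ he
  have hp : betaPlus n c U V ≠ 0 := by rintro h; simp [h] at hne
  have hm : betaMinus n c U V ≠ 0 := by rintro h; simp [h] at hne
  have hd : supDxxy n c U V ≠ 0 := by rintro h; simp [h] at hne
  have bp : BddAbove ((fun p : Euc n × Euc n => ‖DxyC n c p.1 p.2‖) '' (U ×ˢ V)) := by
    by_contra h; exact hp (Real.sSup_of_not_bddAbove h)
  have bm : BddAbove ((fun p : Euc n × Euc n => ‖(DxyC n c p.1 p.2).inverse‖) '' (U ×ˢ V)) := by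
    by_contra h; exact hm (Real.sSup_of_not_bddAbove h)
  have bd : BddAbove ((fun p : Euc n × Euc n => ‖DxxyC n c p.1 p.2‖) '' (U ×ˢ V)) := by
    by_contra h; exact hd (Real.sSup_of_not_bddAbove h)
  have Hp : ∀ x ∈ U, ∀ y ∈ V, ‖DxyC n c x y‖ ≤ betaPlus n c U V := by
    intro x hx y hy
    rw [betaPlus]
    exact le_csSup bp ⟨(x, y), mk_mem_prod hx hy, rfl⟩
  have Hm : ∀ x ∈ U, ∀ y ∈ V, ‖(DxyC n c x y).inverse‖ ≤ betaMinus n c U V := by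
    intro x hx y hy
    rw [betaMinus]
    exact le_csSup bm ⟨(x, y), mk_mem_prod hx hy, rfl⟩
  have Hd : ∀ x ∈ U, ∀ y ∈ V, ‖DxxyC n c x y‖ ≤ supDxxy n c U V := by
    intro x hx y hy
    rw [supDxxy]
    exact le_csSup bd ⟨(x, y), mk_mem_prod hx hy, rfl⟩
  obtain ⟨x, hx⟩ := hU
  obtain ⟨y, hy⟩ := hV
  have p0 := (norm_nonneg _).trans (Hp x hx y hy)
  have m0 := (norm_nonneg _).trans (Hm x hx y hy)
  have d0 := (norm_nonneg (DxxyC n c x y)).trans (Hd x hx y hy)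
  have one : 1 ≤ betaPlus n c U V * betaMinus n c U V := by
    obtain ⟨e, he1, he2⟩ := DxyC_equiv h0 h1 hx hy
    have h1 : (DxyC n c x y).comp (DxyC n c x y).inverse = ContinuousLinearMap.id ℝ (Euc n) := by
      rw [he2, ← he1]; ext v; simp
    have h2 : ‖ContinuousLinearMap.id ℝ (Euc n)‖ = 1 := ContinuousLinearMap.norm_id
    rw [← h2, ← h1]
    refine (ContinuousLinearMap.opNorm_comp_le _ _).trans ?_
    exact mul_le_mul (Hp x hx y hy) (Hm x hx y hy) (norm_nonneg _) p0
  refine ⟨⟨Hp, Hm, Hd, one, p0, m0, d0⟩, ?_⟩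
  exact eps_arith p0 m0 d0 one hne

end Ident

open Set MeasureTheory Metric Bornology
open scoped ENNReal NNReal Pointwise

section Meas
open Topology Filter
variable {n : ℕ} {c : Euc n → Euc n → ℝ} {U V : Set (Euc n)}

lemma clV_null (h0 : B0cond n c U V) (h1 : B1cond n c U V) (h2 : B2cond n c U V)
    (hU : U.Nonempty) : volume (closure V \ V) = 0 := by
  obtain ⟨x, hx⟩ := hU
  have hx := subset_closure (s := U) hx
  obtain ⟨hinj, -, hk⟩ := h1.2 x hx
  have ho := Vxset_open h0 h1 hx
  have hz : volume (closure (Vxset n c V x) \ Vxset n c V x) = 0 := by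
    have := (h2.2 x hx).addHaar_frontier volume
    rwa [frontier, ho.interior_eq] at this
  have hd : DifferentiableOn ℝ (yOf n c V x) (closure (Vxset n c V x) \ Vxset n c V x) := by
    refine (hk.differentiableOn (by norm_num)).mono ?_
    rw [clVx_eq h0 h1 hx]; exact diff_subset
  refine measure_mono_null ?_
    (addHaar_image_eq_zero_of_differentiableOn_of_addHaar_eq_zero volume hd hz)
  rintro y ⟨hy, hyV⟩
  refine ⟨-gradX n c x y, ⟨?_, ?_⟩, yOf_left h1 hx hy⟩
  · rw [← clVx_eq h0 h1 hx]; exact ⟨y, hy, rfl⟩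
  · rintro ⟨y', hy', he⟩
    exact hyV (hinj (subset_closure hy') hy he ▸ hy')

lemma vol_bound {P : Euc n → Euc n} {P' : Euc n → Euc n →L[ℝ] Euc n} {V : Set (Euc n)}
    (hV : IsOpen V) (hP : ∀ y ∈ V, HasFDerivAt P (P' y) y) (hinj : InjOn P V) {γ : ℝ}
    (hγ : ∀ y ∈ V, (P' y).det ≠ 0 ∧ |(P' y).det|⁻¹ ≤ γ) {K : Set (Euc n)} (hK : IsClosed K) :
    volume (V ∩ P ⁻¹' K) ≤ ENNReal.ofReal γ * volume K := by
  have hc : ContinuousOn P V := fun y hy => (hP y hy).continuousAt.continuousWithinAt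
  have hm : MeasurableSet (V ∩ P ⁻¹' K) := by
    obtain ⟨F, hF, he⟩ := (continuousOn_iff_isClosed.1 hc) K hK
    rw [inter_comm, he]; exact hF.measurableSet.inter hV.measurableSet
  set W := V ∩ P ⁻¹' K with hW
  have hcv := lintegral_abs_det_fderiv_eq_addHaar_image volume hm (f := P) (f' := P')
    (fun y hy => (hP y hy.1).hasFDerivWithinAt) (hinj.mono inter_subset_left)
  have h1 : volume (P '' W) ≤ volume K := measure_mono (by rintro _ ⟨y, hy, rfl⟩; exact hy.2)
  calc volume W = ∫⁻ y in W, 1 := by simp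
    _ ≤ ∫⁻ y in W, ENNReal.ofReal γ * ENNReal.ofReal |(P' y).det| := by
        refine setLIntegral_mono' hm fun y hy => ?_
        obtain ⟨hne, hle⟩ := hγ y hy.1
        have hpos : 0 < |(P' y).det| := abs_pos.2 hne
        have hg : 0 ≤ γ := (inv_nonneg.2 hpos.le).trans hle
        rw [← ENNReal.ofReal_mul hg, ← ENNReal.ofReal_one]
        refine ENNReal.ofReal_le_ofReal ?_
        rw [inv_le_iff_one_le_mul₀ hpos] at hle
        exact hle
    _ = ENNReal.ofReal γ * ∫⁻ y in W, ENNReal.ofReal |(P' y).det| :=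
        lintegral_const_mul' _ _ ENNReal.ofReal_ne_top
    _ ≤ _ := by rw [hcv]; gcongr

lemma det_bdd (R : ℝ) : ∃ K : ℝ, 0 ≤ K ∧ ∀ A : Euc n →L[ℝ] Euc n, ‖A‖ ≤ R → |A.det| ≤ K := by
  have hc : IsCompact (closedBall (0 : Euc n →L[ℝ] Euc n) R) := isCompact_closedBall _ _
  obtain ⟨K, hK⟩ := hc.exists_bound_of_continuousOn
    (ContinuousLinearMap.continuous_det (𝕜 := ℝ) (E := Euc n)).continuousOn
  refine ⟨max K 0, le_max_right _ _, fun A hA => ?_⟩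
  exact (hK A (by simpa using hA)).trans (le_max_left _ _)

lemma interior_clUy (h0 : B0cond n c U V) (h1 : B1cond n c U V) (h2 : B2cond n c U V)
    (hU : U.Nonempty) {ybar : Euc n} (hyb : ybar ∈ closure V) :
    interior (clUy n c U ybar) = Uyset n c U ybar := by
  have ho := Uyset_open h0 h1 hyb
  rw [clUy_eq h0 h1 hyb, (h2.1 ybar hyb).interior_closure_eq_interior_of_nonempty_interior,
    ho.interior_eq]
  rw [ho.interior_eq]; exact hU.image _

lemma det_zero_bdry [Nontrivial (Euc n)] (h0 : B0cond n c U V) (h1 : B1cond n c U V)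
    (h2 : B2cond n c U V) (hU : U.Nonempty) {ybar q y : Euc n} (hyb : ybar ∈ closure V)
    (hq : q ∈ clUy n c U ybar) (hq' : q ∉ Uyset n c U ybar) :
    (DxyC n (modCost n c U ybar) q y).det = 0 := by
  by_contra hdet
  set G : Euc n → Euc n := fun q' => gradY n (modCost n c U ybar) q' y with hG
  set A := DxyC n (modCost n c U ybar) q y with hA
  have hA0 : fderiv ℝ G q ≠ 0 := by
    intro h
    have : A = 0 := h
    rw [this] at hdet
    exact hdet (by
      change LinearMap.det ((0 : Euc n →L[ℝ] Euc n) : Euc n →ₗ[ℝ] Euc n) = 0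
      simp [LinearMap.det_zero', LinearMap.det_zero])
  have hd : HasFDerivAt G A q := by
    have : DifferentiableAt ℝ G q := by
      by_contra h; exact hA0 (fderiv_zero_of_not_differentiableAt h)
    exact this.hasFDerivAt
  have hanti : ∃ C, AntilipschitzWith C A := by
    set e := LinearMap.equivOfDetNeZero (A : Euc n →ₗ[ℝ] Euc n) hdet
    refine ⟨_, (e.toContinuousLinearEquiv).antilipschitz⟩
  have hconst : ∀ q1 ∉ clUy n c U ybar, G q1 = gradY n c (Classical.choice ⟨q⟩) y := by
    intro q1 hq1
    rw [hG]; simp only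
    rw [gradY_mod, xOf, Function.invFunOn_neg]
    rintro ⟨x, hx, hxe⟩
    exact hq1 ⟨x, hx, hxe⟩
  have hev := hd.eventually_ne (c := gradY n c (Classical.choice ⟨q⟩) y) hanti
  have hni : q ∈ closure (clUy n c U ybar)ᶜ := by
    rw [closure_compl, interior_clUy h0 h1 h2 hU hyb]; exact hq'
  rw [eventually_nhdsWithin_iff] at hev
  obtain ⟨q1, hq1, hq1'⟩ := (mem_closure_iff_frequently.1 hni).and_eventually hev |>.exists
  refine hq1' ?_ (hconst q1 hq1)
  rintro rfl
  exact hq1 hq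

lemma gamma_bdd [Nontrivial (Euc n)] {bp bm D3 : ℝ} (h0 : B0cond n c U V) (h1 : B1cond n c U V)
    (h2 : B2cond n c U V) (hU : U.Nonempty) (hV : V.Nonempty) (hb : CBds n c U V bp bm D3)
    {ybar : Euc n} (hyb : ybar ∈ closure V) {Q : Set (Euc n)} (hQ : Q ⊆ clUy n c U ybar) :
    BddAbove ((fun p : Euc n × Euc n =>
    |LinearMap.det ((DxyC n (modCost n c U ybar) p.1 p.2 : Euc n →L[ℝ] Euc n) :
      Euc n →ₗ[ℝ] Euc n)|⁻¹) '' (Q ×ˢ V)) := by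
  obtain ⟨K1, hK10, hK1⟩ := det_bdd (n := n) bm
  have hcont : ContinuousOn (fderivWithin ℝ (fun x => -gradY n c x ybar) (closure U)) (closure U) :=
    (h1.1 ybar hyb).2.1.continuousOn_fderivWithin (uniq_U h0 h1 h2 hU hV) (by norm_num)
  obtain ⟨R, hR⟩ := h0.2.1.isCompact_closure.exists_bound_of_continuousOn hcont
  obtain ⟨K2, hK20, hK2⟩ := det_bdd (n := n) R
  refine ⟨K1 * K2, ?_⟩
  rintro _ ⟨⟨q, y⟩, ⟨hq, hy⟩, rfl⟩
  simp only at hq hy ⊢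
  by_cases hqU : q ∈ Uyset n c U ybar
  · obtain ⟨e, he, hes⟩ := xOf_fd h0 h1 hyb hqU
    have hx := (xOf_mem h1 hyb hqU).1
    rw [DxyC_mod h0 h1 hyb hqU hy he]
    obtain ⟨f, hf1, hf2⟩ := DxyC_equiv h0 h1 hx hy
    have e1 : ∀ f : Euc n ≃L[ℝ] Euc n, |LinearMap.det ((f : Euc n →L[ℝ] Euc n) : Euc n →ₗ[ℝ] Euc n)|⁻¹
        = |(f.symm : Euc n →L[ℝ] Euc n).det| := by
      intro f
      rw [← abs_inv]; congr 1
      exact (ContinuousLinearEquiv.det_coe_symm f).symm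
    have e2 : ((((DxyC n c (xOf n c U ybar q) y).comp (e : Euc n →L[ℝ] Euc n)) :
        Euc n →L[ℝ] Euc n) : Euc n →ₗ[ℝ] Euc n) =
        ((DxyC n c (xOf n c U ybar q) y : Euc n →L[ℝ] Euc n) : Euc n →ₗ[ℝ] Euc n) ∘ₗ
          ((e : Euc n →L[ℝ] Euc n) : Euc n →ₗ[ℝ] Euc n) := rfl
    rw [e2, LinearMap.det_comp, abs_mul, mul_inv, e1, ← hf1, e1, ← hf2]
    refine mul_le_mul (hK1 _ (hb.m _ hx _ hy)) (hK2 _ ?_) (abs_nonneg _) hK10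
    have := hR _ (subset_closure hx)
    rwa [hes.hasFDerivWithinAt.fderivWithin (uniq_U h0 h1 h2 hU hV _ (subset_closure hx))] at this
  · have : LinearMap.det ((DxyC n (modCost n c U ybar) q y : Euc n →L[ℝ] Euc n) :
      Euc n →ₗ[ℝ] Euc n) = 0 := det_zero_bdry h0 h1 h2 hU hyb (hQ hq) hqU
    rw [this, abs_zero, inv_zero]
    positivity

end Meas

open Set MeasureTheory Metric Bornology
open scoped ENNReal NNReal Pointwise

section Pot
open Topology Filter
variable {n : ℕ} {c : Euc n → Euc n → ℝ} {U V : Set (Euc n)}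

lemma c_bdd (h0 : B0cond n c U V) :
    ∃ M : ℝ, ∀ x ∈ closure U, ∀ y ∈ closure V, |c x y| ≤ M := by
  obtain ⟨M, hM⟩ := (h0.2.1.isCompact_closure.prod h0.2.2.2.1.isCompact_closure).exists_bound_of_continuousOn
    h0.2.2.2.2.continuousOn
  exact ⟨M, fun x hx y hy => hM (x, y) (mk_mem_prod hx hy)⟩

lemma u_bdd (h0 : B0cond n c U V) {u : Euc n → ℝ} (hV : V.Nonempty)
    (hu : CConvexOn n c (closure U) (closure V) u) : ∃ K : ℝ, ∀ x ∈ closure U, K ≤ u x := by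
  obtain ⟨M, hM⟩ := c_bdd h0
  by_contra hcon
  push Not at hcon
  have hz : ∀ y ∈ closure V, cStarT n c (closure U) u y = 0 := by
    intro y hy
    refine Real.sSup_of_not_bddAbove ?_
    rintro ⟨B, hB⟩
    obtain ⟨x, hx, hlt⟩ := hcon (-B - M)
    have h1 : -c x y - u x ≤ B := hB ⟨x, hx, rfl⟩
    have h2 := abs_le.1 (hM x hx y hy)
    linarith
  obtain ⟨x, hx, hlt⟩ := hcon (-M)
  obtain ⟨y, hy⟩ := hV
  have hy := subset_closure (s := V) hy
  have h1 : -c x y - cStarT n c (closure U) u y ≤ u x := by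
    rw [hu x hx]
    refine le_csSup ⟨M, ?_⟩ ⟨y, hy, rfl⟩
    rintro _ ⟨y', hy', rfl⟩
    simp only [hz y' hy', sub_zero]
    have := abs_le.1 (hM x hx y' hy'); linarith
  rw [hz y hy] at h1
  have := abs_le.1 (hM x hx y hy); linarith

lemma xOf_mem_cl {ybar q : Euc n} (hq : q ∈ clUy n c U ybar) : xOf n c U ybar q ∈ closure U :=
  Function.invFunOn_mem hq

lemma supp_le (h0 : B0cond n c U V) {u : Euc n → ℝ} (hV : V.Nonempty)
    (hu : CConvexOn n c (closure U) (closure V) u) {ybar y q' : Euc n}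
    (hy : y ∈ cSubdiffAt n (modCost n c U ybar) (clUy n c U ybar) (closure V)
      (modPot n c U ybar u) q') :
    ∀ q ∈ clUy n c U ybar, -modCost n c U ybar q y + modCost n c U ybar q' y +
      modPot n c U ybar u q' ≤ modPot n c U ybar u q := by
  intro q hq
  obtain ⟨M, hM⟩ := c_bdd h0
  obtain ⟨K, hK⟩ := u_bdd h0 hV hu
  obtain ⟨hq', hyV, heq⟩ := hy
  simp only at hq' hyV heq
  have : -modCost n c U ybar q y - modPot n c U ybar u q ≤
      cStarT n (modCost n c U ybar) (clUy n c U ybar) (modPot n c U ybar u) y := by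
    refine le_csSup ⟨M - K, ?_⟩ ⟨q, hq, rfl⟩
    rintro _ ⟨q1, hq1, rfl⟩
    simp only [modCost, modPot]
    have hx := xOf_mem_cl hq1
    have h1 := abs_le.1 (hM _ hx y hyV)
    have h2 := hK _ hx
    linarith
  linarith

lemma pot_ge (h0 : B0cond n c U V) {u : Euc n → ℝ} (hV : V.Nonempty)
    (hu : CConvexOn n c (closure U) (closure V) u) {ybar q' : Euc n} (hyb : ybar ∈ closure V)
    {Q : Set (Euc n)} (hQ : Q ⊆ clUy n c U ybar) (hq' : q' ∈ Q) :
    -|sInf (modPot n c U ybar u '' Q)| ≤ modPot n c U ybar u q' := by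
  obtain ⟨M, hM⟩ := c_bdd h0
  obtain ⟨K, hK⟩ := u_bdd h0 hV hu
  refine (neg_abs_le _).trans (csInf_le ⟨K - M, ?_⟩ ⟨q', hq', rfl⟩)
  rintro _ ⟨q1, hq1, rfl⟩
  simp only [modPot]
  have hx := xOf_mem_cl (hQ hq1)
  have h1 := abs_le.1 (hM _ hx ybar hyb)
  have h2 := hK _ hx
  linarith

/-- The polar body. -/
lemma polar_vol (A : Euc n →L[ℝ] Euc n) (hA : A.det ≠ 0) {R : ℝ} (hR : 0 ≤ R) :
    volume {p : Euc n | ‖ContinuousLinearMap.adjoint A p‖ ≤ R} =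
      ENNReal.ofReal (|A.det|⁻¹ * R ^ n) * volume (ball (0 : Euc n) 1) := by
  have hs : {p : Euc n | ‖ContinuousLinearMap.adjoint A p‖ ≤ R} =
      ((ContinuousLinearMap.adjoint A : Euc n →L[ℝ] Euc n) : Euc n →ₗ[ℝ] Euc n) ⁻¹'
        closedBall 0 R := by
    ext p; simp
  have hd : LinearMap.det ((ContinuousLinearMap.adjoint A : Euc n →L[ℝ] Euc n) : Euc n →ₗ[ℝ] Euc n)
      = A.det := det_adj A
  rw [hs, Measure.addHaar_preimage_linearMap volume (by rw [hd]; exact hA), hd,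
    Measure.addHaar_closedBall volume _ hR, ← mul_assoc, ← ENNReal.ofReal_mul (abs_nonneg _),
    abs_inv, finrank_euclideanSpace_fin]

lemma ell_vol (A : Euc n →L[ℝ] Euc n) (x : Euc n) {s R : ℝ} (hs : 0 ≤ s) (hR : 0 ≤ R) :
    volume ((fun v => x + s • A v) '' closedBall (0 : Euc n) R) =
      ENNReal.ofReal (s ^ n * |A.det| * R ^ n) * volume (ball (0 : Euc n) 1) := by
  have : (fun v => x + s • A v) '' closedBall (0 : Euc n) R =
      (fun v => x + v) '' (((s • A : Euc n →L[ℝ] Euc n) : Euc n →ₗ[ℝ] Euc n) '' closedBall 0 R) := by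
    rw [image_image]; rfl
  rw [this, image_add_left, measure_preimage_add, Measure.addHaar_image_linearMap,
    Measure.addHaar_closedBall volume _ hR, ← mul_assoc, ← ENNReal.ofReal_mul (abs_nonneg _),
    finrank_euclideanSpace_fin]
  congr 3
  have : ((s • A : Euc n →L[ℝ] Euc n) : Euc n →ₗ[ℝ] Euc n) = s • (A : Euc n →ₗ[ℝ] Euc n) := rfl
  rw [this, LinearMap.det_smul, finrank_euclideanSpace_fin, abs_mul, abs_pow, abs_of_nonneg hs]

lemma polar_norm (A : Euc n →L[ℝ] Euc n) {δ h : ℝ} (hδ : 0 < δ) (hh : 0 ≤ h) {p : Euc n}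
    (hp : ∀ v ∈ closedBall (0 : Euc n) 1, inner ℝ p (δ • A v) ≤ h) :
    ‖ContinuousLinearMap.adjoint A p‖ ≤ h / δ := by
  set w := ContinuousLinearMap.adjoint A p with hw
  rcases (norm_nonneg w).eq_or_lt with h0 | h0
  · rw [← h0]; positivity
  have := hp (‖w‖⁻¹ • w) (by
    simp only [mem_closedBall_zero_iff, norm_smul, norm_inv, norm_norm]
    rw [inv_mul_cancel₀ h0.ne'])
  rw [inner_smul_right, ← ContinuousLinearMap.adjoint_inner_left, inner_smul_right, ← hw,
    real_inner_self_eq_norm_sq] at this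
  rw [le_div_iff₀ hδ]
  have e : δ * (‖w‖⁻¹ * ‖w‖ ^ 2) = ‖w‖ * δ := by field_simp
  linarith

end Pot

open Set MeasureTheory Metric Bornology
open scoped ENNReal NNReal Pointwise

section Core
open Topology Filter
variable {n : ℕ} {c : Euc n → Euc n → ℝ} {U V : Set (Euc n)}

/-- The gradient map. -/
noncomputable def Pmap (n : ℕ) (c : Euc n → Euc n → ℝ) (e : Euc n →L[ℝ] Euc n)
    (x ybar y : Euc n) : Euc n :=
  -(ContinuousLinearMap.adjoint e (gradX n c x y - gradX n c x ybar))

lemma core_est [Nontrivial (Euc n)] {bp bm D3 : ℝ} (h0 : B0cond n c U V) (h1 : B1cond n c U V)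
    (h2 : B2cond n c U V) (h3 : B3cond n c U V) (hU : U.Nonempty) (hV : V.Nonempty)
    (hb : CBds n c U V bp bm D3) {u : Euc n → ℝ}
    (hu : CConvexOn n c (closure U) (closure V) u) {ybar x₀ : Euc n} (hyb : ybar ∈ closure V)
    {A : Euc n →L[ℝ] Euc n} {a δ h : ℝ} (ha : 0 < a) (hδ : 0 < δ)
    (hKa : 2 * bp ^ 2 * bm ^ 4 * D3 * (2 * a) ≤ 1 / 4)
    (hball : closedBall x₀ (2 * a) ⊆ Uyset n c U ybar)
    (hA : ∀ v ∈ closedBall (0 : Euc n) 1, ‖δ • A v‖ ≤ a)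
    {Q : Set (Euc n)} (hQ : Q = {q ∈ clUy n c U ybar | modPot n c U ybar u q ≤ 0})
    (hE : ∀ v ∈ closedBall (0 : Euc n) 1, x₀ + δ • A v ∈ Q)
    (hh : |sInf (modPot n c U ybar u '' Q)| < h)
    {e : Euc n →L[ℝ] Euc n} (he : HasFDerivAt (xOf n c U ybar) e x₀)
    {v y : Euc n} (hv : v ∈ closedBall (0 : Euc n) 1) (hy : y ∈ closure V)
    (hs : y ∈ cSubdiffAt n (modCost n c U ybar) (clUy n c U ybar) (closure V)
      (modPot n c U ybar u) (x₀ + (δ / 2) • A v)) :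
    ‖ContinuousLinearMap.adjoint A (Pmap n c e (xOf n c U ybar x₀) ybar y)‖ ≤ 5 * h / δ := by
  have hh0 : 0 < h := (abs_nonneg _).trans_lt hh
  have hx₀ : x₀ ∈ Uyset n c U ybar := hball (mem_closedBall_self (by positivity))
  have hQs : Q ⊆ clUy n c U ybar := by rw [hQ]; exact sep_subset _ _
  obtain ⟨p, hp⟩ := lin_bdry h0 h1 h2 hU hV hb hyb hy hx₀
  have hpP : p = Pmap n c e (xOf n c U ybar x₀) ybar y := p_ident h0 h1 hyb hx₀ hy he hp
  rw [← hpP]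
  have hK0 : 0 ≤ 2 * bp ^ 2 * bm ^ 4 * D3 := by
    have := hb.p0; have := hb.m0; have := hb.d0; positivity
  set K := 2 * bp ^ 2 * bm ^ 4 * D3 with hK
  set q' := x₀ + (δ / 2) • A v with hq'
  set m : Euc n → ℝ := fun q => -modCost n c U ybar q y + modCost n c U ybar q' y +
      modPot n c U ybar u q' with hm
  have hle := supp_le h0 hV hu hs
  have hq'Q : q' ∈ Q := by
    have := hE ((2 : ℝ)⁻¹ • v) (by
      simp only [mem_closedBall_zero_iff, norm_smul] at hv ⊢
      norm_num; linarith [norm_nonneg v])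
    rw [map_smul, smul_smul] at this
    exact this
  refine polar_norm A hδ (by positivity) ?_
  have hmax : ∀ q1 ∈ closedBall x₀ (2 * a), ∀ q2 ∈ closedBall x₀ (2 * a),
      max ‖q1 - x₀‖ ‖q2 - x₀‖ ≤ 2 * a := fun q1 h1 q2 h2 =>
    max_le (mem_closedBall_iff_norm.1 h1) (mem_closedBall_iff_norm.1 h2)
  have key := dual_est m x₀ p a h K ((fun v => δ • A v) '' closedBall (0 : Euc n) 1) ha hh0 ?_ ?_ ?_
    ?_ ?_ ((δ / 2) • A v) ?_ ?_
  · intro v' hv'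
    exact key _ ⟨v', hv', rfl⟩
  · have hquasi := quasi_bdry h0 h1 h2 h3 hU hV hyb hy
    intro r
    have hc := (convex_closedBall x₀ (2 * a)).inter
      (hquasi (r - modCost n c U ybar q' y - modPot n c U ybar u q'))
    convert hc using 1
    ext q
    simp only [hm, mem_setOf_eq, mem_inter_iff]
    constructor
    · rintro ⟨h1, h2⟩; exact ⟨h1, hball h1, by linarith⟩
    · rintro ⟨h1, -, h2⟩; exact ⟨h1, by linarith⟩
  · intro q1 h1 q2 h2
    have := hp q1 (hball h1) q2 (hball h2)
    have e1 : m q1 - m q2 = (-modCost n c U ybar q1 y) - (-modCost n c U ybar q2 y) := by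
      simp only [hm]; ring
    rw [e1]
    refine this.trans ?_
    gcongr
    exact (mul_le_mul_of_nonneg_left (hmax q1 h1 q2 h2) hK0).trans hKa
  · intro q1 h1
    have := hp q1 (hball h1) x₀ hx₀
    have e1 : m q1 - m x₀ = (-modCost n c U ybar q1 y) - (-modCost n c U ybar x₀ y) := by
      simp only [hm]; ring
    rw [e1]
    refine this.trans (le_of_eq ?_)
    rw [sub_self, norm_zero, max_eq_left (norm_nonneg _)]
    ring
  · rintro _ ⟨v', hv', rfl⟩; exact hA v' hv'
  · rintro _ ⟨v', hv', rfl⟩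
    have hq := hE v' hv'
    refine (hle _ (hQs hq)).trans ?_
    rw [hQ] at hq; exact hq.2
  · exact ⟨v, hv, by simp only [smul_smul]; congr 1; ring⟩
  · have : m (x₀ + (δ / 2) • A v) = modPot n c U ybar u q' := by simp only [hm, ← hq']; ring
    rw [this]
    have := pot_ge h0 hV hu hyb hQs hq'Q
    linarith

lemma det_est [Nontrivial (Euc n)] {bp bm D3 : ℝ} (h0 : B0cond n c U V) (h1 : B1cond n c U V)
    (h2 : B2cond n c U V) (h3 : B3cond n c U V) (hU : U.Nonempty) (hV : V.Nonempty)
    (hb : CBds n c U V bp bm D3) {u : Euc n → ℝ}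
    (hu : CConvexOn n c (closure U) (closure V) u) {ybar x₀ : Euc n} (hyb : ybar ∈ closure V)
    {A : Euc n →L[ℝ] Euc n} {a δ h lam : ℝ} (ha : 0 < a) (hδ : 0 < δ) (hlam : 0 < lam)
    (hKa : 2 * bp ^ 2 * bm ^ 4 * D3 * (2 * a) ≤ 1 / 4)
    (hball : closedBall x₀ (2 * a) ⊆ Uyset n c U ybar)
    (hA : ∀ v ∈ closedBall (0 : Euc n) 1, ‖δ • A v‖ ≤ a)
    {Q Eδ : Set (Euc n)} (hQ : Q = {q ∈ clUy n c U ybar | modPot n c U ybar u q ≤ 0})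
    (hEδ : Eδ = (fun v => x₀ + δ • A v) '' closedBall (0 : Euc n) 1) (hEQ : Eδ ⊆ Q)
    (hma : MAge n (modCost n c U ybar) (clUy n c U ybar) (closure V)
          (modPot n c U ybar u) lam Eδ)
    (hh : |sInf (modPot n c U ybar u '' Q)| < h) (hdet : A.det ≠ 0) :
    lam * (δ / 2) ^ n * |A.det| ≤
      gammaMinus n (modCost n c U ybar) Q V * (|A.det|⁻¹ * (5 * h / δ) ^ n) := by
  have hh0 : 0 < h := (abs_nonneg _).trans_lt hh
  have hx₀ : x₀ ∈ Uyset n c U ybar := hball (mem_closedBall_self (by positivity))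
  have hQs : Q ⊆ clUy n c U ybar := by rw [hQ]; exact sep_subset _ _
  have hE : ∀ v ∈ closedBall (0 : Euc n) 1, x₀ + δ • A v ∈ Q := fun v hv =>
    hEQ (by rw [hEδ]; exact ⟨v, hv, rfl⟩)
  have hx₀Q : x₀ ∈ Q := by simpa using hE 0 (by simp)
  obtain ⟨e, he, -⟩ := xOf_fd h0 h1 hyb hx₀
  have hxU := (xOf_mem h1 hyb hx₀).1
  set γ := gammaMinus n (modCost n c U ybar) Q V with hγ
  set X : Set (Euc n) := (fun v => x₀ + (δ / 2) • A v) '' closedBall (0 : Euc n) 1 with hX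
  have hXE : X ⊆ Eδ := by
    rintro _ ⟨v, hv, rfl⟩
    rw [hEδ]
    refine ⟨(2 : ℝ)⁻¹ • v, ?_, ?_⟩
    · simp only [mem_closedBall_zero_iff, norm_smul] at hv ⊢
      norm_num; linarith [norm_nonneg v]
    · simp only [map_smul, smul_smul]; rfl
  have hXm : MeasurableSet X := by
    refine IsCompact.measurableSet ((isCompact_closedBall _ _).image ?_)
    fun_prop
  have hma1 := hma X hXE hXm
  rw [ell_vol A x₀ (by positivity) zero_le_one] at hma1
  set K : Set (Euc n) := {p : Euc n | ‖ContinuousLinearMap.adjoint A p‖ ≤ 5 * h / δ} with hK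
  have hKc : IsClosed K := isClosed_le (by fun_prop) continuous_const
  set P := Pmap n c (e : Euc n →L[ℝ] Euc n) (xOf n c U ybar x₀) ybar with hP
  have hsub : cSubdiffImg n (modCost n c U ybar) (clUy n c U ybar) (closure V)
      (modPot n c U ybar u) X ⊆ (V ∩ P ⁻¹' K) ∪ (closure V \ V) := by
    intro y hy
    simp only [cSubdiffImg, mem_iUnion] at hy
    obtain ⟨q, ⟨v, hv, rfl⟩, hy⟩ := hy
    have hyV : y ∈ closure V := hy.2.1
    by_cases hyV' : y ∈ V
    · left
      exact ⟨hyV', core_est h0 h1 h2 h3 hU hV hb hu hyb ha hδ hKa hball hA hQ hE hh he hv hyV hy⟩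
    · right; exact ⟨hyV, hyV'⟩
  have hPd : ∀ y ∈ V, HasFDerivAt P
      (-(ContinuousLinearMap.adjoint (DxyC n (modCost n c U ybar) x₀ y))) y := by
    intro y hy
    rw [DxyC_mod h0 h1 hyb hx₀ hy he, ContinuousLinearMap.adjoint_comp]
    exact (HasFDerivAt.comp (f := fun y' => gradX n c (xOf n c U ybar x₀) y' -
      gradX n c (xOf n c U ybar x₀) ybar) y
      (ContinuousLinearMap.hasFDerivAt (ContinuousLinearMap.adjoint (e : Euc n →L[ℝ] Euc n)))
      ((hasFD_gradX h0 hxU hy).sub_const _)).neg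
  have hPinj : InjOn P V := by
    intro y1 hy1 y2 hy2 heq
    refine (h1.2 _ (subset_closure hxU)).1 (subset_closure hy1) (subset_closure hy2) ?_
    have h4 : ContinuousLinearMap.adjoint (e : Euc n →L[ℝ] Euc n)
        (gradX n c (xOf n c U ybar x₀) y1 - gradX n c (xOf n c U ybar x₀) y2) = 0 := by
      have := neg_injective heq
      rw [← sub_eq_zero, ← map_sub] at this
      rw [← this]; congr 1; abel
    have h5 : gradX n c (xOf n c U ybar x₀) y1 - gradX n c (xOf n c U ybar x₀) y2 = 0 := by
      refine ext_inner_right ℝ fun w => ?_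
      have := congrArg (fun z => inner ℝ z (e.symm w)) h4
      simp only [ContinuousLinearMap.adjoint_inner_left, inner_zero_left] at this
      simpa using this
    simp only [sub_eq_zero.1 h5]
  have hgam : ∀ y ∈ V, (-(ContinuousLinearMap.adjoint (DxyC n (modCost n c U ybar) x₀ y))).det ≠ 0
      ∧ |(-(ContinuousLinearMap.adjoint (DxyC n (modCost n c U ybar) x₀ y))).det|⁻¹ ≤ γ := by
    intro y hy
    have habs : |(-(ContinuousLinearMap.adjoint (DxyC n (modCost n c U ybar) x₀ y))).det| =
        |LinearMap.det ((DxyC n (modCost n c U ybar) x₀ y : Euc n →L[ℝ] Euc n) :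
          Euc n →ₗ[ℝ] Euc n)| := by
      rw [← det_adj]
      set B := ContinuousLinearMap.adjoint (DxyC n (modCost n c U ybar) x₀ y)
      have : ((-B : Euc n →L[ℝ] Euc n) : Euc n →ₗ[ℝ] Euc n) =
        (-1 : ℝ) • (B : Euc n →ₗ[ℝ] Euc n) := by ext; simp
      change |LinearMap.det ((-B : Euc n →L[ℝ] Euc n) : Euc n →ₗ[ℝ] Euc n)| = _
      rw [this, LinearMap.det_smul, abs_mul, abs_pow]; simp
    constructor
    · rw [← abs_ne_zero, habs, DxyC_mod h0 h1 hyb hx₀ hy he, abs_ne_zero]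
      obtain ⟨f, hf, -⟩ := DxyC_equiv h0 h1 hxU hy
      rw [← hf]
      exact (LinearEquiv.isUnit_det' (e.trans f).toLinearEquiv).ne_zero
    · rw [habs, hγ, gammaMinus]
      exact le_csSup (gamma_bdd h0 h1 h2 hU hV hb hyb hQs) ⟨(x₀, y), mk_mem_prod hx₀Q hy, rfl⟩
  have hγ0 : 0 ≤ γ := by
    obtain ⟨y, hy⟩ := hV
    exact (inv_nonneg.2 (abs_nonneg _)).trans (hgam y hy).2
  have hvol := vol_bound h0.2.2.1 hPd hPinj hgam hKc
  have hvol2 : volume (cSubdiffImg n (modCost n c U ybar) (clUy n c U ybar) (closure V)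
      (modPot n c U ybar u) X) ≤ ENNReal.ofReal γ * volume K := by
    refine (measure_mono hsub).trans ((measure_union_le _ _).trans ?_)
    rw [clV_null h0 h1 h2 hU, add_zero]; exact hvol
  have hfin := hma1.trans hvol2
  rw [hK, polar_vol A hdet (by positivity), ← mul_assoc, ← mul_assoc,
    ← ENNReal.ofReal_mul hlam.le, ← ENNReal.ofReal_mul hγ0] at hfin
  have hω0 : volume (ball (0 : Euc n) 1) ≠ 0 := (measure_ball_pos volume _ one_pos).ne'
  have hωt : volume (ball (0 : Euc n) 1) ≠ ⊤ := measure_ball_lt_top.ne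
  rw [ENNReal.mul_le_mul_iff_left hω0 hωt] at hfin
  rw [ENNReal.ofReal_le_ofReal_iff (by positivity)] at hfin
  rw [one_pow, mul_one] at hfin
  linarith

end Core

open Set MeasureTheory Metric Bornology
open scoped ENNReal NNReal Pointwise

section Fin
open Topology Filter

lemma fin_arith {n : ℕ} {D γ lam δ h w v : ℝ} (hD : 0 < D) (hlam : 0 < lam) (hδ : 0 < δ)
    (hw : 0 ≤ w) (hv0 : 0 ≤ v) (hv : v ≤ (n : ℝ) ^ n * D * w) (hh : 0 ≤ h)
    (H : lam * (δ / 2) ^ n * D ≤ γ * (D⁻¹ * (5 * h / δ) ^ n)) :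
    v ^ 2 ≤ ((n : ℝ) ^ (2 * n) * w ^ 2 * 10 ^ n + 1) * (γ / (δ ^ (2 * n) * lam)) * h ^ n := by
  have h1 : D ^ 2 ≤ 10 ^ n * (γ / (δ ^ (2 * n) * lam)) * h ^ n := by
    have e : 10 ^ n * (γ / (δ ^ (2 * n) * lam)) * h ^ n =
        (γ * (D⁻¹ * (5 * h / δ) ^ n)) * (D / (lam * (δ / 2) ^ n)) := by
      have : (10 : ℝ) ^ n = 5 ^ n * 2 ^ n := by rw [← mul_pow]; norm_num
      rw [this, div_pow, div_pow, mul_pow]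
      field_simp
      ring
    rw [e]
    have e2 : D ^ 2 = (lam * (δ / 2) ^ n * D) * (D / (lam * (δ / 2) ^ n)) := by
      field_simp
    rw [e2]
    exact mul_le_mul_of_nonneg_right H (by positivity)
  have h2 : 0 ≤ (γ / (δ ^ (2 * n) * lam)) * h ^ n := by
    have : 0 ≤ 10 ^ n * ((γ / (δ ^ (2 * n) * lam)) * h ^ n) := by
      rw [← mul_assoc]; exact (sq_nonneg D).trans h1
    exact nonneg_of_mul_nonneg_right this (by positivity)
  calc v ^ 2 ≤ ((n : ℝ) ^ n * D * w) ^ 2 := by gcongr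
    _ = ((n : ℝ) ^ (2 * n) * w ^ 2) * D ^ 2 := by ring
    _ ≤ ((n : ℝ) ^ (2 * n) * w ^ 2) * (10 ^ n * (γ / (δ ^ (2 * n) * lam)) * h ^ n) := by gcongr
    _ ≤ ((n : ℝ) ^ (2 * n) * w ^ 2) * (10 ^ n * (γ / (δ ^ (2 * n) * lam)) * h ^ n) +
        (γ / (δ ^ (2 * n) * lam)) * h ^ n := by linarith
    _ = _ := by ring

lemma gamma_nonneg (n : ℕ) (c : Euc n → Euc n → ℝ) (U V : Set (Euc n)) :
    0 ≤ gammaMinus n c U V := by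
  refine Real.sSup_nonneg ?_
  rintro _ ⟨p, -, rfl⟩
  exact inv_nonneg.2 (abs_nonneg _)

end Fin

theorem alexandrov_lower_bound (n : ℕ) :
    ∃ C : ℝ, 0 < C ∧
      ∀ (c : Euc n → Euc n → ℝ) (U V : Set (Euc n)) (u : Euc n → ℝ)
        (ybar x₀ : Euc n) (lam δ : ℝ) (L : Euc n →ᵃ[ℝ] Euc n)
        (Q E Eδ : Set (Euc n)),
        B0cond n c U V → B1cond n c U V → B2cond n c U V → B3cond n c U V →
        ybar ∈ closure V →
        CConvexOn n c (closure U) (closure V) u →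
        0 < lam → 0 < δ →
        -- `Q = {ũ ≤ 0}` and `E` the John ellipsoid of `Q`
        Q = {q ∈ clUy n c U ybar | modPot n c U ybar u q ≤ 0} →
        E = L '' Metric.closedBall 0 1 →
        E ⊆ Q → Q ⊆ L '' Metric.closedBall 0 (n : ℝ) →
        -- the small ellipsoid `E_δ = x₀ + δ·E`
        Eδ = (fun e => x₀ + δ • (e - L 0)) '' E →
        Eδ ⊆ Q →
        δ ≤ min 1 (epsC n c U V / (4 * Metric.diam E)) →
        -- `|∂^{c̃}ũ| ≥ λ` inside `E_δ`
        MAge n (modCost n c U ybar) (clUy n c U ybar) (closure V)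
          (modPot n c U ybar u) lam Eδ →
        -- `E_δ ⊂ B ⊂ 4·B ⊂ U_ȳ`
        (∃ z r, 0 < r ∧ Eδ ⊆ Metric.ball z r ∧
          Metric.ball z (4 * r) ⊆ Uyset n c U ybar) →
        (volume Q).toReal ^ 2 ≤
          C * (gammaMinus n (modCost n c U ybar) Q V / (δ ^ (2 * n) * lam)) *
            |sInf (modPot n c U ybar u '' Q)| ^ n := by
  refine ⟨(n : ℝ) ^ (2 * n) * (volume (ball (0 : Euc n) 1)).toReal ^ 2 * 10 ^ n + 1,
    by positivity, ?_⟩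
  intro c U V u ybar x₀ lam δ L Q E Eδ h0 h1 h2 h3 hyb hu hlam hδ hQ hE hEQ hQE hEδ hEδQ hδle hma
    ⟨z, r, hr, hEB, hBU⟩
  set A : Euc n →L[ℝ] Euc n := LinearMap.toContinuousLinearMap L.linear with hAdef
  have hL : ∀ v, L v = L 0 + A v := by
    intro v
    have := congrFun (AffineMap.decomp L) v
    simp only [Pi.add_apply] at this
    rw [this, add_comm]; rfl
  have hVne : V.Nonempty := closure_nonempty_iff.1 ⟨_, hyb⟩
  have hUne : U.Nonempty := by
    have : (Uyset n c U ybar).Nonempty := ⟨z, hBU (mem_ball_self (by positivity))⟩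
    exact this.of_image
  have hδ2 := hδle.trans (min_le_right _ _)
  have hdiam : 0 < diam E := by
    rcases (diam_nonneg (s := E)).eq_or_lt with h | h
    · rw [← h, mul_zero, div_zero] at hδ2; linarith
    · exact h
  have heps : δ * (4 * diam E) ≤ epsC n c U V := by
    rwa [le_div_iff₀ (by positivity)] at hδ2
  have heps0 : 0 < epsC n c U V := lt_of_lt_of_le (by positivity) heps
  have : Nontrivial (Euc n) := by
    by_contra hc
    rw [not_nontrivial_iff_subsingleton] at hc
    have : diam E = 0 := diam_subsingleton (Set.subsingleton_of_subsingleton)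
    linarith
  obtain ⟨hb, hKe⟩ := cbds_of_eps h0 h1 hUne hVne heps0
  have hEb : IsBounded E := by
    rw [hE]
    have : IsCompact (L '' closedBall 0 1) := (isCompact_closedBall _ _).image (by
      have : (L : Euc n → Euc n) = fun v => L 0 + A v := funext hL
      rw [this]; fun_prop)
    exact this.isBounded
  have hEδ' : Eδ = (fun v => x₀ + δ • A v) '' closedBall (0 : Euc n) 1 := by
    rw [hEδ, hE, image_image]
    refine image_congr fun v _ => ?_
    rw [hL v, add_sub_cancel_left]
  have hx₀E : x₀ ∈ Eδ := by rw [hEδ']; exact ⟨0, by simp, by simp⟩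
  set a := δ * diam E / 2 with ha_def
  have ha : 0 < a := by positivity
  have hKa : 2 * betaPlus n c U V ^ 2 * betaMinus n c U V ^ 4 * supDxxy n c U V * (2 * a) ≤ 1 / 4 := by
    have hK0 : 0 ≤ 2 * betaPlus n c U V ^ 2 * betaMinus n c U V ^ 4 * supDxxy n c U V := by
      have := hb.p0; have := hb.m0; have := hb.d0; positivity
    have h5 : 2 * a ≤ epsC n c U V / 4 := by rw [ha_def]; linarith
    have h6 := mul_le_mul_of_nonneg_left h5 hK0
    linarith
  have har : a ≤ r := by
    have : diam E ≤ 2 * r / δ := by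
      refine diam_le_of_forall_dist_le (by positivity) ?_
      intro e1 he1 e2 he2
      have m1 : x₀ + δ • (e1 - L 0) ∈ ball z r := hEB (by rw [hEδ]; exact ⟨e1, he1, rfl⟩)
      have m2 : x₀ + δ • (e2 - L 0) ∈ ball z r := hEB (by rw [hEδ]; exact ⟨e2, he2, rfl⟩)
      have hd := dist_triangle_right (x₀ + δ • (e1 - L 0)) (x₀ + δ • (e2 - L 0)) z
      have heq : dist (x₀ + δ • (e1 - L 0)) (x₀ + δ • (e2 - L 0)) = δ * dist e1 e2 := by
        rw [dist_add_left, dist_smul₀, dist_sub_right, Real.norm_eq_abs, abs_of_pos hδ]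
      rw [le_div_iff₀ hδ]
      rw [mem_ball] at m1 m2
      linarith
    rw [le_div_iff₀ hδ] at this
    rw [ha_def]; linarith
  have hball : closedBall x₀ (2 * a) ⊆ Uyset n c U ybar := by
    refine Subset.trans ?_ hBU
    intro q hq
    have hx := hEB hx₀E
    rw [mem_ball] at hx ⊢
    rw [mem_closedBall] at hq
    have := dist_triangle q x₀ z
    linarith
  have hA : ∀ v ∈ closedBall (0 : Euc n) 1, ‖δ • A v‖ ≤ a := by
    intro v hv
    have m1 : L v ∈ E := by rw [hE]; exact ⟨v, hv, rfl⟩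
    have m2 : L (-v) ∈ E := by
      rw [hE]; exact ⟨-v, by simpa using hv, rfl⟩
    have hd := dist_le_diam_of_mem hEb m1 m2
    have e1 : dist (L v) (L (-v)) = 2 * ‖A v‖ := by
      rw [hL v, hL (-v), dist_add_left, map_neg, dist_eq_norm, sub_neg_eq_add, ← two_smul ℝ,
        norm_smul]; norm_num
    rw [norm_smul, Real.norm_eq_abs, abs_of_pos hδ, ha_def]
    rw [e1] at hd
    have := mul_le_mul_of_nonneg_left hd hδ.le
    linarith
  have hvolQ : volume Q ≤ ENNReal.ofReal ((n : ℝ) ^ n * |A.det| *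
      (volume (ball (0 : Euc n) 1)).toReal) := by
    refine (measure_mono hQE).trans ?_
    have : L '' closedBall 0 (n : ℝ) = (fun v => L 0 + (1 : ℝ) • A v) '' closedBall (0 : Euc n) n := by
      refine image_congr fun v _ => ?_
      rw [hL v, one_smul]
    rw [this, ell_vol A (L 0) zero_le_one (Nat.cast_nonneg n),
      ENNReal.ofReal_mul (p := (n : ℝ) ^ n * |A.det|) (by positivity),
      ENNReal.ofReal_toReal measure_ball_lt_top.ne, one_pow, one_mul, mul_comm (|A.det|)]
  have hv : (volume Q).toReal ≤ (n : ℝ) ^ n * |A.det| * (volume (ball (0 : Euc n) 1)).toReal :=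
    ENNReal.toReal_le_of_le_ofReal (by positivity) hvolQ
  by_cases hdet : A.det = 0
  · have hz : (volume Q).toReal = 0 := by
      refine le_antisymm ?_ ENNReal.toReal_nonneg
      rw [hdet] at hv; simpa using hv
    rw [hz]
    have := gamma_nonneg n (modCost n c U ybar) Q V
    have h7 : (0 : ℝ) ^ 2 = 0 := by norm_num
    rw [h7]; positivity
  have hstep : ∀ h : ℝ, |sInf (modPot n c U ybar u '' Q)| < h → (volume Q).toReal ^ 2 ≤
      ((n : ℝ) ^ (2 * n) * (volume (ball (0 : Euc n) 1)).toReal ^ 2 * 10 ^ n + 1) *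
        (gammaMinus n (modCost n c U ybar) Q V / (δ ^ (2 * n) * lam)) * h ^ n := by
    intro h hh
    exact fin_arith (abs_pos.2 hdet) hlam hδ ENNReal.toReal_nonneg ENNReal.toReal_nonneg hv
      ((abs_nonneg _).trans hh.le)
      (det_est h0 h1 h2 h3 hUne hVne hb hu hyb ha hδ hlam hKa hball hA hQ hEδ' hEδQ hma hh hdet)
  set H := |sInf (modPot n c U ybar u '' Q)| with hH
  have hcont : Continuous fun h : ℝ =>
      ((n : ℝ) ^ (2 * n) * (volume (ball (0 : Euc n) 1)).toReal ^ 2 * 10 ^ n + 1) *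
        (gammaMinus n (modCost n c U ybar) Q V / (δ ^ (2 * n) * lam)) * h ^ n := by fun_prop
  refine ge_of_tendsto (hcont.continuousWithinAt (s := Ioi H) (x := H)).tendsto ?_
  filter_upwards [self_mem_nhdsWithin] with h hh
  exact hstep h hh
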